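/- There exists an absolute constant M > 0 such that for every ε > 0 and every V > 0 there exists A > 0 (depending only on ε and V) with the following property. Let 1 < a < b < 4 and 0 < κ ≤ 1, and let (v, p, θ, R, f) be smooth functions on ℝ × T³, vanishing for t outside (a, b), which solve the Boussinesq–Stress system and satisfy ‖v‖₀ ≤ V, ‖R‖₀ ≤ κ, ‖f‖₀ ≤ κ. Set Λ := max{1, ‖R‖_{C¹}, ‖f‖_{C¹}, ‖v‖_{C¹}, ‖θ‖_{C¹}} and Λ̄ := max{1, ‖R‖_{C¹_z}, ‖f‖_{C¹_z}, ‖v‖_{C¹_z}, ‖θ‖_{C¹_z}}. Then for every κ̄ with 0 < κ̄ ≤ κ^{3/2} there exist smooth functions (ṽ, p̃, θ̃, R̃, f̃) on ℝ × T³, vanishing for t outside (a−κ, b+κ), which solve the Boussinesq–Stress system and satisfy: ‖R̃‖₀ ≤ κ̄; ‖f̃‖₀ ≤ κ̄; ‖ṽ − v‖₀ ≤ M√κ; ‖θ̃ − θ‖₀ ≤ M√κ; p̃ = p; max{1, ‖R̃‖_{C¹}, ‖f̃‖_{C¹}, ‖ṽ‖_{C¹}, ‖θ̃‖_{C¹}}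 ≤ A(κ^{(6+11ε)/2}(κ/κ̄²)^{6+16ε} Λ^{(1+ε)⁶} + κ^{5.5+11ε} Λ̄^{2(1+ε)⁵} κ̄^{−(6+16ε)} (√κ/κ̄)^{7+21ε}); max{1, ‖R̃‖_{C¹_z}, ‖f̃‖_{C¹_z}, ‖ṽ‖_{C¹_z}, ‖θ̃‖_{C¹_z}} ≤ A(κ/κ̄)⁶ Λ̄; and more precisely ‖∂_z θ̃‖₀ ≤ A(κ/κ̄)³ Λ̄ and ‖∂_t θ̃‖₀ + ‖∂_x θ̃‖₀ + ‖∂_y θ̃‖₀ ≤ A(κ^{(3+ε)/2}(κ/κ̄²)^{3+4ε} Λ^{(1+ε)³} + κ^{5/2+ε} Λ̄^{2(1+ε)²} κ̄^{−(3+4ε)} (√κ/κ̄)^{4+6ε}). -/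

import Mathlib

open MeasureTheory

noncomputable section

/-- Space-time ℝ × ℝ³; spatial functions are 2π-periodic, modelling ℝ × T³. -/
abbrev SpaceTime := ℝ × (Fin 3 → ℝ)

/-- 2π-periodicity in each spatial variable. -/
def stPeriodic {E : Type*} (f : SpaceTime → E) : Prop :=
  ∀ (t : ℝ) (x : Fin 3 → ℝ) (m : Fin 3 → ℤ),
    f (t, fun i => x i + 2 * Real.pi * m i) = f (t, x)

/-- Time derivative. -/
noncomputable def tderiv {E : Type*} [NormedAddCommGroup E] [NormedSpace ℝ E]
    (f : SpaceTime → E) (q : SpaceTime) : E :=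
  deriv (fun s => f (s, q.2)) q.1

/-- Spatial partial derivative in direction i (i = 0,1,2 for x,y,z). -/
noncomputable def sderiv {E : Type*} [NormedAddCommGroup E] [NormedSpace ℝ E]
    (i : Fin 3) (f : SpaceTime → E) (q : SpaceTime) : E :=
  deriv (fun s => f (q.1, Function.update q.2 i s)) (q.2 i)

/-- ‖f‖₀ : sup norm over space-time. -/
noncomputable def supNorm {α : Type*} {E : Type*} [NormedAddCommGroup E] (f : α → E) : ℝ :=
  ⨆ x, ‖f x‖

/-- ‖f‖_{C¹} = ‖f‖₀ + [f]₁ + ‖∂_t f‖₀, where [f]₁ is the max of the first spatial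
derivatives in sup norm. -/
noncomputable def c1Norm {E : Type*} [NormedAddCommGroup E] [NormedSpace ℝ E]
    (f : SpaceTime → E) : ℝ :=
  supNorm f + (⨆ i : Fin 3, supNorm (sderiv i f)) + supNorm (tderiv f)

/-- ‖f‖_{C¹_z} = ‖f‖₀ + ‖∂_z f‖₀. -/
noncomputable def czNorm {E : Type*} [NormedAddCommGroup E] [NormedSpace ℝ E]
    (f : SpaceTime → E) : ℝ :=
  supNorm f + supNorm (sderiv 2 f)

/-- The Boussinesq–Stress system:
∂_t v + div(v⊗v) + ∇p − ∂_zz v = θe₃ + div R, div v = 0,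
∂_t θ + div(vθ) − ∂_zz θ = div f. -/
def BoussStress (v : SpaceTime → Fin 3 → ℝ) (p θ : SpaceTime → ℝ)
    (R : SpaceTime → Fin 3 → Fin 3 → ℝ) (f : SpaceTime → Fin 3 → ℝ) : Prop :=
  (∀ (q : SpaceTime) (i : Fin 3),
    tderiv (fun r => v r i) q
      + (∑ j, sderiv j (fun r => v r i * v r j) q)
      + sderiv i p q
      - sderiv 2 (sderiv 2 fun r => v r i) q
      = θ q * (if i = 2 then 1 else 0) + ∑ j, sderiv j (fun r => R r i j) q) ∧
  (∀ q : SpaceTime, (∑ i, sderiv i (fun r => v r i) q) = 0) ∧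
  (∀ q : SpaceTime,
    tderiv θ q + (∑ j, sderiv j (fun r => v r j * θ r) q)
      - sderiv 2 (sderiv 2 θ) q
      = ∑ j, sderiv j (fun r => f r j) q)

/-- Λ = max{1, ‖R‖_{C¹}, ‖f‖_{C¹}, ‖v‖_{C¹}, ‖θ‖_{C¹}}. -/
noncomputable def Lam (v f : SpaceTime → Fin 3 → ℝ) (θ : SpaceTime → ℝ)
    (R : SpaceTime → Fin 3 → Fin 3 → ℝ) : ℝ :=
  max 1 (max (c1Norm R) (max (c1Norm f) (max (c1Norm v) (c1Norm θ))))

/-- Λ̄ = max{1, ‖R‖_{C¹_z}, ‖f‖_{C¹_z}, ‖v‖_{C¹_z}, ‖θ‖_{C¹_z}}. -/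
noncomputable def LamZ (v f : SpaceTime → Fin 3 → ℝ) (θ : SpaceTime → ℝ)
    (R : SpaceTime → Fin 3 → Fin 3 → ℝ) : ℝ :=
  max 1 (max (czNorm R) (max (czNorm f) (max (czNorm v) (czNorm θ))))

/-- The algebra of smooth real functions on space-time that are `2π`-periodic in space. -/
def smoothPeriodic : Subalgebra ℝ (SpaceTime → ℝ) where
  carrier := {g | ContDiff ℝ (⊤ : ℕ∞) g ∧ stPeriodic g}
  mul_mem' := fun {f g} hf hg => ⟨hf.1.mul hg.1, fun t x m => by
    simp only [Pi.mul_apply, hf.2 t x m, hg.2 t x m]⟩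
  add_mem' := fun {f g} hf hg => ⟨hf.1.add hg.1, fun t x m => by
    simp only [Pi.add_apply, hf.2 t x m, hg.2 t x m]⟩
  algebraMap_mem' := fun _ => ⟨contDiff_const, fun _ _ _ => rfl⟩

/-- Bundled smooth functions on `ℝ × T³`. -/
abbrev SPF : Type := ↥smoothPeriodic

instance : CoeFun SPF (fun _ => SpaceTime → ℝ) := ⟨Subtype.val⟩

/-- Directions: `none` is time, `some i` the `i`-th spatial direction.  The same type indexes the
components of the pair (velocity, temperature): `none` is the temperature. -/
abbrev Dir := Option (Fin 3)

namespace SPF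

theorem smooth (g : SPF) : ContDiff ℝ (⊤ : ℕ∞) (g : SpaceTime → ℝ) := g.2.1

theorem periodic (g : SPF) : stPeriodic (g : SpaceTime → ℝ) := g.2.2

theorem differentiable (g : SPF) : Differentiable ℝ (g : SpaceTime → ℝ) :=
  g.smooth.differentiable (by simp)

@[ext] theorem ext' {f g : SPF} (h : ∀ q, f q = g q) : f = g := Subtype.ext (funext h)

@[simp] theorem add_apply (f g : SPF) (q : SpaceTime) : (f + g) q = f q + g q := rfl
@[simp] theorem sub_apply (f g : SPF) (q : SpaceTime) : (f - g) q = f q - g q := rfl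
@[simp] theorem neg_apply (f : SPF) (q : SpaceTime) : (-f) q = -f q := rfl
@[simp] theorem mul_apply (f g : SPF) (q : SpaceTime) : (f * g) q = f q * g q := rfl
@[simp] theorem smul_apply (c : ℝ) (f : SPF) (q : SpaceTime) : (c • f) q = c * f q := rfl
@[simp] theorem zero_apply (q : SpaceTime) : (0 : SPF) q = 0 := rfl
@[simp] theorem one_apply (q : SpaceTime) : (1 : SPF) q = 1 := rfl
@[simp] theorem algebraMap_apply (c : ℝ) (q : SpaceTime) : (algebraMap ℝ SPF c) q = c := rfl
@[simp] theorem sum_apply {ι : Type*} (s : Finset ι) (f : ι → SPF) (q : SpaceTime) :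
    (∑ i ∈ s, f i) q = ∑ i ∈ s, f i q := by
  rw [AddSubmonoidClass.coe_finsetSum, Finset.sum_apply]

/-- The coordinate vector of a direction. -/
def dvec : Dir → SpaceTime
  | none => (1, 0)
  | some i => (0, Pi.single i 1)

theorem shift_periodic {E : Type*} {g : SpaceTime → E} (hg : stPeriodic g) (m : Fin 3 → ℤ)
    (q : SpaceTime) : g (q + (0, fun i => 2 * Real.pi * m i)) = g q := by
  have := hg q.1 q.2 m
  simpa [Prod.ext_iff] using (show g (q + (0, fun i => 2 * Real.pi * m i)) = g q by
    convert this using 2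
    ext <;> simp)

theorem periodic_iff {E : Type*} {g : SpaceTime → E} :
    stPeriodic g ↔ ∀ (m : Fin 3 → ℤ) (q : SpaceTime),
      g (q + (0, fun i => 2 * Real.pi * m i)) = g q :=
  ⟨fun h m q => shift_periodic h m q, fun h t x m => by
    rw [← h m (t, x)]
    congr 1
    ext <;> simp⟩

theorem fderiv_mem (g : SPF) (v : SpaceTime) :
    (fun q => fderiv ℝ (g : SpaceTime → ℝ) q v) ∈ smoothPeriodic := by
  refine ⟨?_, ?_⟩
  · exact (g.smooth.fderiv_right (m := (⊤ : ℕ∞)) (by simp)).clm_apply contDiff_const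
  · rw [periodic_iff]
    intro m q
    have : (g : SpaceTime → ℝ) = fun p => g (p + (0, fun i => 2 * Real.pi * m i)) :=
      funext fun p => (shift_periodic g.periodic m p).symm
    conv_rhs => rw [this]
    rw [fderiv_comp_add_right]

/-- The partial derivative in the direction `d`, as a derivation. -/
def pd (d : Dir) : Derivation ℝ SPF SPF :=
  Derivation.mk'
    { toFun := fun g => ⟨fun q => fderiv ℝ (g : SpaceTime → ℝ) q (dvec d), fderiv_mem g _⟩
      map_add' := fun f g => by
        ext q
        change fderiv ℝ ((f : SpaceTime → ℝ) + (g : SpaceTime → ℝ)) q _ = _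
        rw [fderiv_add (f.differentiable q) (g.differentiable q)]
        rfl
      map_smul' := fun c f => by
        ext q
        change fderiv ℝ (c • (f : SpaceTime → ℝ)) q _ = _
        rw [fderiv_const_smul (f.differentiable q)]
        rfl }
    (fun f g => by
      ext q
      change fderiv ℝ ((f : SpaceTime → ℝ) * (g : SpaceTime → ℝ)) q _ = _
      rw [fderiv_mul (f.differentiable q) (g.differentiable q)]
      rfl)

theorem pd_apply (d : Dir) (g : SPF) (q : SpaceTime) :
    pd d g q = fderiv ℝ (g : SpaceTime → ℝ) q (dvec d) := rfl

theorem pd_mul (d : Dir) (f g : SPF) : pd d (f * g) = pd d f * g + f * pd d g := by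
  rw [(pd d).leibniz, smul_eq_mul, smul_eq_mul]; ring

theorem hasDerivAt_line (g : SPF) (q v : SpaceTime) (s : ℝ) :
    HasDerivAt (fun s : ℝ => g (q + s • v)) (fderiv ℝ (g : SpaceTime → ℝ) (q + s • v) v) s := by
  have h1 : HasDerivAt (fun s : ℝ => q + s • v) v s := by
    simpa using ((hasDerivAt_id s).smul_const v).const_add q
  exact (g.differentiable (q + s • v)).hasFDerivAt.comp_hasDerivAt s h1

theorem pd_comm (d e : Dir) (g : SPF) : pd d (pd e g) = pd e (pd d g) := by
  ext q
  have hs : IsSymmSndFDerivAt ℝ (g : SpaceTime → ℝ) q :=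
    (g.smooth.contDiffAt).isSymmSndFDerivAt (by
      simpa using WithTop.coe_le_coe.2 (le_top : (2 : ℕ∞) ≤ ⊤))
  have key : ∀ a b : SpaceTime, fderiv ℝ (fun p => fderiv ℝ (g : SpaceTime → ℝ) p a) q b
      = fderiv ℝ (fderiv ℝ (g : SpaceTime → ℝ)) q b a := by
    intro a b
    have hd : DifferentiableAt ℝ (fderiv ℝ (g : SpaceTime → ℝ)) q :=
      ((g.smooth.fderiv_right (m := (⊤ : ℕ∞)) (by simp)).differentiable (by simp)) q
    rw [fderiv_clm_apply hd (differentiableAt_const a)]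
    simp
  change fderiv ℝ (fun p => fderiv ℝ (g : SpaceTime → ℝ) p (dvec e)) q (dvec d)
    = fderiv ℝ (fun p => fderiv ℝ (g : SpaceTime → ℝ) p (dvec d)) q (dvec e)
  rw [key, key]
  exact hs _ _

theorem tderiv_eq (g : SPF) : tderiv (g : SpaceTime → ℝ) = pd none g := by
  funext q
  have h := hasDerivAt_line g (0, q.2) (dvec none) q.1
  have e : ∀ s : ℝ, ((0, q.2) : SpaceTime) + s • dvec none = (s, q.2) := fun s => by
    ext <;> simp [dvec]
  simp only [e] at h
  exact h.deriv

theorem sderiv_eq (i : Fin 3) (g : SPF) : sderiv i (g : SpaceTime → ℝ) = pd (some i) g := by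
  funext q
  have h := hasDerivAt_line g (q.1, Function.update q.2 i 0) (dvec (some i)) (q.2 i)
  have e : ∀ s : ℝ, ((q.1, Function.update q.2 i 0) : SpaceTime) + s • dvec (some i)
      = (q.1, Function.update q.2 i s) := fun s => by
    refine Prod.ext (by simp [dvec]) (funext fun j => ?_)
    by_cases hj : j = i
    · subst hj; simp [dvec]
    · simp [dvec, hj]
  simp only [e, Function.update_eq_self] at h
  exact h.deriv

/-- Composition of a smooth function of one variable with an element of `SPF`. -/
def comp (F : ℝ → ℝ) (hF : ContDiff ℝ (⊤ : ℕ∞) F) (g : SPF) : SPF :=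
  ⟨fun q => F (g q), hF.comp g.smooth, fun t x m =>
    congrArg F (g.periodic t x m)⟩

@[simp] theorem comp_apply (F : ℝ → ℝ) (hF : ContDiff ℝ (⊤ : ℕ∞) F) (g : SPF) (q : SpaceTime) :
    comp F hF g q = F (g q) := rfl

theorem contDiff_deriv {F : ℝ → ℝ} (hF : ContDiff ℝ (⊤ : ℕ∞) F) :
    ContDiff ℝ (⊤ : ℕ∞) (deriv F) := (contDiff_infty_iff_deriv.1 hF).2

theorem pd_comp (d : Dir) (F : ℝ → ℝ) (hF : ContDiff ℝ (⊤ : ℕ∞) F) (g : SPF) :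
    pd d (comp F hF g) = comp (deriv F) (contDiff_deriv hF) g * pd d g := by
  ext q
  have h1 : HasDerivAt F (deriv F (g q)) (g q) :=
    ((hF.differentiable (by simp)) (g q)).hasDerivAt
  have h2 := h1.comp_hasFDerivAt q (g.differentiable q).hasFDerivAt
  change fderiv ℝ (F ∘ g) q (dvec d) = _
  rw [h2.fderiv]
  simp [pd_apply]

/-- The time coordinate. -/
def time : SPF := ⟨fun q => q.1, contDiff_fst, fun _ _ _ => rfl⟩

@[simp] theorem time_apply (q : SpaceTime) : time q = q.1 := rfl

theorem pd_time (d : Dir) : pd d time = algebraMap ℝ SPF (if d = none then 1 else 0) := by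
  ext q
  change fderiv ℝ (Prod.fst : SpaceTime → ℝ) q (dvec d) = _
  rw [fderiv_fst]
  cases d <;> simp [dvec]

/-- The plane wave `cos (ω t + ξ · x + σ)`. -/
def wave (ξ : Fin 3 → ℤ) (ω σ : ℝ) : SPF :=
  ⟨fun q => Real.cos (ω * q.1 + ∑ j, ξ j * q.2 j + σ), by
    refine ⟨Real.contDiff_cos.comp (by fun_prop), fun t x m => ?_⟩
    have : ω * t + ∑ j, (ξ j : ℝ) * (x j + 2 * Real.pi * m j) + σ
        = ω * t + ∑ j, (ξ j : ℝ) * x j + σ + (∑ j, ξ j * m j : ℤ) * (2 * Real.pi) := by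
      push_cast
      simp only [Fin.sum_univ_three]
      ring
    change Real.cos (ω * t + ∑ j, (ξ j : ℝ) * (x j + 2 * Real.pi * m j) + σ) = _
    rw [this, Real.cos_add_int_mul_two_pi]⟩

theorem wave_apply (ξ : Fin 3 → ℤ) (ω σ : ℝ) (q : SpaceTime) :
    wave ξ ω σ q = Real.cos (ω * q.1 + ∑ j, ξ j * q.2 j + σ) := rfl

theorem pd_wave (d : Dir) (ξ : Fin 3 → ℤ) (ω σ : ℝ) :
    pd d (wave ξ ω σ) = (d.elim ω (fun j => (ξ j : ℝ))) • wave ξ ω (σ + Real.pi / 2) := by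
  ext q
  have h1 := hasDerivAt_line (wave ξ ω σ) q (dvec d) 0
  simp only [zero_smul, add_zero] at h1
  have h2 : HasDerivAt (fun s : ℝ => wave ξ ω σ (q + s • dvec d))
      ((d.elim ω (fun j => (ξ j : ℝ))) * wave ξ ω (σ + Real.pi / 2) q) 0 := by
    have e : ∀ s : ℝ, wave ξ ω σ (q + s • dvec d)
        = Real.cos (ω * q.1 + ∑ j, ξ j * q.2 j + σ + s * (d.elim ω (fun j => (ξ j : ℝ)))) := by
      intro s
      rw [wave_apply]
      congr 1
      cases d with
      | none => simp [dvec]; ring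
      | some i =>
        simp only [dvec, Prod.fst_add, Prod.smul_fst, smul_eq_mul, mul_zero, add_zero,
          Prod.snd_add, Prod.smul_snd, Pi.add_apply, Pi.smul_apply, mul_add, Finset.sum_add_distrib,
          Option.elim, Pi.single_apply, mul_ite, mul_one, Finset.sum_ite_eq', Finset.mem_univ,
          if_true]
        ring
    simp only [e]
    have h3 : HasDerivAt (fun s : ℝ => ω * q.1 + ∑ j, ξ j * q.2 j + σ
        + s * (d.elim ω (fun j => (ξ j : ℝ)))) (d.elim ω (fun j => (ξ j : ℝ))) 0 := by
      simpa using ((hasDerivAt_id (0 : ℝ)).mul_const (d.elim ω (fun j => (ξ j : ℝ)))).const_add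
        (ω * q.1 + ∑ j, ξ j * q.2 j + σ)
    have h4 := h3.cos
    convert h4 using 1
    rw [wave_apply, ← add_assoc, Real.cos_add_pi_div_two]
    simp; ring
  exact h1.unique h2

theorem wave_abs_le (ξ : Fin 3 → ℤ) (ω σ : ℝ) (q : SpaceTime) : |wave ξ ω σ q| ≤ 1 :=
  Real.abs_cos_le_one _

end SPF

section Averages

variable {E : Type} [NormedAddCommGroup E] [NormedSpace ℝ E]

theorem hasFDerivAt_average {g : SpaceTime → E} (hg : ContDiff ℝ 1 g) (v : SpaceTime)
    {ω : ℝ → ℝ} (hω : Continuous ω) (a b : ℝ) (q : SpaceTime) :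
    HasFDerivAt (fun q => ∫ s in a..b, ω s • g (q + s • v))
      (∫ s in a..b, ω s • fderiv ℝ g (q + s • v)) q := by
  have hg' : Continuous (fderiv ℝ g) := hg.continuous_fderiv (by simp)
  have hgc : Continuous g := hg.continuous
  have hK : IsCompact (Metric.closedBall q 1 ×ˢ Set.uIcc a b) :=
    (isCompact_closedBall q 1).prod isCompact_uIcc
  have hc : Continuous (fun p : SpaceTime × ℝ => ω p.2 • fderiv ℝ g (p.1 + p.2 • v)) := by
    exact (hω.comp continuous_snd).smul (hg'.comp (by fun_prop))
  obtain ⟨C, hC⟩ := hK.exists_bound_of_continuousOn hc.continuousOn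
  refine intervalIntegral.hasFDerivAt_integral_of_dominated_of_fderiv_le (𝕜 := ℝ)
    (F := fun (q : SpaceTime) s => ω s • g (q + s • v))
    (F' := fun (q : SpaceTime) s => ω s • fderiv ℝ g (q + s • v))
    (bound := fun _ => C) (Metric.closedBall_mem_nhds q one_pos) ?_ ?_ ?_ ?_ ?_ ?_
  · exact Filter.Eventually.of_forall fun p =>
      (by fun_prop : Continuous fun s : ℝ => ω s • g (p + s • v)).aestronglyMeasurable
  · exact (by fun_prop : Continuous fun s : ℝ => ω s • g (q + s • v)).intervalIntegrable _ _
  · exact (by fun_prop : Continuous fun s : ℝ =>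
      ω s • fderiv ℝ g (q + s • v)).aestronglyMeasurable
  · exact Filter.Eventually.of_forall fun s hs p hp =>
      hC (p, s) ⟨hp, Set.uIoc_subset_uIcc hs⟩
  · exact intervalIntegrable_const
  · refine Filter.Eventually.of_forall fun s _ p _ => ?_
    have h1 : HasFDerivAt g (fderiv ℝ g (p + s • v)) (p + s • v) :=
      ((hg.differentiable (by simp)) _).hasFDerivAt
    exact ((hasFDerivAt_comp_add_right (s • v)).2 h1).const_smul (ω s)

theorem contDiff_average_nat (n : ℕ) : ∀ {E : Type} [NormedAddCommGroup E] [NormedSpace ℝ E]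
    {g : SpaceTime → E}, ContDiff ℝ n g → ∀ (v : SpaceTime) {ω : ℝ → ℝ}, Continuous ω →
    ∀ a b : ℝ, ContDiff ℝ n (fun q => ∫ s in a..b, ω s • g (q + s • v)) := by
  induction n with
  | zero =>
    intro E _ _ g hg v ω hω a b
    have hgc : Continuous g := hg.continuous
    refine contDiff_zero.2 ?_
    exact intervalIntegral.continuous_parametric_intervalIntegral_of_continuous'
      (by simp only [Function.uncurry_def]; fun_prop) a b
  | succ n ih =>
    intro E _ _ g hg v ω hω a b
    have h1 : ContDiff ℝ 1 g := hg.of_le (by norm_cast; omega)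
    have hd := hasFDerivAt_average h1 v hω a b
    have hg2 : ContDiff ℝ n (fderiv ℝ g) := hg.fderiv_right (by norm_cast)
    have key := ih hg2 v hω a b
    rw [Nat.cast_add, Nat.cast_one, contDiff_succ_iff_fderiv]
    refine ⟨fun q => (hd q).differentiableAt, by simp, ?_⟩
    rwa [show fderiv ℝ (fun q => ∫ s in a..b, ω s • g (q + s • v))
      = fun q => ∫ s in a..b, ω s • fderiv ℝ g (q + s • v) from funext fun q => (hd q).fderiv]

end Averages

namespace SPF

theorem continuous_line (g : SPF) (q v : SpaceTime) : Continuous fun s : ℝ => g (q + s • v) :=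
  g.smooth.continuous.comp (by fun_prop)

/-- Weighted average along the direction `d`. -/
def avg (d : Dir) (a b : ℝ) (ω : ℝ → ℝ) (hω : Continuous ω) : SPF →ₗ[ℝ] SPF where
  toFun g := ⟨fun q => ∫ s in a..b, ω s • g (q + s • dvec d),
    contDiff_infty.2 fun n => contDiff_average_nat n (contDiff_infty.1 g.smooth n) _ hω a b, by
      rw [periodic_iff]
      intro m q
      refine intervalIntegral.integral_congr fun s _ => ?_
      rw [add_right_comm, shift_periodic g.periodic]⟩
  map_add' f g := by
    ext q
    change (∫ s in a..b, ω s • (f (q + s • dvec d) + g (q + s • dvec d))) = _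
    simp only [smul_add]
    exact intervalIntegral.integral_add
      ((hω.smul (continuous_line f q _)).intervalIntegrable _ _)
      ((hω.smul (continuous_line g q _)).intervalIntegrable _ _)
  map_smul' c f := by
    ext q
    change (∫ s in a..b, ω s • (c * f (q + s • dvec d))) = c * ∫ s in a..b, ω s • f (q + s • dvec d)
    rw [← intervalIntegral.integral_const_mul]
    refine intervalIntegral.integral_congr fun s _ => ?_
    simp only [smul_eq_mul]
    ring

variable {d : Dir} {a b : ℝ} {ω : ℝ → ℝ} {hω : Continuous ω}

theorem avg_apply (g : SPF) (q : SpaceTime) :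
    avg d a b ω hω g q = ∫ s in a..b, ω s * g (q + s • dvec d) := rfl

theorem pd_avg (e : Dir) (g : SPF) : pd e (avg d a b ω hω g) = avg d a b ω hω (pd e g) := by
  ext q
  have h := hasFDerivAt_average (g.smooth.of_le (by exact_mod_cast le_top)) (dvec d) hω a b q
  change fderiv ℝ (fun q => ∫ s in a..b, ω s • g (q + s • dvec d)) q (dvec e) = _
  rw [h.fderiv]
  have hc : Continuous fun s : ℝ => ω s • fderiv ℝ (g : SpaceTime → ℝ) (q + s • dvec d) :=
    hω.smul ((g.smooth.continuous_fderiv (by simp)).comp (by fun_prop))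
  rw [ContinuousLinearMap.intervalIntegral_apply (hc.intervalIntegrable _ _)]
  rfl

theorem avg_abs_le (hab : a ≤ b) {A W : ℝ} (hW : ∀ s ∈ Set.Ioc a b, |ω s| ≤ W) (g : SPF)
    (q : SpaceTime) (hg : ∀ s ∈ Set.Ioc a b, |g (q + s • dvec d)| ≤ A) :
    |avg d a b ω hω g q| ≤ W * A * (b - a) := by
  have := intervalIntegral.norm_integral_le_of_norm_le_const (a := a) (b := b) (C := W * A)
    (f := fun s => ω s * g (q + s • dvec d)) (fun s hs => by
      rw [Set.uIoc_of_le hab] at hs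
      rw [norm_mul]
      exact mul_le_mul (hW s hs) (hg s hs) (norm_nonneg _) ((abs_nonneg _).trans (hW s hs)))
  rwa [abs_of_nonneg (sub_nonneg.2 hab)] at this

/-- Integration by parts for an average against an affine weight. -/
theorem avg_pd_affine (m c : ℝ) (g : SPF) (q : SpaceTime) (hω : Continuous fun s : ℝ => m * s + c) :
    avg d a b (fun s => m * s + c) hω (pd d g) q
      = (m * b + c) * g (q + b • dvec d) - (m * a + c) * g (q + a • dvec d)
        - m * ∫ s in a..b, g (q + s • dvec d) := by
  have h := intervalIntegral.integral_mul_deriv_eq_deriv_mul (a := a) (b := b)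
    (u := fun s : ℝ => m * s + c) (u' := fun _ => m)
    (v := fun s : ℝ => g (q + s • dvec d)) (v' := fun s : ℝ => pd d g (q + s • dvec d))
    (fun s _ => by simpa using ((hasDerivAt_id s).const_mul m).add_const c)
    (fun s _ => hasDerivAt_line g q (dvec d) s)
    intervalIntegrable_const ((continuous_line (pd d g) q _).intervalIntegrable _ _)
  rw [avg_apply, h, intervalIntegral.integral_const_mul]

theorem line_const {d : Dir} {g : SPF} (h : pd d g = 0) (q : SpaceTime) (s : ℝ) :
    g (q + s • dvec d) = g q := by
  have h1 := is_const_of_deriv_eq_zero (f := fun s : ℝ => g (q + s • dvec d))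
    (fun s => (hasDerivAt_line g q (dvec d) s).differentiableAt)
    (fun s => by
      rw [(hasDerivAt_line g q (dvec d) s).deriv]
      exact congrArg (fun f : SPF => f (q + s • dvec d)) h) s 0
  simpa using h1

theorem line_periodic (i : Fin 3) (g : SPF) (q : SpaceTime) :
    g (q + (2 * Real.pi) • dvec (some i)) = g q := by
  have := shift_periodic g.periodic (Pi.single i 1) q
  convert this using 3
  refine Prod.ext (by simp [dvec]) (funext fun j => ?_)
  by_cases hj : j = i
  · subst hj; simp [dvec]
  · simp [dvec, hj]

/-- The mean in the `i`-th spatial variable. -/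
def mean (i : Fin 3) : SPF →ₗ[ℝ] SPF :=
  avg (some i) 0 (2 * Real.pi) (fun _ => (2 * Real.pi)⁻¹) continuous_const

/-- The primitive in the `i`-th spatial variable with vanishing mean. -/
def prim (i : Fin 3) : SPF →ₗ[ℝ] SPF :=
  avg (some i) 0 (2 * Real.pi) (fun s => (2 * Real.pi)⁻¹ * s + (-2⁻¹)) (by fun_prop)

theorem pd_mean (e : Dir) (i : Fin 3) (g : SPF) : pd e (mean i g) = mean i (pd e g) := pd_avg e g

theorem pd_prim (e : Dir) (i : Fin 3) (g : SPF) : pd e (prim i g) = prim i (pd e g) := pd_avg e g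

theorem mean_apply (i : Fin 3) (g : SPF) (q : SpaceTime) :
    mean i g q = (2 * Real.pi)⁻¹ * ∫ s in (0 : ℝ)..(2 * Real.pi), g (q + s • dvec (some i)) := by
  rw [mean, avg_apply, intervalIntegral.integral_const_mul]

theorem mean_pd_self (i : Fin 3) (g : SPF) : mean i (pd (some i) g) = 0 := by
  ext q
  rw [mean_apply, intervalIntegral.integral_eq_sub_of_hasDerivAt
    (f' := fun s => pd (some i) g (q + s • dvec (some i)))
    (fun s _ => hasDerivAt_line g q (dvec (some i)) s)
    ((continuous_line (pd (some i) g) q _).intervalIntegrable _ _), line_periodic]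
  simp

theorem pd_mean_self (i : Fin 3) (g : SPF) : pd (some i) (mean i g) = 0 := by
  rw [pd_mean, mean_pd_self]

theorem prim_pd_self (i : Fin 3) (g : SPF) : prim i (pd (some i) g) = g - mean i g := by
  ext q
  have hpi : (2 * Real.pi) ≠ 0 := by positivity
  rw [prim, avg_pd_affine, line_periodic, sub_apply, mean_apply, inv_mul_cancel₀ hpi]
  simp only [mul_zero, zero_smul, add_zero]
  ring

theorem pd_prim_self (i : Fin 3) (g : SPF) : pd (some i) (prim i g) = g - mean i g := by
  rw [pd_prim, prim_pd_self]

theorem prim_of_pd_eq_zero {i : Fin 3} {g : SPF} (h : pd (some i) g = 0) : prim i g = 0 := by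
  ext q
  rw [prim, avg_apply]
  simp only [line_const h]
  rw [intervalIntegral.integral_mul_const, intervalIntegral.integral_add
    ((by fun_prop : Continuous _).intervalIntegrable _ _) intervalIntegrable_const,
    intervalIntegral.integral_const_mul, integral_id, intervalIntegral.integral_const]
  have hpi : Real.pi ≠ 0 := Real.pi_ne_zero
  simp only [smul_eq_mul, zero_apply]
  field_simp
  ring

theorem mean_prim (i : Fin 3) (g : SPF) : mean i (prim i g) = 0 := by
  have h1 := prim_pd_self i (prim i g)
  rw [pd_prim_self, map_sub, prim_of_pd_eq_zero (pd_mean_self i g), sub_zero] at h1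
  exact sub_eq_self.1 h1.symm

theorem prim_abs_le (i : Fin 3) {A : ℝ} {g : SPF} (hg : ∀ q, |g q| ≤ A) (q : SpaceTime) :
    |prim i g q| ≤ 4 * A := by
  have hA : 0 ≤ A := (abs_nonneg _).trans (hg 0)
  have h := avg_abs_le (d := some i) (a := 0) (b := 2 * Real.pi) (W := 2⁻¹)
    (ω := fun s => (2 * Real.pi)⁻¹ * s + (-2⁻¹)) (hω := by fun_prop) (by positivity)
    (fun s hs => by
      have hpi : 0 < 2 * Real.pi := by positivity
      have h1 : (2 * Real.pi)⁻¹ * s ≤ 1 := by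
        rw [inv_mul_le_iff₀ hpi]; linarith [hs.2]
      have h0 : 0 ≤ (2 * Real.pi)⁻¹ * s := mul_nonneg (inv_nonneg.2 hpi.le) hs.1.le
      rw [abs_le]; constructor <;> linarith) g q (fun s _ => hg _)
  refine h.trans ?_
  nlinarith [Real.pi_lt_four]

theorem mean_abs_le (i : Fin 3) {A : ℝ} {g : SPF} (hg : ∀ q, |g q| ≤ A) (q : SpaceTime) :
    |mean i g q| ≤ A := by
  have hA : 0 ≤ A := (abs_nonneg _).trans (hg 0)
  have hpi : 0 < 2 * Real.pi := by positivity
  have h := avg_abs_le (d := some i) (a := 0) (b := 2 * Real.pi) (W := (2 * Real.pi)⁻¹)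
    (ω := fun s => (2 * Real.pi)⁻¹) (hω := by fun_prop) (by positivity)
    (fun s _ => by rw [abs_of_pos (inv_pos.2 hpi)]) g q (fun s _ => hg _)
  refine h.trans (le_of_eq ?_)
  field_simp
  ring

/-- The ideal of functions vanishing for times in `O`. -/
def vanish (O : Set ℝ) : Ideal SPF where
  carrier := {g | ∀ q : SpaceTime, q.1 ∈ O → g q = 0}
  add_mem' := fun hf hg q hq => by rw [add_apply, hf q hq, hg q hq, add_zero]
  zero_mem' := fun _ _ => rfl
  smul_mem' := fun c f hf q hq => by
    rw [smul_eq_mul, mul_apply, hf q hq, mul_zero]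

theorem smul_mem_vanish {O : Set ℝ} {g : SPF} (c : ℝ) (h : g ∈ vanish O) : c • g ∈ vanish O :=
  fun q hq => by rw [smul_apply, h q hq, mul_zero]

theorem pd_mem_vanish {O : Set ℝ} (hO : IsOpen O) {g : SPF} (d : Dir) (h : g ∈ vanish O) :
    pd d g ∈ vanish O := by
  intro q hq
  have : (g : SpaceTime → ℝ) =ᶠ[nhds q] fun _ => 0 := by
    filter_upwards [(hO.preimage continuous_fst).mem_nhds hq] with p hp using h p hp
  rw [pd_apply, this.fderiv_eq]
  simp

theorem avg_mem_vanish {O : Set ℝ} {g : SPF} {i : Fin 3} (h : g ∈ vanish O) :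
    avg (some i) a b ω hω g ∈ vanish O := by
  intro q hq
  rw [avg_apply]
  have : ∀ s : ℝ, g (q + s • dvec (some i)) = 0 := fun s => h _ (by simpa [dvec] using hq)
  simp [this]

theorem mean_mem_vanish {O : Set ℝ} {g : SPF} {i : Fin 3} (h : g ∈ vanish O) :
    mean i g ∈ vanish O := avg_mem_vanish h

theorem prim_mem_vanish {O : Set ℝ} {g : SPF} {i : Fin 3} (h : g ∈ vanish O) :
    prim i g ∈ vanish O := avg_mem_vanish h

end SPF

namespace SPF

variable {ι ι' : Type} {w w' : Dir → ℝ} {N : ℕ} {A B : ℝ}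

/-- `Bd w N A g`: the `ℓ¹` sums of the family `g` are at most `A`, and each derivative in a
direction `d`, up to order `N`, costs a factor `w d`. -/
def Bd (w : Dir → ℝ) : ℕ → ℝ → (ι → SPF) → Prop
  | 0, A, g => ∀ (q : SpaceTime) (t : Finset ι), ∑ m ∈ t, |g m q| ≤ A
  | N + 1, A, g => (∀ (q : SpaceTime) (t : Finset ι), ∑ m ∈ t, |g m q| ≤ A) ∧
      ∀ d, Bd w N (w d * A) (fun m => pd d (g m))

/-- `Bd` for a single function. -/
abbrev Bd1 (w : Dir → ℝ) (N : ℕ) (A : ℝ) (g : SPF) : Prop := Bd w N A (fun _ : Unit => g)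

theorem Bd.sum_le {g : ι → SPF} (h : Bd w N A g) (q : SpaceTime) (t : Finset ι) :
    ∑ m ∈ t, |g m q| ≤ A := by
  cases N with
  | zero => exact h q t
  | succ N => exact h.1 q t

theorem Bd.abs_le {g : ι → SPF} (h : Bd w N A g) (m : ι) (q : SpaceTime) : |g m q| ≤ A := by
  simpa using h.sum_le q {m}

theorem Bd.nonneg {g : ι → SPF} (h : Bd w N A g) : 0 ≤ A := by
  simpa using h.sum_le 0 ∅

theorem Bd.pd {g : ι → SPF} (h : Bd w (N + 1) A g) (d : Dir) :
    Bd w N (w d * A) (fun m => pd d (g m)) := h.2 d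

theorem Bd.mono (hw : ∀ d, 0 ≤ w d) (hww : ∀ d, w d ≤ w' d) {n : ℕ} {g : ι → SPF}
    (h : Bd w N A g) (hn : n ≤ N) (hA : A ≤ B) : Bd w' n B g := by
  induction N generalizing n A B g with
  | zero =>
    obtain rfl : n = 0 := by omega
    exact fun q t => (h q t).trans hA
  | succ N ih =>
    cases n with
    | zero => exact fun q t => (h.1 q t).trans hA
    | succ n =>
      exact ⟨fun q t => (h.1 q t).trans hA, fun d => ih (h.2 d) (by omega)
        (mul_le_mul (hww d) hA h.nonneg ((hw d).trans (hww d)))⟩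

theorem Bd.mono_right (hw : ∀ d, 0 ≤ w d) {g : ι → SPF} (h : Bd w N A g) (hA : A ≤ B) :
    Bd w N B g := h.mono hw (fun _ => le_rfl) le_rfl hA

theorem Bd.of_le (hw : ∀ d, 0 ≤ w d) {n : ℕ} {g : ι → SPF} (h : Bd w N A g) (hn : n ≤ N) :
    Bd w n A g := h.mono hw (fun _ => le_rfl) hn le_rfl

theorem Bd.add {f g : ι → SPF} (hf : Bd w N A f) (hg : Bd w N B g) :
    Bd w N (A + B) (fun m => f m + g m) := by
  have key : ∀ {f g : ι → SPF} {A B : ℝ} {n : ℕ}, Bd w n A f → Bd w n B g → ∀ q (t : Finset ι),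
      ∑ m ∈ t, |(f m + g m) q| ≤ A + B := fun hf hg q t => by
    refine le_trans ?_ (add_le_add (hf.sum_le q t) (hg.sum_le q t))
    rw [← Finset.sum_add_distrib]
    exact Finset.sum_le_sum fun m _ => abs_add_le _ _
  induction N generalizing A B f g with
  | zero => exact key hf hg
  | succ N ih =>
    refine ⟨key hf hg, fun d => ?_⟩
    simp only [map_add, mul_add]
    exact ih (hf.2 d) (hg.2 d)

theorem Bd.smul {g : ι → SPF} (hg : Bd w N A g) {r : ι → ℝ} {c : ℝ} (hc : 0 ≤ c)
    (hr : ∀ m, |r m| ≤ c) : Bd w N (c * A) (fun m => r m • g m) := by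
  have key : ∀ {g : ι → SPF} {A : ℝ} {n : ℕ}, Bd w n A g → ∀ q (t : Finset ι),
      ∑ m ∈ t, |(r m • g m) q| ≤ c * A := fun hg q t => by
    refine le_trans ?_ (mul_le_mul_of_nonneg_left (hg.sum_le q t) hc)
    rw [Finset.mul_sum]
    refine Finset.sum_le_sum fun m _ => ?_
    rw [smul_apply, abs_mul]
    exact mul_le_mul_of_nonneg_right (hr m) (abs_nonneg _)
  induction N generalizing A g with
  | zero => exact key hg
  | succ N ih =>
    refine ⟨key hg, fun d => ?_⟩
    simp only [Derivation.map_smul]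
    rw [mul_left_comm]
    exact ih (hg.2 d)

theorem Bd.neg {g : ι → SPF} (hg : Bd w N A g) : Bd w N A (fun m => -g m) := by
  have := hg.smul (r := fun _ => -1) zero_le_one (by simp)
  simpa using this

theorem Bd.sub {f g : ι → SPF} (hf : Bd w N A f) (hg : Bd w N B g) :
    Bd w N (A + B) (fun m => f m - g m) := by
  simpa only [sub_eq_add_neg] using hf.add hg.neg

theorem bd_zero (hw : ∀ d, 0 ≤ w d) (hA : 0 ≤ A) : Bd w N A (fun _ : ι => (0 : SPF)) := by
  induction N generalizing A with
  | zero => exact fun q t => by simpa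
  | succ N ih =>
    refine ⟨fun q t => by simpa, fun d => ?_⟩
    simp only [map_zero]
    exact ih (mul_nonneg (hw d) hA)

theorem Bd.sum {κ : Type} (hw : ∀ d, 0 ≤ w d) (s : Finset κ) {g : κ → ι → SPF} {A : κ → ℝ}
    (h : ∀ k ∈ s, Bd w N (A k) (g k)) : Bd w N (∑ k ∈ s, A k) (fun m => ∑ k ∈ s, g k m) := by
  classical
  induction s using Finset.induction_on with
  | empty => simpa using bd_zero hw le_rfl
  | insert k s hk ih =>
    simp only [Finset.sum_insert hk]
    exact (h k (by simp)).add (ih fun k hk => h k (by simp [hk]))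

/-- Product of an `ℓ¹` family with uniformly bounded functions. -/
theorem Bd.mul (hw : ∀ d, 0 ≤ w d) {f g : ι → SPF} (hf : Bd w N A f) (hB : 0 ≤ B)
    (hg : ∀ m, f m = 0 ∨ Bd1 w N B (g m)) : Bd w N (2 ^ N * (A * B)) (fun m => f m * g m) := by
  have key : ∀ {f g : ι → SPF} {A B : ℝ} {n : ℕ}, Bd w n A f → 0 ≤ B →
      (∀ m, f m = 0 ∨ Bd1 w n B (g m)) → ∀ q (t : Finset ι),
      ∑ m ∈ t, |(f m * g m) q| ≤ A * B := fun hf hB hg q t => by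
    refine le_trans ?_ (mul_le_mul_of_nonneg_right (hf.sum_le q t) hB)
    rw [Finset.sum_mul]
    refine Finset.sum_le_sum fun m _ => ?_
    rw [mul_apply, abs_mul]
    rcases hg m with h | h
    · simp [h]
    · exact mul_le_mul_of_nonneg_left (h.abs_le () q) (abs_nonneg _)
  induction N generalizing A B f g with
  | zero => rw [pow_zero, one_mul]; exact key hf hB hg
  | succ N ih =>
    refine ⟨fun q t => (key hf hB hg q t).trans ?_, fun d => ?_⟩
    · exact le_mul_of_one_le_left (mul_nonneg hf.nonneg hB) (one_le_pow₀ one_le_two)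
    · simp only [pd_mul]
      have h1 := ih (hf.2 d) hB (g := g) fun m => (hg m).imp (fun h => by rw [h, map_zero])
        fun h => h.of_le hw (Nat.le_succ N)
      have h2 := ih (hf.of_le hw (Nat.le_succ N)) (mul_nonneg (hw d) hB)
        (g := fun m => SPF.pd d (g m)) fun m => (hg m).imp id fun h => h.2 d
      refine (h1.add h2).mono_right hw (le_of_eq ?_)
      ring

theorem Bd1.mul (hw : ∀ d, 0 ≤ w d) {f g : SPF} (hf : Bd1 w N A f) (hg : Bd1 w N B g) :
    Bd1 w N (2 ^ N * (A * B)) (f * g) :=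
  Bd.mul hw hf hg.nonneg fun _ => Or.inr hg

/-- Product of two families, indexed by pairs. -/
theorem Bd.prod (hw : ∀ d, 0 ≤ w d) {f : ι → SPF} {g : ι' → SPF} (hf : Bd w N A f)
    (hg : Bd w N B g) : Bd w N (2 ^ N * (A * B)) (fun m : ι × ι' => f m.1 * g m.2) := by
  classical
  have key : ∀ {f : ι → SPF} {g : ι' → SPF} {A B : ℝ} {n : ℕ}, Bd w n A f →
      Bd w n B g → ∀ q (t : Finset (ι × ι')),
      ∑ m ∈ t, |(f m.1 * g m.2) q| ≤ A * B := fun {f g A B n} hf hg q t => by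
    calc ∑ m ∈ t, |(f m.1 * g m.2) q|
        ≤ ∑ m ∈ t.image Prod.fst ×ˢ t.image Prod.snd, |(f m.1 * g m.2) q| :=
          Finset.sum_le_sum_of_subset_of_nonneg Finset.subset_product
            fun _ _ _ => abs_nonneg _
      _ = (∑ m ∈ t.image Prod.fst, |f m q|) * ∑ m ∈ t.image Prod.snd, |g m q| := by
          rw [Finset.sum_mul_sum, Finset.sum_product]
          simp [abs_mul]
      _ ≤ A * B := mul_le_mul (hf.sum_le q _) (hg.sum_le q _)
          (Finset.sum_nonneg fun _ _ => abs_nonneg _) hf.nonneg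
  induction N generalizing A B f g with
  | zero => rw [pow_zero, one_mul]; exact key hf hg
  | succ N ih =>
    refine ⟨fun q t => (key hf hg q t).trans ?_, fun d => ?_⟩
    · exact le_mul_of_one_le_left (mul_nonneg hf.nonneg hg.nonneg) (one_le_pow₀ one_le_two)
    · simp only [pd_mul]
      have h1 := ih (hf.2 d) (hg.of_le hw (Nat.le_succ N))
      have h2 := ih (hf.of_le hw (Nat.le_succ N)) (hg.2 d)
      refine (h1.add h2).mono_right hw (le_of_eq ?_)
      ring

/-- The total of an `ℓ¹` family. -/
theorem Bd.total {g : ι → SPF} (h : Bd w N A g) (s : Finset ι) : Bd1 w N A (∑ m ∈ s, g m) := by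
  have key : ∀ {g : ι → SPF} {A : ℝ} {n : ℕ}, Bd w n A g → ∀ q (t : Finset Unit),
      ∑ _m ∈ t, |(∑ m ∈ s, g m) q| ≤ A := fun {g A n} hg q t => by
    calc ∑ _m ∈ t, |(∑ m ∈ s, g m) q|
        ≤ ∑ _m ∈ (Finset.univ : Finset Unit), |(∑ m ∈ s, g m) q| :=
          Finset.sum_le_sum_of_subset_of_nonneg (Finset.subset_univ t)
            fun _ _ _ => abs_nonneg _
      _ = |∑ m ∈ s, g m q| := by simp
      _ ≤ ∑ m ∈ s, |g m q| := Finset.abs_sum_le_sum_abs _ _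
      _ ≤ A := hg.sum_le q s
  induction N generalizing A g with
  | zero => exact key h
  | succ N ih =>
    refine ⟨key h, fun d => ?_⟩
    simp only [map_sum]
    exact ih (h.2 d)

theorem bd1_of_abs_le {g : SPF} (h : ∀ q, |g q| ≤ A) : Bd1 w 0 A g := fun q t => by
  calc ∑ _m ∈ t, |g q| ≤ ∑ _m ∈ (Finset.univ : Finset Unit), |g q| :=
        Finset.sum_le_sum_of_subset_of_nonneg (Finset.subset_univ t) fun _ _ _ => abs_nonneg _
    _ ≤ A := by simpa using h q

theorem bd1_succ {g : SPF} (h : ∀ q, |g q| ≤ A) (hd : ∀ d, Bd1 w N (w d * A) (SPF.pd d g)) :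
    Bd1 w (N + 1) A g := ⟨fun q t => bd1_of_abs_le (w := w) h q t, hd⟩

/-- A linear operator commuting with derivatives and bounded for the sup norm. -/
theorem Bd1.map {T : SPF →ₗ[ℝ] SPF} (hT : ∀ d g, SPF.pd d (T g) = T (SPF.pd d g)) {C : ℝ}
    (hC : ∀ (g : SPF) (A : ℝ), (∀ q, |g q| ≤ A) → ∀ q, |T g q| ≤ C * A)
    {g : SPF} (h : Bd1 w N A g) : Bd1 w N (C * A) (T g) := by
  induction N generalizing A g with
  | zero => exact bd1_of_abs_le (hC g A (h.abs_le ()))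
  | succ N ih =>
    refine bd1_succ (hC g A (h.abs_le ())) fun d => ?_
    rw [hT, mul_left_comm]
    exact ih (h.2 d)

theorem Bd1.mean {g : SPF} (h : Bd1 w N A g) (i : Fin 3) : Bd1 w N A (mean i g) := by
  simpa using h.map (T := SPF.mean i) (fun d g => pd_mean d i g) (C := 1)
    (fun g A hg q => by simpa using mean_abs_le i hg q)

theorem Bd1.prim {g : SPF} (h : Bd1 w N A g) (i : Fin 3) : Bd1 w N (4 * A) (prim i g) :=
  h.map (fun d g => pd_prim d i g) (fun _ _ hg q => prim_abs_le i hg q)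

theorem bd1_const (hw : ∀ d, 0 ≤ w d) (c : ℝ) : Bd1 w N |c| (algebraMap ℝ SPF c) := by
  cases N with
  | zero => exact bd1_of_abs_le fun q => le_rfl
  | succ N =>
    refine bd1_succ (fun q => le_rfl) fun d => ?_
    rw [(SPF.pd d).map_algebraMap]
    exact bd_zero hw (mul_nonneg (hw d) (abs_nonneg c))

theorem bd1_wave (hw : ∀ d, 0 ≤ w d) {ξ : Fin 3 → ℤ} {ω : ℝ} (hω : |ω| ≤ w none)
    (hξ : ∀ j, |(ξ j : ℝ)| ≤ w (some j)) (σ : ℝ) : Bd1 w N 1 (wave ξ ω σ) := by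
  induction N generalizing σ with
  | zero => exact bd1_of_abs_le (wave_abs_le ξ ω σ)
  | succ N ih =>
    refine bd1_succ (wave_abs_le ξ ω σ) fun d => ?_
    rw [pd_wave]
    refine (ih (σ + Real.pi / 2)).smul (r := fun _ => _) (hw d) fun _ => ?_
    cases d with
    | none => exact hω
    | some j => exact hξ j

/-- The constant of the composition estimate. -/
def compConst : ℕ → ℝ
  | 0 => 1
  | N + 1 => 2 ^ N * compConst N

theorem one_le_compConst (N : ℕ) : 1 ≤ compConst N := by
  induction N with
  | zero => exact le_rfl
  | succ N ih => exact one_le_mul_of_one_le_of_one_le (one_le_pow₀ one_le_two) ih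

theorem bd_comp (hw : ∀ d, 0 ≤ w d) {F : ι → ℝ → ℝ} (hF : ∀ m, ContDiff ℝ (⊤ : ℕ∞) (F m))
    {C : ℝ} (hC : ∀ j ≤ N, ∀ (s : ℝ) (t : Finset ι), ∑ m ∈ t, |iteratedDeriv j (F m) s| ≤ C)
    {g : SPF} (hg : ∀ d, Bd1 w N (w d) (SPF.pd d g)) :
    Bd w N (compConst N * C) (fun m => comp (F m) (hF m) g) := by
  induction N generalizing F with
  | zero => exact fun q t => by simpa [compConst] using hC 0 le_rfl (g q) t
  | succ N ih =>
    have hC0 : 0 ≤ C := by simpa using hC 0 (Nat.zero_le _) 0 ∅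
    refine ⟨fun q t => ?_, fun d => ?_⟩
    · refine le_trans (by simpa using hC 0 (Nat.zero_le _) (g q) t)
        (le_mul_of_one_le_left hC0 (one_le_compConst _))
    · simp only [pd_comp]
      have h1 := ih (F := fun m => deriv (F m)) (fun m => contDiff_deriv (hF m))
        (fun j hj s t => by
          simpa only [iteratedDeriv_succ'] using hC (j + 1) (by omega) s t)
        (fun d => (hg d).of_le hw (Nat.le_succ N))
      refine (h1.mul hw (hw d) fun m =>
        Or.inr ((hg d).of_le hw (Nat.le_succ N))).mono_right hw (le_of_eq ?_)
      rw [compConst]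
      ring

section Uniform

variable {D : Type} {w : D → Dir → ℝ} {n : ℕ} {s s' : D → ℝ} {f g : D → ι → SPF}

/-- Uniform bounds: the family `f S` is `Bd` with constant `s S`, up to a constant that does not
depend on the parameter `S`. -/
def IsO (w : D → Dir → ℝ) (n : ℕ) (s : D → ℝ) (f : D → ι → SPF) : Prop :=
  ∃ C, 0 ≤ C ∧ ∀ S, Bd (w S) n (C * s S) (f S)

theorem IsO.mono (hw : ∀ S d, 0 ≤ w S d) (h : IsO w n s f) {n' : ℕ} (hn : n' ≤ n) (K : ℝ)
    (hK : 0 ≤ K) (hs : ∀ S, s S ≤ K * s' S) : IsO w n' s' f := by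
  obtain ⟨C, hC, h⟩ := h
  refine ⟨C * K, mul_nonneg hC hK, fun S => (h S).mono (hw S) (fun _ => le_rfl) hn ?_⟩
  rw [mul_assoc]
  exact mul_le_mul_of_nonneg_left (hs S) hC

theorem IsO.of_le (hw : ∀ S d, 0 ≤ w S d) (h : IsO w n s f) {n' : ℕ} (hn : n' ≤ n) :
    IsO w n' s f := h.mono hw hn 1 zero_le_one (by simp)

theorem IsO.add (hw : ∀ S d, 0 ≤ w S d) (hf : IsO w n s f) (hg : IsO w n s g) :
    IsO w n s (fun S m => f S m + g S m) := by
  obtain ⟨C, hC, hf⟩ := hf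
  obtain ⟨C', hC', hg⟩ := hg
  exact ⟨C + C', add_nonneg hC hC', fun S => ((hf S).add (hg S)).mono_right (hw S)
    (le_of_eq (by ring))⟩

theorem IsO.neg (hf : IsO w n s f) : IsO w n s (fun S m => -f S m) := by
  obtain ⟨C, hC, hf⟩ := hf
  exact ⟨C, hC, fun S => (hf S).neg⟩

theorem IsO.sub (hw : ∀ S d, 0 ≤ w S d) (hf : IsO w n s f) (hg : IsO w n s g) :
    IsO w n s (fun S m => f S m - g S m) := by
  simpa only [sub_eq_add_neg] using hf.add hw hg.neg

theorem isO_zero (hw : ∀ S d, 0 ≤ w S d) : IsO w n s (fun _ (_ : ι) => (0 : SPF)) :=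
  ⟨0, le_rfl, fun S => by simpa using bd_zero (hw S) le_rfl⟩

theorem IsO.sum {κ : Type} (hw : ∀ S d, 0 ≤ w S d) (t : Finset κ)
    {f : κ → D → ι → SPF} (h : ∀ k ∈ t, IsO w n s (f k)) :
    IsO w n s (fun S m => ∑ k ∈ t, f k S m) := by
  classical
  induction t using Finset.induction_on with
  | empty => simpa using isO_zero hw
  | insert k t hk ih =>
    simp only [Finset.sum_insert hk]
    exact (h k (by simp)).add hw (ih fun k hk => h k (by simp [hk]))

theorem IsO.smul {r : D → ι → ℝ} {c : D → ℝ} (hc : ∀ S, 0 ≤ c S) (hr : ∀ S m, |r S m| ≤ c S)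
    (hf : IsO w n s f) : IsO w n (fun S => c S * s S) (fun S m => r S m • f S m) := by
  obtain ⟨C, hC, hf⟩ := hf
  refine ⟨C, hC, fun S => ?_⟩
  rw [mul_left_comm]
  exact (hf S).smul (hc S) (hr S)

theorem IsO.mul (hw : ∀ S d, 0 ≤ w S d) {g : D → SPF} (hf : IsO w n s f)
    (hg : IsO w n s' fun S (_ : Unit) => g S) :
    IsO w n (fun S => s S * s' S) (fun S m => f S m * g S) := by
  obtain ⟨C, hC, hf⟩ := hf
  obtain ⟨C', hC', hg⟩ := hg
  refine ⟨2 ^ n * (C * C'), by positivity, fun S => ?_⟩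
  refine ((hf S).mul (hw S) (hg S).nonneg fun _ => Or.inr (hg S)).mono_right (hw S)
    (le_of_eq (by ring))

theorem IsO.prod (hw : ∀ S d, 0 ≤ w S d) {g : D → ι' → SPF} (hf : IsO w n s f)
    (hg : IsO w n s' g) :
    IsO w n (fun S => s S * s' S) (fun S (m : ι × ι') => f S m.1 * g S m.2) := by
  obtain ⟨C, hC, hf⟩ := hf
  obtain ⟨C', hC', hg⟩ := hg
  refine ⟨2 ^ n * (C * C'), by positivity, fun S => ?_⟩
  exact ((hf S).prod (hw S) (hg S)).mono_right (hw S) (le_of_eq (by ring))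

theorem IsO.pd (hf : IsO w (n + 1) s f) (d : Dir) :
    IsO w n (fun S => w S d * s S) (fun S m => pd d (f S m)) := by
  obtain ⟨C, hC, hf⟩ := hf
  refine ⟨C, hC, fun S => ?_⟩
  rw [mul_left_comm]
  exact (hf S).2 d

end Uniform

end SPF

namespace SPF

/-- Nonzero horizontal wave vectors with entries `0, ±1`. -/
structure Horizontal (k : Fin 3 → ℤ) : Prop where
  two : k 2 = 0
  ne : k ≠ 0
  abs_le : ∀ j, |k j| ≤ 1

/-- The wave vector as a direction-indexed family of coefficients. -/
def coeff (k : Fin 3 → ℤ) (d : Dir) : ℝ := d.elim 0 fun j => (k j : ℝ)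

@[simp] theorem coeff_some (k : Fin 3 → ℤ) (j : Fin 3) : coeff k (some j) = k j := rfl
@[simp] theorem coeff_none (k : Fin 3 → ℤ) : coeff k none = 0 := rfl

/-- The squared length of a horizontal vector. -/
def len2 (k : Fin 3 → ℤ) : ℝ := (k 0 : ℝ) ^ 2 + (k 1 : ℝ) ^ 2

theorem Horizontal.one_le {k : Fin 3 → ℤ} (hk : Horizontal k) : 1 ≤ len2 k := by
  have h : 1 ≤ (k 0) ^ 2 + (k 1) ^ 2 := by
    by_contra! h
    have h0 : k 0 = 0 := by nlinarith [sq_nonneg (k 0), sq_nonneg (k 1)]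
    have h1 : k 1 = 0 := by nlinarith [sq_nonneg (k 0), sq_nonneg (k 1)]
    refine hk.ne (funext fun j => ?_)
    fin_cases j
    exacts [h0, h1, hk.two]
  rw [len2]
  exact_mod_cast h

theorem Horizontal.abs_coeff_le {k : Fin 3 → ℤ} (hk : Horizontal k) (d : Dir) :
    |coeff k d| ≤ 1 := by
  cases d with
  | none => simp
  | some j => rw [coeff_some]; exact_mod_cast hk.abs_le j

variable {ι : Type}

/-- The plane wave with phase `ν λ k · x + ω t + σ`. -/
def pw (k : Fin 3 → ℤ) (lam : ℕ) (ν : ℤ) (ω σ : ℝ) : SPF :=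
  wave (fun j => ν * lam * k j) ω σ

theorem pd_pw (k : Fin 3 → ℤ) (lam : ℕ) (ν : ℤ) (ω σ : ℝ) (j : Fin 3) :
    pd (some j) (pw k lam ν ω (σ - Real.pi / 2)) = (ν * lam * k j : ℝ) • pw k lam ν ω σ := by
  rw [pw, pd_wave, sub_add_cancel]
  simp [pw]

section Inverse

variable (k : Fin 3 → ℤ) (F : Dir → ι → SPF)

/-- The algebraic right inverse of the contraction with `k`. -/
def contr (i : Dir) (j : Fin 3) (m : ι) : SPF :=
  (coeff k (some j) / len2 k) • F i m + (coeff k i / len2 k) • F (some j) m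
    - ∑ l : Fin 3, (coeff k i * coeff k (some j) * coeff k (some l) / len2 k ^ 2) • F (some l) m

variable {k F}

theorem contr_symm (i j : Fin 3) (m : ι) : contr k F (some i) j m = contr k F (some j) i m := by
  simp only [contr, mul_comm (coeff k (some i)) (coeff k (some j))]
  rw [add_comm]

theorem sum_contr (hk : Horizontal k) (i : Dir) (m : ι) :
    ∑ j : Fin 3, (k j : ℝ) • contr k F i j m = F i m := by
  have h : len2 k ≠ 0 := (zero_lt_one.trans_le hk.one_le).ne'
  ext q
  simp only [contr, Fin.sum_univ_three, coeff_some, hk.two, Int.cast_zero, zero_smul,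
    add_apply, smul_apply, sub_apply, mul_zero, zero_mul, add_zero, zero_div]
  field_simp
  rw [len2]
  ring

theorem bd_contr (hk : Horizontal k) {w : Dir → ℝ} (hw : ∀ d, 0 ≤ w d) {N : ℕ} {A : ℝ}
    (hF : ∀ i, Bd w N A (F i)) (i : Dir) (j : Fin 3) : Bd w N (5 * A) (contr k F i j) := by
  have h1 : ∀ a b : ℝ, |a| ≤ 1 → 1 ≤ b → |a / b| ≤ 1 := fun a b ha hb => by
    rw [abs_div, abs_of_pos (zero_lt_one.trans_le hb)]
    exact div_le_one_of_le₀ (ha.trans hb) (zero_le_one.trans hb)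
  have hc := hk.abs_coeff_le
  have hA := (hF none).nonneg
  have e1 := (hF i).smul (r := fun _ => coeff k (some j) / len2 k) zero_le_one
    fun _ => h1 _ _ (hc _) hk.one_le
  have e2 := (hF (some j)).smul (r := fun _ => coeff k i / len2 k) zero_le_one
    fun _ => h1 _ _ (hc _) hk.one_le
  have e3 := Bd.sum hw Finset.univ (g := fun l m =>
      (coeff k i * coeff k (some j) * coeff k (some l) / len2 k ^ 2) • F (some l) m)
    (A := fun _ : Fin 3 => 1 * A) fun l _ => (hF (some l)).smul
      (r := fun _ => coeff k i * coeff k (some j) * coeff k (some l) / len2 k ^ 2)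
      zero_le_one fun _ => h1 _ _ (by
        rw [abs_mul, abs_mul]
        exact mul_le_one₀ (mul_le_one₀ (hc _) (abs_nonneg _) (hc _)) (abs_nonneg _) (hc _))
        (one_le_pow₀ hk.one_le)
  refine ((e1.add e2).sub e3).mono_right hw (le_of_eq ?_)
  simp
  ring

theorem contr_mem {O : Set ℝ} {m : ι} (hF : ∀ i, F i m ∈ vanish O) (i : Dir) (j : Fin 3) :
    contr k F i j m ∈ vanish O :=
  sub_mem (add_mem (smul_mem_vanish _ (hF _)) (smul_mem_vanish _ (hF _)))
    (sum_mem fun _ _ => smul_mem_vanish _ (hF _))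

theorem contr_eq_zero {m : ι} (hF : ∀ i, F i m = 0) (i : Dir) (j : Fin 3) :
    contr k F i j m = 0 := by simp [contr, hF]

/-- An oscillating family is a divergence up to an error which is smaller by `J` powers of the
ratio between the derivative cost and the frequency. -/
theorem exists_oscillating_inverse (hk : Horizontal k) {lam : ℕ} (hlam : 0 < lam)
    {w w' : Dir → ℝ} (hw : ∀ d, 0 ≤ w d) (hww : ∀ d, w d ≤ w' d) {W : ℝ}
    (hW : ∀ j, w (some j) ≤ W) (hθ : 15 * W / lam ≤ 1 / 2) {ν : ι → ℤ} {ω : ι → ℝ}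
    {O : Set ℝ} (hO : IsOpen O) (J N : ℕ) (t : Finset ι) : ∀ {A : ℝ} {F : Dir → ι → SPF} (σ : ℝ),
    (∀ i, Bd w (N + J) A (F i)) →
    (∀ m, (∀ i, F i m = 0) ∨ (ν m ≠ 0 ∧ |ω m| ≤ w' none ∧
      ∀ j, |(ν m * lam * k j : ℝ)| ≤ w' (some j))) →
    (∀ i m, F i m ∈ vanish O) →
    ∃ (S : Dir → Fin 3 → SPF) (r : Dir → SPF),
      (∀ i, ∑ m ∈ t, F i m * pw k lam (ν m) (ω m) σ = ∑ j, pd (some j) (S i j) + r i) ∧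
      (∀ i j, S (some i) j = S (some j) i) ∧
      (∀ i j, S i j ∈ vanish O) ∧ (∀ i, r i ∈ vanish O) ∧
      (∀ i j, Bd1 w' N (2 ^ N * (10 * A / lam)) (S i j)) ∧
      (∀ i, Bd1 w' N (2 ^ N * ((15 * W / lam) ^ J * A)) (r i)) := by
  have hl : (0 : ℝ) < lam := by exact_mod_cast hlam
  have hl' : (1 : ℝ) ≤ lam := by exact_mod_cast hlam
  have hw' : ∀ d, 0 ≤ w' d := fun d => (hw d).trans (hww d)
  have hW0 : 0 ≤ W := (hw _).trans (hW 0)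
  have bdpw : ∀ (N : ℕ) {A : ℝ} {G : ι → SPF} {F : Dir → ι → SPF} (σ : ℝ), Bd w N A G →
      (∀ m, (∀ i, F i m = 0) → G m = 0) →
      (∀ m, (∀ i, F i m = 0) ∨ (ν m ≠ 0 ∧ |ω m| ≤ w' none ∧
        ∀ j, |(ν m * lam * k j : ℝ)| ≤ w' (some j))) →
      Bd1 w' N (2 ^ N * A) (∑ m ∈ t, G m * pw k lam (ν m) (ω m) σ) := by
    intro N A G F σ hG h0 hν
    have h1 := (hG.mono hw hww le_rfl le_rfl).mul hw' zero_le_one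
      (g := fun m => pw k lam (ν m) (ω m) σ) fun m => (hν m).imp (h0 m) fun h =>
        bd1_wave hw' h.2.1 (fun j => by exact_mod_cast h.2.2 j) σ
    simpa only [mul_one] using h1.total t
  induction J with
  | zero =>
    intro A F σ hF hν hv
    have hA := (hF none).nonneg
    refine ⟨fun _ _ => 0, fun i => ∑ m ∈ t, F i m * pw k lam (ν m) (ω m) σ, ?_, ?_, ?_, ?_, ?_, ?_⟩
    · simp
    · simp
    · exact fun _ _ => zero_mem _
    · exact fun i => sum_mem fun m _ => Ideal.mul_mem_right _ _ (hv i m)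
    · exact fun _ _ => bd_zero hw' (by positivity)
    · intro i
      simpa using bdpw N σ (hF i) (fun m h => h i) hν
  | succ J ih =>
    intro A F σ hF hν hv
    have hA := (hF none).nonneg
    set c : ι → ℝ := fun m => (ν m * lam : ℝ)⁻¹ with hc
    have hcb : ∀ m, |c m| ≤ (lam : ℝ)⁻¹ := by
      intro m
      rw [hc]
      simp only
      rw [abs_inv, abs_mul, Nat.abs_cast]
      by_cases h : ν m = 0
      · simp [h]
      · refine inv_anti₀ hl (le_mul_of_one_le_left hl.le ?_)
        exact_mod_cast Int.one_le_abs h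
    set G : Dir → ι → SPF := fun i m => -(c m • ∑ j, pd (some j) (contr k F i j m)) with hG
    have hGb : ∀ i, Bd w (N + J) (15 * W / lam * A) (G i) := by
      intro i
      have h1 := Bd.sum hw Finset.univ (g := fun (j : Fin 3) m => pd (some j) (contr k F i j m))
        (A := fun _ => W * (5 * A)) fun j _ => ((bd_contr hk hw hF i j).pd (some j)).mono_right hw
          (mul_le_mul_of_nonneg_right (hW j) (by positivity))
      refine ((h1.smul (inv_nonneg.2 hl.le) hcb).neg).mono_right hw (le_of_eq ?_)
      simp
      ring
    have hG0 : ∀ m, (∀ i, F i m = 0) → ∀ i, G i m = 0 := fun m h i => by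
      simp [hG, contr_eq_zero h]
    obtain ⟨S, r, h1, h2, h3, h4, h5, h6⟩ := ih (F := G) (σ - Real.pi / 2) hGb
      (fun m => (hν m).imp (hG0 m) id)
      (fun i m => neg_mem (smul_mem_vanish _ (sum_mem fun j _ =>
        pd_mem_vanish hO _ (contr_mem (fun i => hv i m) i j))))
    refine ⟨fun i j => ∑ m ∈ t, c m • contr k F i j m * pw k lam (ν m) (ω m) (σ - Real.pi / 2)
      + S i j, r, ?_, ?_, ?_, h4, ?_, ?_⟩
    · intro i
      simp only [map_add, Finset.sum_add_distrib]
      rw [add_assoc, ← h1 i]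
      simp only [map_sum]
      rw [Finset.sum_comm, ← Finset.sum_add_distrib]
      refine Finset.sum_congr rfl fun m _ => ?_
      rcases hν m with h | h
      · simp [contr_eq_zero h, hG0 m h, h i]
      · have hn : (ν m : ℝ) ≠ 0 := by exact_mod_cast h.1
        simp only [pd_mul, Derivation.map_smul, pd_pw, Finset.sum_add_distrib, hG]
        conv_lhs => rw [← sum_contr hk (F := F) i m]
        have e1 : ∀ j : Fin 3, c m • contr k F i j m * (ν m * lam * k j : ℝ) •
            pw k lam (ν m) (ω m) σ = (k j : ℝ) • contr k F i j m * pw k lam (ν m) (ω m) σ := by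
          intro j
          ext q
          simp only [mul_apply, smul_apply, hc]
          field_simp
        simp only [e1, ← Finset.sum_mul, ← Finset.smul_sum]
        ring
    · intro i j
      simp only [contr_symm i j, h2 i j]
    · exact fun i j => add_mem (sum_mem fun m _ => Ideal.mul_mem_right _ _
        (smul_mem_vanish _ (contr_mem (fun i => hv i m) i j))) (h3 i j)
    · intro i j
      have e1 := bdpw N (σ - Real.pi / 2) (F := F) (((bd_contr hk hw hF i j).smul
        (inv_nonneg.2 hl.le) hcb).of_le hw (by omega))
        (fun m h => by rw [contr_eq_zero h, smul_zero]) hν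
      refine (e1.add (h5 i j)).mono_right hw' ?_
      have e2 : 10 * (15 * W / lam * A) / lam ≤ 5 * A / lam := by
        refine div_le_div_of_nonneg_right ?_ hl.le
        nlinarith
      have e3 : (lam : ℝ)⁻¹ * (5 * A) + 10 * (15 * W / lam * A) / lam ≤ 10 * A / lam := by
        calc _ ≤ (lam : ℝ)⁻¹ * (5 * A) + 5 * A / lam := by gcongr
          _ = _ := by ring
      rw [← mul_add]
      gcongr
    · intro i
      refine (h6 i).mono_right hw' (le_of_eq ?_)
      ring

end Inverse

section Antidivergence

variable {w : Dir → ℝ} {A W : ℝ} {O : Set ℝ}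

/-- One step of the antidivergence: remove everything but the mean in the direction `j`. -/
theorem exists_antidivergence_step {N : ℕ} (hw : ∀ d, 0 ≤ w d) (hW : ∀ j, w (some j) ≤ W)
    (hW1 : 1 ≤ W)
    (hO : IsOpen O) (j : Fin 3) {r : Dir → SPF} (hr : ∀ i, Bd1 w (N + 1) A (r i))
    (hv : ∀ i, r i ∈ vanish O) :
    ∃ S : Dir → Fin 3 → SPF, (∀ i, ∑ l, pd (some l) (S i l) = r i - mean j (r i)) ∧
      (∀ i l, S (some i) l = S (some l) i) ∧ (∀ i l, S i l ∈ vanish O) ∧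
      (∀ i l, Bd1 w N (60 * W * A) (S i l)) := by
  have hA := (hr none).nonneg
  have hW0 : 0 ≤ W := zero_le_one.trans hW1
  set c : SPF := ∑ l ∈ Finset.univ.erase j, pd (some l) (prim j (r (some l))) with hc
  have hcv : c ∈ vanish O := sum_mem fun l _ => pd_mem_vanish hO _ (prim_mem_vanish (hv _))
  have hcb : Bd1 w N (8 * W * A) c := by
    have h1 := Bd.sum (ι := Unit) hw (Finset.univ.erase j)
      (g := fun l _ => pd (some l) (prim j (r (some l))))
      (A := fun _ => W * (4 * A)) fun l _ => (((hr (some l)).prim j).pd (some l)).mono_right hw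
        (mul_le_mul_of_nonneg_right (hW l) (by positivity))
    refine h1.mono_right hw (le_of_eq ?_)
    rw [Finset.sum_const, Finset.card_erase_of_mem (Finset.mem_univ j)]
    simp
    ring
  have hm : ∀ l : Fin 3, mean j (pd (some l) (prim j (r (some l)))) = 0 := fun l => by
    rw [← pd_mean, mean_prim, map_zero]
  have hmc : mean j c = 0 := by
    rw [hc, map_sum]
    exact Finset.sum_eq_zero fun l _ => hm l
  set S : Dir → Fin 3 → SPF := fun i l =>
    i.elim (if l = j then prim j (r none) else 0) fun i =>
      if l = j then (if i = j then prim j (r (some j) - c) else prim j (r (some i)))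
      else if i = j then prim j (r (some l)) else 0 with hS
  refine ⟨S, fun i => ?_, fun i l => ?_, fun i l => ?_, fun i l => ?_⟩
  · rw [← Finset.add_sum_erase _ _ (Finset.mem_univ j)]
    cases i with
    | none =>
      rw [Finset.sum_eq_zero fun l hl => ?_]
      · simp [hS, pd_prim_self]
      · simp [hS, (Finset.mem_erase.1 hl).1]
    | some i =>
      by_cases hij : i = j
      · subst hij
        have : ∑ l ∈ Finset.univ.erase i, pd (some l) (S (some i) l) = c :=
          Finset.sum_congr rfl fun l hl => by simp [hS, (Finset.mem_erase.1 hl).1]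
        rw [this]
        simp only [hS, Option.elim, if_true, pd_prim_self, map_sub, hmc]
        ring
      · rw [Finset.sum_eq_zero fun l hl => ?_]
        · simp [hS, pd_prim_self, hij]
        · simp [hS, (Finset.mem_erase.1 hl).1, hij]
  · simp only [hS, Option.elim]
    by_cases hl : l = j <;> by_cases hi : i = j <;> simp [hl, hi]
  · have hp : ∀ i, prim j (r i) ∈ vanish O := fun i => prim_mem_vanish (hv i)
    have hpc : prim j (r (some j) - c) ∈ vanish O := prim_mem_vanish (sub_mem (hv _) hcv)
    cases i with
    | none => simp only [hS, Option.elim]; split_ifs <;> first | exact hp _ | exact zero_mem _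
    | some i =>
      simp only [hS, Option.elim]
      split_ifs <;> first | exact hp _ | exact zero_mem _ | exact hpc
  · have hp : ∀ i, Bd1 w N (60 * W * A) (prim j (r i)) := fun i =>
      (((hr i).prim j).of_le hw (Nat.le_succ N)).mono_right hw (by nlinarith)
    have hpc : Bd1 w N (60 * W * A) (prim j (r (some j) - c)) :=
      (Bd1.prim (((hr (some j)).of_le hw (Nat.le_succ N)).sub hcb) j).mono_right hw (by nlinarith)
    have h0 : Bd1 w N (60 * W * A) 0 := bd_zero hw (by positivity)
    cases i with
    | none => simp only [hS, Option.elim]; split_ifs <;> first | exact hp _ | exact h0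
    | some i =>
      simp only [hS, Option.elim]
      split_ifs <;> first | exact hp _ | exact h0 | exact hpc

/-- Every periodic field of zero mean is the divergence of a symmetric field. -/
theorem exists_antidivergence {N : ℕ} (hw : ∀ d, 0 ≤ w d) (hW : ∀ j, w (some j) ≤ W) (hW1 : 1 ≤ W)
    (hO : IsOpen O) {r : Dir → SPF} (hr : ∀ i, Bd1 w (N + 1) A (r i))
    (hv : ∀ i, r i ∈ vanish O) (hm : ∀ i, mean 2 (mean 1 (mean 0 (r i))) = 0) :
    ∃ S : Dir → Fin 3 → SPF, (∀ i, ∑ l, pd (some l) (S i l) = r i) ∧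
      (∀ i l, S (some i) l = S (some l) i) ∧ (∀ i l, S i l ∈ vanish O) ∧
      (∀ i l, Bd1 w N (180 * W * A) (S i l)) := by
  obtain ⟨S, h1, h2, h3, h4⟩ := exists_antidivergence_step hw hW hW1 hO 0 hr hv
  obtain ⟨S', h1', h2', h3', h4'⟩ := exists_antidivergence_step hw hW hW1 hO 1
    (fun i => (hr i).mean 0) fun i => mean_mem_vanish (hv i)
  obtain ⟨T, g1, g2, g3, g4⟩ := exists_antidivergence_step hw hW hW1 hO 2
    (fun i => ((hr i).mean 0).mean 1) fun i => mean_mem_vanish (mean_mem_vanish (hv i))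
  refine ⟨fun i l => S i l + S' i l + T i l, fun i => ?_, fun i l => ?_, fun i l => ?_,
    fun i l => ?_⟩
  · simp only [map_add, Finset.sum_add_distrib, h1, h1', g1, hm]
    ring
  · simp only [h2 i l, h2' i l, g2 i l]
  · exact add_mem (add_mem (h3 _ _) (h3' _ _)) (g3 _ _)
  · refine (((h4 i l).add (h4' i l)).add (g4 i l)).mono_right hw (le_of_eq ?_)
    ring

end Antidivergence

end SPF

/-- A smooth function supported in the unit interval around the origin. -/
structure UnitBump (φ : ℝ → ℝ) : Prop where
  smooth : ContDiff ℝ (⊤ : ℕ∞) φ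
  zero : ∀ s, 1 ≤ |s| → φ s = 0

namespace UnitBump

variable {φ : ℝ → ℝ}

theorem iteratedDeriv_zero (h : UnitBump φ) (j : ℕ) {s : ℝ} (hs : 1 < |s|) :
    iteratedDeriv j φ s = 0 := by
  have : φ =ᶠ[nhds s] fun _ => 0 := by
    filter_upwards [(isOpen_lt continuous_const continuous_abs).mem_nhds hs] with x hx
      using h.zero x hx.le
  rw [this.iteratedDeriv_eq]
  simp

theorem deriv (h : UnitBump φ) : UnitBump (deriv φ) where
  smooth := (contDiff_infty_iff_deriv.1 h.smooth).2
  zero := by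
    intro s hs
    have hc : Continuous (_root_.deriv φ) := (contDiff_infty_iff_deriv.1 h.smooth).2.continuous
    have h0 : ∀ x, 1 < |x| → _root_.deriv φ x = 0 := fun x hx => by
      simpa using h.iteratedDeriv_zero 1 hx
    have hcl : IsClosed {x | _root_.deriv φ x = 0} := isClosed_eq hc continuous_const
    have hmem : s ∈ closure {x : ℝ | 1 < |x|} := by
      refine mem_closure_of_tendsto (f := fun n : ℕ => (1 + 1 / ((n : ℝ) + 1)) * s)
        (b := Filter.atTop) ?_ (Filter.Eventually.of_forall fun n => ?_)
      · have := (tendsto_one_div_add_atTop_nhds_zero_nat (𝕜 := ℝ)).const_add 1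
        simpa using this.mul_const s
      · have : 0 < 1 / ((n : ℝ) + 1) := by positivity
        simp only [Set.mem_ofPred_eq, abs_mul]
        rw [abs_of_pos (by linarith)]
        nlinarith
    exact closure_minimal (fun x hx => h0 x hx) hcl hmem

theorem id_mul (h : UnitBump φ) : UnitBump fun s => s * φ s where
  smooth := contDiff_id.mul h.smooth
  zero s hs := by rw [h.zero s hs, mul_zero]

theorem exists_bound (h : UnitBump φ) (N : ℕ) : ∃ C, 0 ≤ C ∧ ∀ j ≤ N, ∀ (s : ℝ) (t : Finset ℤ),
    ∑ m ∈ t, |iteratedDeriv j (fun x => φ (x - m)) s| ≤ C := by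
  have key : ∀ j, ∃ C, 0 ≤ C ∧ ∀ s, |iteratedDeriv j φ s| ≤ C := by
    intro j
    have hc : Continuous (iteratedDeriv j φ) := h.smooth.continuous_iteratedDeriv j (by
      exact_mod_cast le_top)
    obtain ⟨C, hC⟩ := (isCompact_Icc (a := (-1 : ℝ)) (b := 1)).exists_bound_of_continuousOn
      hc.continuousOn
    refine ⟨|C|, abs_nonneg _, fun s => ?_⟩
    by_cases hs : |s| ≤ 1
    · exact (hC s (abs_le.1 hs)).trans (le_abs_self C)
    · rw [h.iteratedDeriv_zero j (not_le.1 hs), abs_zero]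
      exact abs_nonneg C
  choose C hC0 hC using key
  refine ⟨3 * ∑ j ∈ Finset.range (N + 1), C j, mul_nonneg (by norm_num)
    (Finset.sum_nonneg fun j _ => hC0 j), fun j hj s t => ?_⟩
  have hCj : C j ≤ ∑ j ∈ Finset.range (N + 1), C j :=
    Finset.single_le_sum (f := C) (fun j _ => hC0 j) (by simp; omega)
  have hsub : ∀ m : ℤ, iteratedDeriv j (fun x => φ (x - m)) s = iteratedDeriv j φ (s - m) :=
    fun m => congrFun (iteratedDeriv_comp_sub_const j φ (m : ℝ)) s
  simp only [hsub]
  calc ∑ m ∈ t, |iteratedDeriv j φ (s - m)|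
      = ∑ m ∈ t.filter (fun m => m ∈ Finset.Icc (⌊s⌋ - 1) (⌊s⌋ + 1)),
          |iteratedDeriv j φ (s - m)| := by
        refine (Finset.sum_filter_of_ne fun m _ hm => ?_).symm
        by_contra hcon
        refine hm ?_
        rw [h.iteratedDeriv_zero j, abs_zero]
        by_contra! habs
        rw [abs_le] at habs
        refine hcon (Finset.mem_Icc.2 ⟨?_, ?_⟩)
        · have : ((⌊s⌋ - 1 : ℤ) : ℝ) ≤ m := by push_cast; linarith [Int.floor_le s, habs.2]
          exact_mod_cast this
        · have : (m : ℝ) < ((⌊s⌋ + 2 : ℤ) : ℝ) := by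
            push_cast; linarith [Int.lt_floor_add_one s, habs.1]
          have : m < ⌊s⌋ + 2 := by exact_mod_cast this
          omega
    _ ≤ ∑ m ∈ Finset.Icc (⌊s⌋ - 1) (⌊s⌋ + 1), C j := by
        refine (Finset.sum_le_sum fun m _ => hC j _).trans
          (Finset.sum_le_sum_of_subset_of_nonneg ?_ fun _ _ _ => hC0 j)
        exact fun m hm => (Finset.mem_filter.1 hm).2
    _ = 3 * C j := by
        rw [Finset.sum_const, Int.card_Icc]
        simp only [show ⌊s⌋ + 1 + 1 - (⌊s⌋ - 1) = 3 by ring, nsmul_eq_mul,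
          show Int.toNat 3 = 3 from rfl, Nat.cast_ofNat]
    _ ≤ _ := by linarith

end UnitBump

/-- A quarter-turn smooth angle. -/
def angle (s : ℝ) : ℝ := Real.pi / 2 * Real.smoothTransition s

/-- The profile whose squared integer translates form a partition of unity. -/
def profile (s : ℝ) : ℝ := Real.sin (angle (s + 1)) * Real.cos (angle s)

theorem unitBump_profile : UnitBump profile where
  smooth := by
    have h : ContDiff ℝ (⊤ : ℕ∞) angle := contDiff_const.mul Real.smoothTransition.contDiff
    exact (h.comp (contDiff_id.add contDiff_const)).sin.mul h.cos
  zero s hs := by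
    rcases le_abs.1 hs with h | h
    · rw [profile, angle, angle, Real.smoothTransition.one_of_one_le h]
      simp
    · rw [profile, angle, Real.smoothTransition.zero_of_nonpos (by linarith)]
      simp

theorem profile_abs_le (s : ℝ) : |profile s| ≤ 1 := by
  rw [profile, abs_mul]
  exact mul_le_one₀ (Real.abs_sin_le_one _) (abs_nonneg _) (Real.abs_cos_le_one _)

theorem profile_translate_eq_zero {s : ℝ} {m : ℤ} (h1 : m ≠ ⌊s⌋) (h2 : m ≠ ⌊s⌋ + 1) :
    profile (s - m) = 0 := by
  refine unitBump_profile.zero _ ?_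
  by_contra! h
  rw [abs_lt] at h
  have a1 : (m : ℝ) < ((⌊s⌋ + 2 : ℤ) : ℝ) := by
    push_cast; linarith [Int.lt_floor_add_one s, h.1]
  have a2 : ((⌊s⌋ - 1 : ℤ) : ℝ) < m := by
    push_cast; linarith [Int.floor_le s, h.2]
  have a1 : m < ⌊s⌋ + 2 := by exact_mod_cast a1
  have a2 : ⌊s⌋ - 1 < m := by exact_mod_cast a2
  omega

theorem profile_sq_add (s : ℝ) :
    profile (s - ⌊s⌋) ^ 2 + profile (s - (⌊s⌋ + 1 : ℤ)) ^ 2 = 1 := by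
  have h0 : 0 ≤ s - ⌊s⌋ := sub_nonneg.2 (Int.floor_le s)
  have h1 : s - ⌊s⌋ - 1 ≤ 0 := by linarith [Int.lt_floor_add_one s]
  push_cast
  rw [show s - (⌊s⌋ + 1 : ℝ) = s - ⌊s⌋ - 1 by ring, profile, profile, sub_add_cancel]
  have e1 : angle (s - ⌊s⌋ + 1) = Real.pi / 2 := by
    rw [angle, Real.smoothTransition.one_of_one_le (by linarith), mul_one]
  have e2 : angle (s - ⌊s⌋ - 1) = 0 := by
    rw [angle, Real.smoothTransition.zero_of_nonpos h1, mul_zero]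
  rw [e1, e2, Real.sin_pi_div_two, Real.cos_zero, one_mul, mul_one, Real.cos_sq_add_sin_sq]

/-- Sums over translates of the profile have two terms. -/
theorem sum_profile_eq {s : ℝ} {t : Finset ℤ} (h1 : ⌊s⌋ ∈ t) (h2 : ⌊s⌋ + 1 ∈ t) (g : ℤ → ℝ)
    (hg : ∀ m : ℤ, profile (s - m) = 0 → g m = 0) : ∑ m ∈ t, g m = g ⌊s⌋ + g (⌊s⌋ + 1) := by
  rw [← Finset.sum_pair (f := g) (a := ⌊s⌋) (b := ⌊s⌋ + 1) (by omega)]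
  refine (Finset.sum_subset ?_ fun m _ hm => hg m ?_).symm
  · intro m hm
    rcases Finset.mem_insert.1 hm with rfl | hm
    · exact h1
    · rw [Finset.mem_singleton.1 hm]; exact h2
  · simp only [Finset.mem_insert, Finset.mem_singleton, not_or] at hm
    exact profile_translate_eq_zero hm.1 hm.2

theorem profile_mul_profile {s : ℝ} {m m' : ℤ} (hne : m ≠ m') (hpar : Even m ↔ Even m') :
    profile (s - m) * profile (s - m') = 0 := by
  by_cases h1 : profile (s - m) = 0
  · rw [h1, zero_mul]
  by_cases h2 : profile (s - m') = 0
  · rw [h2, mul_zero]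
  have a1 : m = ⌊s⌋ ∨ m = ⌊s⌋ + 1 := by
    by_contra! h; exact h1 (profile_translate_eq_zero h.1 h.2)
  have a2 : m' = ⌊s⌋ ∨ m' = ⌊s⌋ + 1 := by
    by_contra! h; exact h2 (profile_translate_eq_zero h.1 h.2)
  rw [Int.even_iff, Int.even_iff] at hpar
  omega

namespace SPF

/-- Anisotropic size of first derivatives: `Z` in the `z`-direction, `Λ` in all others. -/
def scale (Λ Z : ℝ) (d : Dir) : ℝ := if d = some 2 then Z else Λ

theorem scale_nonneg {Λ Z : ℝ} (hΛ : 0 ≤ Λ) (hZ : 0 ≤ Z) (d : Dir) : 0 ≤ scale Λ Z d := by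
  unfold scale; split_ifs <;> assumption

theorem scale_le {Λ Z : ℝ} (h : Z ≤ Λ) (d : Dir) : scale Λ Z d ≤ Λ := by
  unfold scale; split_ifs <;> linarith

theorem le_scale {Λ Z : ℝ} (h : Z ≤ Λ) (d : Dir) : Z ≤ scale Λ Z d := by
  unfold scale; split_ifs <;> linarith

/-- Input of one perturbation step: a background field `u` (velocity and temperature), an amplitude
`A` orthogonal to the direction `k`, the frequency `lam` and the size parameters. -/
structure Stage (N : ℕ) (V M₀ : ℝ) (k : Fin 3 → ℤ) where
  δ : ℝ
  κ : ℝ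
  Λ : ℝ
  Z : ℝ
  K : ℝ
  lam : ℕ
  O : Set ℝ
  u : Dir → SPF
  A : Dir → SPF
  δ_pos : 0 < δ
  κ_pos : 0 < κ
  κ_le : κ ≤ 1
  δ_le : δ ≤ κ * √κ
  Z_ge : 1 ≤ Z
  Z_le : Z ≤ Λ
  K_ge : 1 ≤ K
  lam_ge : 90 * K * Λ / δ ≤ lam
  isOpen : IsOpen O
  u_le : ∀ (j : Fin 3) q, |u (some j) q| ≤ V
  pd_u : ∀ d i, Bd1 (fun d => scale Λ Z d / δ) N (scale Λ Z d) (pd d (u i))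
  A_le : ∀ i q, |A i q| ≤ M₀ * √κ
  pd_A : ∀ d i, Bd1 (fun d => scale Λ Z d / δ) N (κ / δ * scale Λ Z d) (pd d (A i))
  orth : ∑ j, (k j : ℝ) • A (some j) = 0
  A_mem : ∀ i, A i ∈ vanish O

/-- The linearisation of the equations around `u`, acting on fields of zero divergence. -/
def lin (u F : Dir → SPF) (i : Dir) : SPF :=
  pd none (F i) + ∑ j, u (some j) * pd (some j) (F i) + F i * ∑ j, pd (some j) (u (some j))
    + ∑ j, F (some j) * pd (some j) (u i) - pd (some 2) (pd (some 2) (F i))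
    - if i = some 2 then F none else 0

namespace Stage

variable {N : ℕ} {V M₀ : ℝ} {k : Fin 3 → ℤ} (S : Stage N V M₀ k)

def sc (d : Dir) : ℝ := scale S.Λ S.Z d

/-- Resolution of the phase decomposition. -/
def μ : ℝ := S.K * √S.κ / S.δ

/-- Derivative cost of the slow amplitudes. -/
def w (d : Dir) : ℝ := 3 * S.K * S.sc d / S.δ

/-- The rescaled velocity in the direction of oscillation. -/
def s : SPF := S.μ • ∑ j, (k j : ℝ) • S.u (some j)

theorem sqrt_pos : 0 < √S.κ := Real.sqrt_pos.2 S.κ_pos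
theorem sqrt_le : √S.κ ≤ 1 := Real.sqrt_le_one.2 S.κ_le
theorem sq_sqrt : √S.κ * √S.κ = S.κ := Real.mul_self_sqrt S.κ_pos.le
theorem κ_le_sqrt : S.κ ≤ √S.κ := by nlinarith [S.sq_sqrt, S.sqrt_pos, S.sqrt_le]
theorem δ_le_κ : S.δ ≤ S.κ := S.δ_le.trans (by nlinarith [S.κ_pos, S.sqrt_le])
theorem δ_le_one : S.δ ≤ 1 := S.δ_le_κ.trans S.κ_le
theorem K_pos : 0 < S.K := zero_lt_one.trans_le S.K_ge
theorem Z_pos : 0 < S.Z := zero_lt_one.trans_le S.Z_ge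
theorem Λ_ge : 1 ≤ S.Λ := S.Z_ge.trans S.Z_le
theorem Λ_pos : 0 < S.Λ := zero_lt_one.trans_le S.Λ_ge
theorem sc_ge (d : Dir) : 1 ≤ S.sc d := S.Z_ge.trans (le_scale S.Z_le d)
theorem sc_pos (d : Dir) : 0 < S.sc d := zero_lt_one.trans_le (S.sc_ge d)
theorem sc_le (d : Dir) : S.sc d ≤ S.Λ := scale_le S.Z_le d
theorem V_nonneg (S : Stage N V M₀ k) : 0 ≤ V := (abs_nonneg _).trans (S.u_le 0 0)
theorem M_nonneg (S : Stage N V M₀ k) : 0 ≤ M₀ := by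
  have := (abs_nonneg _).trans (S.A_le none 0)
  exact nonneg_of_mul_nonneg_left this S.sqrt_pos

theorem μ_pos : 0 < S.μ := div_pos (mul_pos S.K_pos S.sqrt_pos) S.δ_pos

theorem μ_ge : 1 ≤ S.μ := by
  rw [μ, le_div_iff₀ S.δ_pos]
  nlinarith [S.K_ge, S.sqrt_pos, S.δ_le_κ, S.κ_le_sqrt]

theorem w_pos (d : Dir) : 0 < S.w d :=
  div_pos (mul_pos (mul_pos three_pos S.K_pos) (S.sc_pos d)) S.δ_pos

theorem w_nonneg (S : Stage N V M₀ k) (d : Dir) : 0 ≤ S.w d := (S.w_pos d).le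

theorem sc_div_le_w (d : Dir) : S.sc d / S.δ ≤ S.w d := by
  rw [w, div_le_div_iff_of_pos_right S.δ_pos]
  nlinarith [S.K_ge, S.sc_pos d]

theorem lam_pos' : (0 : ℝ) < S.lam :=
  (div_pos (mul_pos (mul_pos (by norm_num) S.K_pos) S.Λ_pos) S.δ_pos).trans_le S.lam_ge

theorem lam_pos : 0 < S.lam := by exact_mod_cast S.lam_pos'

theorem w_le_lam (d : Dir) : 30 * S.w d ≤ S.lam := by
  refine le_trans ?_ S.lam_ge
  rw [w, ← mul_div_assoc, div_le_div_iff_of_pos_right S.δ_pos]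
  nlinarith [S.K_pos, S.sc_le d, S.sc_pos d, mul_le_mul_of_nonneg_left (S.sc_le d) S.K_pos.le]

theorem w0_nonneg (d : Dir) : 0 ≤ scale S.Λ S.Z d / S.δ := div_nonneg (S.sc_pos d).le S.δ_pos.le

theorem μ_sc_le (d : Dir) : 2 * (S.μ * S.sc d) ≤ S.w d := by
  rw [w, μ, div_mul_eq_mul_div, mul_div_assoc', div_le_div_iff_of_pos_right S.δ_pos]
  have h := mul_pos S.K_pos (S.sc_pos d)
  nlinarith [S.sqrt_le, S.sqrt_pos]

theorem bd_pd_s (hk : Horizontal k) (d : Dir) :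
    Bd1 S.w N (2 * (S.μ * S.sc d)) (pd d S.s) := by
  have h : ∀ j : Fin 3, Bd1 S.w N (S.sc d) (pd d (S.u (some j))) := fun j =>
    (S.pd_u d (some j)).mono S.w0_nonneg S.sc_div_le_w le_rfl le_rfl
  have e : pd d S.s = S.μ • ((k 0 : ℝ) • pd d (S.u (some 0)) + (k 1 : ℝ) • pd d (S.u (some 1))) := by
    simp [s, Fin.sum_univ_three, hk.two]
  have h01 := ((h 0).smul (r := fun _ => (k 0 : ℝ)) zero_le_one
    (fun _ => hk.abs_coeff_le (some 0))).add ((h 1).smul (r := fun _ => (k 1 : ℝ)) zero_le_one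
    (fun _ => hk.abs_coeff_le (some 1)))
  rw [e]
  refine (h01.smul (r := fun _ => S.μ) S.μ_pos.le fun _ => (abs_of_pos S.μ_pos).le).mono_right
    S.w_nonneg (le_of_eq (by ring))

theorem abs_s_le (hk : Horizontal k) (q : SpaceTime) : |S.s q| ≤ 2 * S.μ * V := by
  have e : S.s q = S.μ * (k 0 * S.u (some 0) q + k 1 * S.u (some 1) q) := by
    simp [s, Fin.sum_univ_three, hk.two, mul_add]
  have h : ∀ j, |(k j : ℝ) * S.u (some j) q| ≤ 1 * V := fun j => by
    rw [abs_mul]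
    exact mul_le_mul (hk.abs_coeff_le (some j)) (S.u_le j q) (abs_nonneg _) zero_le_one
  rw [e, abs_mul, abs_of_pos S.μ_pos]
  have := (abs_add_le _ _).trans (add_le_add (h 0) (h 1))
  nlinarith [S.μ_pos]

section Cutoff

variable {φ : ℝ → ℝ} (hφ : UnitBump φ)

/-- The cutoff isolating the `m`-th unit interval of values of `s`. -/
def cut (m : ℤ) : SPF :=
  comp (fun x => φ (x - m)) (hφ.smooth.comp (contDiff_id.sub contDiff_const)) S.s

theorem cut_apply (m : ℤ) (q : SpaceTime) : S.cut hφ m q = φ (S.s q - m) := rfl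

theorem pd_cut (d : Dir) (m : ℤ) : pd d (S.cut hφ m) = S.cut hφ.deriv m * pd d S.s := by
  rw [cut, pd_comp]
  congr 1
  ext q
  simp only [comp_apply, cut_apply]
  exact deriv_comp_sub_const _ _ _

theorem sub_mul_cut (m : ℤ) :
    (S.s - algebraMap ℝ SPF m) * S.cut hφ m = S.cut hφ.id_mul m := by
  ext q; simp [cut_apply]

theorem isO_cut (hk : Horizontal k) :
    IsO (D := Stage N V M₀ k) w N (fun _ => 1) fun S m => S.cut hφ m := by
  obtain ⟨C, hC, h⟩ := hφ.exists_bound N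
  refine ⟨compConst N * C, mul_nonneg (zero_le_one.trans (one_le_compConst N)) hC, fun S => ?_⟩
  rw [mul_one]
  exact bd_comp S.w_nonneg _ h fun d => (S.bd_pd_s hk d).mono_right S.w_nonneg (S.μ_sc_le d)

theorem isO_amp (i : Dir) :
    IsO (D := Stage N V M₀ k) w N (fun S => √S.κ) fun S (_ : Unit) => S.A i := by
  refine ⟨max 1 M₀, by positivity, fun S => ?_⟩
  cases N with
  | zero =>
    exact (bd1_of_abs_le (w := S.w) (S.A_le i)).mono_right S.w_nonneg
      (mul_le_mul_of_nonneg_right (le_max_right _ _) S.sqrt_pos.le)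
  | succ N =>
    refine bd1_succ (fun q => (S.A_le i q).trans
      (mul_le_mul_of_nonneg_right (le_max_right _ _) S.sqrt_pos.le)) fun d => ?_
    refine (S.pd_A d i).mono S.w0_nonneg S.sc_div_le_w (Nat.le_succ N) ?_
    calc S.κ / S.δ * S.sc d = S.κ * (S.sc d / S.δ) := by ring
      _ ≤ √S.κ * S.w d := mul_le_mul S.κ_le_sqrt (S.sc_div_le_w d)
          (div_pos (S.sc_pos d) S.δ_pos).le S.sqrt_pos.le
      _ = S.w d * (1 * √S.κ) := by ring
      _ ≤ _ := mul_le_mul_of_nonneg_left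
          (mul_le_mul_of_nonneg_right (le_max_left _ _) S.sqrt_pos.le) (S.w_nonneg d)

theorem isO_pd_amp (d i : Dir) :
    IsO (D := Stage N V M₀ k) w N (fun S => √S.κ * S.μ * S.sc d) fun S (_ : Unit) =>
      pd d (S.A i) := by
  refine ⟨1, zero_le_one, fun S => (S.pd_A d i).mono S.w0_nonneg S.sc_div_le_w le_rfl ?_⟩
  have : √S.κ * S.μ * S.sc d = S.K * (S.κ / S.δ * S.sc d) := by
    rw [μ]
    linear_combination (S.K / S.δ * S.sc d) * S.sq_sqrt
  simp only [one_mul, this]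
  exact le_mul_of_one_le_left (mul_pos (div_pos S.κ_pos S.δ_pos) (S.sc_pos d)).le S.K_ge

theorem isO_pd_s (hk : Horizontal k) (d : Dir) :
    IsO (D := Stage N V M₀ k) w N (fun S => S.μ * S.sc d) fun S (_ : Unit) => pd d S.s :=
  ⟨2, zero_le_two, fun S => S.bd_pd_s hk d⟩

/-- A localised amplitude. -/
def loc (i : Dir) (m : ℤ) : SPF := S.cut hφ m * S.A i

/-- Its derivative, with independent choices of the two cutoffs. -/
def pdLoc {ψ : ℝ → ℝ} (hψ : UnitBump ψ) (d i : Dir) (m : ℤ) : SPF :=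
  S.cut hψ m * pd d S.s * S.A i + S.cut hφ m * pd d (S.A i)

theorem pd_loc (d i : Dir) (m : ℤ) : pd d (S.loc hφ i m) = S.pdLoc hφ hφ.deriv d i m := by
  rw [loc, pd_mul, pd_cut, pdLoc]

theorem sub_mul_loc (i : Dir) (m : ℤ) :
    (S.s - algebraMap ℝ SPF m) * S.loc hφ i m = S.loc hφ.id_mul i m := by
  rw [loc, ← mul_assoc, sub_mul_cut, loc]

theorem sub_mul_pd_loc (d i : Dir) (m : ℤ) :
    (S.s - algebraMap ℝ SPF m) * pd d (S.loc hφ i m) =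
      S.pdLoc hφ.id_mul hφ.deriv.id_mul d i m := by
  rw [pd_loc, pdLoc, pdLoc, ← S.sub_mul_cut hφ, ← S.sub_mul_cut hφ.deriv]
  ring

theorem isO_loc (hk : Horizontal k) (i : Dir) :
    IsO (D := Stage N V M₀ k) w N (fun S => √S.κ) fun S m => S.loc hφ i m := by
  simpa only [one_mul, loc] using (isO_cut hφ hk).mul w_nonneg (isO_amp i)

theorem isO_pdLoc (hk : Horizontal k) {ψ : ℝ → ℝ} (hψ : UnitBump ψ) (d i : Dir) :
    IsO (D := Stage N V M₀ k) w N (fun S => √S.κ * S.μ * S.sc d) fun S m =>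
      S.pdLoc hφ hψ d i m := by
  refine IsO.add w_nonneg ?_ ?_
  · refine (((isO_cut hψ hk).mul w_nonneg (isO_pd_s hk d)).mul w_nonneg (isO_amp i)).mono
      w_nonneg le_rfl 1 zero_le_one fun S => le_of_eq (by ring)
  · simpa only [one_mul] using (isO_cut hφ hk).mul w_nonneg (isO_pd_amp d i)

end Cutoff

theorem isO_u {n : ℕ} (hn : n ≤ N) (j : Fin 3) :
    IsO (D := Stage N V M₀ k) w n (fun _ => 1) fun S (_ : Unit) => S.u (some j) := by
  refine ⟨max 1 V, by positivity, fun S => ?_⟩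
  simp only [mul_one]
  have h0 : ∀ q, |S.u (some j) q| ≤ max 1 V := fun q => (S.u_le j q).trans (le_max_right _ _)
  cases n with
  | zero => exact bd1_of_abs_le h0
  | succ n =>
    refine bd1_succ h0 fun d => (S.pd_u d _).mono S.w0_nonneg S.sc_div_le_w (by omega) ?_
    have h1 : S.sc d ≤ S.w d :=
      (le_div_self (S.sc_pos d).le S.δ_pos S.δ_le_one).trans (S.sc_div_le_w d)
    exact h1.trans (le_mul_of_one_le_right (S.w_nonneg d) (le_max_left _ _))

theorem isO_pd_u {n : ℕ} (hn : n ≤ N) (d i : Dir) :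
    IsO (D := Stage N V M₀ k) w n (fun S => S.Λ) fun S (_ : Unit) => pd d (S.u i) :=
  ⟨1, zero_le_one, fun S => (S.pd_u d i).mono S.w0_nonneg S.sc_div_le_w hn
    (by rw [one_mul]; exact S.sc_le d)⟩

/-- The linearised operator applied to a family. -/
theorem isO_lin {ι : Type} {n : ℕ} (hn : n ≤ N) {F : Stage N V M₀ k → Dir → ι → SPF}
    {E : Stage N V M₀ k → ℝ} (hE : ∀ S, 0 ≤ E S)
    (h0 : ∀ i, IsO w n (fun S => E S / S.Λ) fun S => F S i)
    (h1 : ∀ d i, IsO w n E fun S m => pd d (F S i m))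
    (h2 : ∀ i, IsO w n E fun S m => pd (some 2) (pd (some 2) (F S i m))) (i : Dir) :
    IsO w n E fun S m => lin S.u (fun i => F S i m) i := by
  have hF : ∀ i, IsO w n E fun S => F S i := fun i =>
    (h0 i).mono w_nonneg le_rfl 1 zero_le_one fun S => by
      rw [one_mul]; exact div_le_self (hE S) S.Λ_ge
  have hc : ∀ S : Stage N V M₀ k, E S / S.Λ * S.Λ ≤ 1 * E S := fun S => by
    rw [one_mul, div_mul_cancel₀ _ S.Λ_pos.ne']
  refine ((((IsO.add w_nonneg (h1 none i) (IsO.sum w_nonneg _ fun j _ => ?_)).add w_nonneg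
    ?_).add w_nonneg (IsO.sum w_nonneg _ fun j _ => ?_)).sub w_nonneg (h2 i)).sub w_nonneg ?_
  · simpa only [mul_comm (pd _ _), mul_one] using (h1 (some j) i).mul w_nonneg (isO_u hn j)
  · exact ((h0 i).mul w_nonneg (IsO.sum w_nonneg _ fun j _ => isO_pd_u hn (some j) (some j))).mono
      w_nonneg le_rfl 1 zero_le_one hc
  · exact ((h0 (some j)).mul w_nonneg (isO_pd_u hn (some j) i)).mono
      w_nonneg le_rfl 1 zero_le_one hc
  · split_ifs
    · exact hF none
    · exact isO_zero w_nonneg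

end Stage

/-- The normalised cutoff. -/
def bump (s : ℝ) : ℝ := √2 * profile s

theorem unitBump_bump : UnitBump bump where
  smooth := contDiff_const.mul unitBump_profile.smooth
  zero s hs := by rw [bump, unitBump_profile.zero s hs, mul_zero]

/-- Frequency factor of the `m`-th wave; neighbouring waves have different factors. -/
def par (m : ℤ) : ℤ := if Even m then 1 else 2

theorem one_le_par (m : ℤ) : (1 : ℝ) ≤ par m := by unfold par; split_ifs <;> norm_num

theorem par_le_two (m : ℤ) : (par m : ℝ) ≤ 2 := by unfold par; split_ifs <;> norm_num

namespace Stage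

variable {N : ℕ} {V M₀ : ℝ} {k : Fin 3 → ℤ} (S : Stage N V M₀ k)

/-- The principal amplitudes. -/
def a (i : Dir) (m : ℤ) : SPF := S.loc unitBump_bump i m

/-- The corrector built from the derivatives `G j i` of an amplitude. -/
def corr (G : Fin 3 → Dir → ℤ → SPF) (i : Dir) (m : ℤ) : SPF :=
  ((par m * S.lam * len2 k)⁻¹ : ℝ) •
    ∑ j, ((k j : ℝ) • G j i m - coeff k i • G j (some j) m)

/-- The corrector amplitudes, which make the perturbation divergence free. -/
def c (i : Dir) (m : ℤ) : SPF := S.corr (fun j i m => pd (some j) (S.a i m)) i m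

theorem sub_mul_c (i : Dir) (m : ℤ) : (S.s - algebraMap ℝ SPF m) * S.c i m =
    S.corr (fun j => S.pdLoc unitBump_bump.id_mul unitBump_bump.deriv.id_mul (some j)) i m := by
  simp only [c, corr, a, mul_smul_comm, Finset.mul_sum, mul_sub, sub_mul_pd_loc]

theorem isO_corr (hk : Horizontal k) {n : ℕ} {G : Stage N V M₀ k → Fin 3 → Dir → ℤ → SPF}
    {E : Stage N V M₀ k → ℝ} (hG : ∀ j i, IsO w n E fun S => G S j i) (i : Dir) :
    IsO w n (fun S => (S.lam : ℝ)⁻¹ * E S) fun S m => S.corr (G S) i m := by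
  have hs : ∀ (r : Dir) (j : Fin 3) (i : Dir), IsO w n E fun S m => coeff k r • G S j i m :=
    fun r j i => by
      simpa only [one_mul] using IsO.smul (c := fun _ => 1) (r := fun _ _ => coeff k r)
        (fun _ => zero_le_one) (fun _ _ => hk.abs_coeff_le r) (hG j i)
  refine IsO.smul (fun S => (inv_pos.2 S.lam_pos').le) (fun S m => ?_)
    (IsO.sum w_nonneg _ fun j _ => (hs (some j) j i).sub w_nonneg (hs i j (some j)))
  have h1 : (S.lam : ℝ) ≤ par m * S.lam * len2 k := by
    have := mul_le_mul (one_le_par m) hk.one_le zero_le_one (by linarith [one_le_par m])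
    nlinarith [S.lam_pos']
  rw [abs_of_nonneg (inv_nonneg.2 (S.lam_pos'.le.trans h1))]
  exact inv_anti₀ S.lam_pos' h1

/-- Size of the slow part of the error. -/
def E (S : Stage N V M₀ k) : ℝ := √S.κ * S.μ * (S.Λ + S.Z * S.w (some 2))

theorem E_nonneg (S : Stage N V M₀ k) : 0 ≤ S.E :=
  mul_nonneg (mul_pos S.sqrt_pos S.μ_pos).le
    (add_nonneg S.Λ_pos.le (mul_pos S.Z_pos (S.w_pos _)).le)

theorem le_E : √S.κ * S.μ * S.Λ ≤ S.E :=
  mul_le_mul_of_nonneg_left (le_add_of_nonneg_right (mul_pos S.Z_pos (S.w_pos _)).le)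
    (mul_pos S.sqrt_pos S.μ_pos).le

theorem le_E' : √S.κ * S.μ * (S.Z * S.w (some 2)) ≤ S.E :=
  mul_le_mul_of_nonneg_left (le_add_of_nonneg_left S.Λ_pos.le)
    (mul_pos S.sqrt_pos S.μ_pos).le

theorem isO_a (hk : Horizontal k) (i : Dir) :
    IsO (D := Stage N V M₀ k) w N (fun S => √S.κ) fun S => S.a i := isO_loc _ hk i

theorem isO_pd_a (hk : Horizontal k) (d i : Dir) :
    IsO (D := Stage N V M₀ k) w N (fun S => √S.κ * S.μ * S.sc d) fun S m => pd d (S.a i m) := by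
  simpa only [a, pd_loc] using isO_pdLoc unitBump_bump hk unitBump_bump.deriv d i

theorem isO_pd_a' (hk : Horizontal k) (d i : Dir) :
    IsO (D := Stage N V M₀ k) w N (fun S => √S.κ * S.μ * S.Λ) fun S m => pd d (S.a i m) :=
  (isO_pd_a hk d i).mono w_nonneg le_rfl 1 zero_le_one fun S => by
    rw [one_mul]
    exact mul_le_mul_of_nonneg_left (S.sc_le d) (mul_pos S.sqrt_pos S.μ_pos).le

theorem isO_c (hk : Horizontal k) (i : Dir) :
    IsO (D := Stage N V M₀ k) w N (fun S => (S.lam : ℝ)⁻¹ * (√S.κ * S.μ * S.Λ)) fun S => S.c i :=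
  isO_corr hk (fun j i => isO_pd_a' hk (some j) i) i

theorem isO_sub_mul_c (hk : Horizontal k) (i : Dir) :
    IsO (D := Stage N V M₀ k) w N (fun S => (S.lam : ℝ)⁻¹ * (√S.κ * S.μ * S.Λ)) fun S (m : ℤ) =>
      (S.s - algebraMap ℝ SPF m) * S.c i m := by
  simp only [sub_mul_c]
  refine isO_corr hk (fun j i => (isO_pdLoc _ hk _ (some j) i).mono w_nonneg le_rfl 1
    zero_le_one fun S => ?_) i
  rw [one_mul]
  exact mul_le_mul_of_nonneg_left (S.sc_le _) (mul_pos S.sqrt_pos S.μ_pos).le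

/-- Rate at which the background field transports the phase, up to the factor `s - m`. -/
def rate (m : ℤ) : ℝ := par m * S.lam / S.μ

theorem abs_rate_le (m : ℤ) : |S.rate m| ≤ 2 * S.lam / S.μ := by
  have := one_le_par m
  rw [rate, abs_of_nonneg (div_nonneg (mul_nonneg (by linarith) S.lam_pos'.le) S.μ_pos.le)]
  exact div_le_div_of_nonneg_right
    (mul_le_mul_of_nonneg_right (par_le_two m) S.lam_pos'.le) S.μ_pos.le

theorem isO_rate_c (hk : Horizontal k) (i : Dir) :
    IsO (D := Stage N V M₀ k) w N E fun S (m : ℤ) =>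
      S.rate m • ((S.s - algebraMap ℝ SPF m) * S.c i m) := by
  refine (IsO.smul (fun S => ?_) (fun S m => S.abs_rate_le m) (isO_sub_mul_c hk i)).mono w_nonneg
    le_rfl 2 zero_le_two fun S => ?_
  · exact div_nonneg (mul_nonneg zero_le_two S.lam_pos'.le) S.μ_pos.le
  · have h1 := S.lam_pos'.ne'
    have h2 := S.μ_pos.ne'
    have h3 : 2 * S.lam / S.μ * ((S.lam : ℝ)⁻¹ * (√S.κ * S.μ * S.Λ)) = 2 * (√S.κ * S.Λ) := by
      field_simp
    simp only [h3]
    refine mul_le_mul_of_nonneg_left (le_trans ?_ S.le_E) zero_le_two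
    refine mul_le_mul_of_nonneg_right ?_ S.Λ_pos.le
    exact le_mul_of_one_le_right S.sqrt_pos.le S.μ_ge

theorem isO_rate_a (hk : Horizontal k) (i : Dir) :
    IsO (D := Stage N V M₀ k) w N (fun S => S.δ * S.lam / S.K) fun S (m : ℤ) =>
      S.rate m • ((S.s - algebraMap ℝ SPF m) * S.a i m) := by
  simp only [a, sub_mul_loc]
  refine (IsO.smul (fun S => ?_) (fun S m => S.abs_rate_le m)
    (isO_loc unitBump_bump.id_mul hk i)).mono w_nonneg le_rfl 2 zero_le_two fun S => ?_
  · exact div_nonneg (mul_nonneg zero_le_two S.lam_pos'.le) S.μ_pos.le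
  · refine le_of_eq ?_
    have h1 := S.K_pos.ne'
    have h2 := S.δ_pos.ne'
    have h3 := S.sqrt_pos.ne'
    simp only [μ]
    field_simp

end Stage

namespace Stage

variable {N : ℕ} {V M₀ : ℝ} {k : Fin 3 → ℤ}

theorem isO_lin_a (hk : Horizontal k) (i : Dir) :
    IsO (D := Stage (N + 2) V M₀ k) w N E fun S m => lin S.u (fun i => S.a i m) i := by
  have hp : ∀ S : Stage (N + 2) V M₀ k, 0 < √S.κ * S.μ := fun S => mul_pos S.sqrt_pos S.μ_pos
  refine isO_lin (by omega) E_nonneg (fun i => ?_) (fun d i => ?_) (fun i => ?_) i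
  · refine (isO_a hk i).mono w_nonneg (by omega) 1 zero_le_one fun S => ?_
    rw [one_mul, le_div_iff₀ S.Λ_pos]
    refine le_trans ?_ S.le_E
    exact mul_le_mul_of_nonneg_right (le_mul_of_one_le_right S.sqrt_pos.le S.μ_ge) S.Λ_pos.le
  · refine (isO_pd_a' hk d i).mono w_nonneg (by omega) 1 zero_le_one fun S => ?_
    rw [one_mul]
    exact S.le_E
  · refine (((isO_pd_a hk (some 2) i).of_le w_nonneg (n' := N + 1) (by omega)).pd (some 2)).mono
      w_nonneg le_rfl 1 zero_le_one fun S => le_trans (le_of_eq ?_) (S.le_E'.trans_eq (one_mul _).symm)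
    simp only [sc, scale]
    simp only [if_true]
    ring

theorem isO_lin_c (hk : Horizontal k) (i : Dir) :
    IsO (D := Stage (N + 2) V M₀ k) w N E fun S m => lin S.u (fun i => S.c i m) i := by
  have hp : ∀ S : Stage (N + 2) V M₀ k, 0 < √S.κ * S.μ := fun S => mul_pos S.sqrt_pos S.μ_pos
  have hd : ∀ (S : Stage (N + 2) V M₀ k) d, S.w d * (S.lam : ℝ)⁻¹ ≤ 1 := fun S d => by
    rw [← div_eq_mul_inv, div_le_one S.lam_pos']
    linarith [S.w_le_lam d, S.w_nonneg d]
  refine isO_lin (by omega) E_nonneg (fun i => ?_) (fun d i => ?_) (fun i => ?_) i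
  · refine (isO_c hk i).mono w_nonneg (by omega) 1 zero_le_one fun S => ?_
    rw [one_mul, le_div_iff₀ S.Λ_pos]
    refine le_trans ?_ S.le_E
    refine mul_le_of_le_one_left (mul_pos (hp S) S.Λ_pos).le ?_ |>.trans' (le_of_eq (mul_right_comm _ _ _))
    refine le_trans ?_ (hd S none)
    rw [mul_comm]
    refine mul_le_mul_of_nonneg_right ?_ (inv_pos.2 S.lam_pos').le
    refine (le_div_self S.Λ_pos.le S.δ_pos S.δ_le_one).trans ?_
    exact (S.sc_div_le_w none)
  · refine (((isO_c hk i).of_le w_nonneg (n' := N + 1) (by omega)).pd d).mono w_nonneg le_rfl 1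
      zero_le_one fun S => ?_
    rw [one_mul, ← mul_assoc]
    exact (mul_le_of_le_one_left (mul_pos (hp S) S.Λ_pos).le (hd S d)).trans S.le_E
  · refine (((isO_c hk i).pd (some 2)).pd (some 2)).mono w_nonneg le_rfl 1 zero_le_one fun S => ?_
    rw [one_mul]
    refine le_trans (le_of_eq ?_) ((mul_le_of_le_one_left (mul_nonneg (hp S).le
      (mul_pos S.Z_pos (S.w_pos (some 2))).le) (hd S none)).trans S.le_E')
    have : S.w (some 2) * S.Λ = S.Z * S.w none := by
      simp only [w, sc, scale]
      simp only [if_true, reduceCtorEq, if_false]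
      ring
    linear_combination (S.w (some 2) * (S.lam : ℝ)⁻¹ * √S.κ * S.μ) * this

/-- Coefficients of the cosine waves in the linearised operator. -/
def lead (S : Stage N V M₀ k) (i : Dir) (m : ℤ) : SPF :=
  lin S.u (fun i => S.a i m) i + S.rate m • ((S.s - algebraMap ℝ SPF m) * S.c i m)

/-- Coefficients of the sine waves in the linearised operator. -/
def sub (S : Stage N V M₀ k) (i : Dir) (m : ℤ) : SPF :=
  lin S.u (fun i => S.c i m) i - S.rate m • ((S.s - algebraMap ℝ SPF m) * S.a i m)

/-- Coefficients of the interactions of waves. -/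
def quad (S : Stage N V M₀ k) (r : ℤ × ℤ → ℝ) (i : Dir) (m : ℤ × ℤ) : SPF :=
  r m • ∑ j, pd (some j) (S.a i m.1 * S.a (some j) m.2)

theorem isO_lead (hk : Horizontal k) (i : Dir) :
    IsO (D := Stage (N + 2) V M₀ k) w N E fun S => S.lead i :=
  (isO_lin_a hk i).add w_nonneg ((isO_rate_c hk i).of_le w_nonneg (by omega))

theorem isO_sub (hk : Horizontal k) (i : Dir) :
    IsO (D := Stage (N + 2) V M₀ k) w N (fun S => S.E + S.δ * S.lam / S.K) fun S => S.sub i := by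
  refine IsO.sub w_nonneg ((isO_lin_c hk i).mono w_nonneg le_rfl 1 zero_le_one fun S => ?_)
    ((isO_rate_a hk i).mono w_nonneg (by omega) 1 zero_le_one fun S => ?_)
  · rw [one_mul]
    exact le_add_of_nonneg_right (div_pos (mul_pos S.δ_pos S.lam_pos') S.K_pos).le
  · rw [one_mul]
    exact le_add_of_nonneg_left S.E_nonneg

theorem isO_quad (hk : Horizontal k) {r : ℤ × ℤ → ℝ} (hr : ∀ m, |r m| ≤ 1) (i : Dir) :
    IsO (D := Stage (N + 2) V M₀ k) w N E fun S => S.quad r i := by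
  have h : ∀ j, IsO (D := Stage (N + 2) V M₀ k) w (N + 2) E fun S (m : ℤ × ℤ) =>
      pd (some j) (S.a i m.1 * S.a (some j) m.2) := fun j => by
    simp only [pd_mul]
    have hs : ∀ S : Stage (N + 2) V M₀ k, √S.κ * S.μ * S.Λ * √S.κ ≤ 1 * S.E := fun S => by
      rw [one_mul]
      exact (mul_le_of_le_one_right (mul_pos (mul_pos S.sqrt_pos S.μ_pos) S.Λ_pos).le
        S.sqrt_le).trans S.le_E
    exact (((isO_pd_a' hk (some j) i).prod w_nonneg (isO_a hk (some j))).mono w_nonneg le_rfl 1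
      zero_le_one hs).add w_nonneg (((isO_a hk i).prod w_nonneg (isO_pd_a' hk (some j) (some j))).mono
      w_nonneg le_rfl 1 zero_le_one fun S => by rw [mul_comm]; exact hs S)
  have := IsO.smul (c := fun _ => 1) (r := fun _ => r) (fun _ => zero_le_one) (fun _ => hr)
    (IsO.sum w_nonneg Finset.univ fun j _ => h j)
  simp only [one_mul] at this
  exact this.of_le w_nonneg (by omega)

variable (S : Stage N V M₀ k)

/-- The wave amplitudes vanish outside a bounded range of indices. -/
theorem a_eq_zero (hk : Horizontal k) {m : ℤ} (hm : 2 * S.μ * V + 1 ≤ |(m : ℝ)|) (i : Dir) :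
    S.a i m = 0 := by
  have : S.cut unitBump_bump m = 0 := by
    ext q
    refine unitBump_bump.zero _ ?_
    have h1 := S.abs_s_le hk q
    have h2 := abs_sub_abs_le_abs_sub (m : ℝ) (S.s q)
    rw [abs_sub_comm] at h2
    linarith
  rw [a, loc, this, zero_mul]

theorem a_mul_a (hne : m ≠ m') (h : Even m ↔ Even m') (i j : Dir) : S.a i m * S.a j m' = 0 := by
  ext q
  have h := profile_mul_profile (s := S.s q) hne h
  simp only [a, loc, mul_apply, cut_apply, bump, zero_apply]
  linear_combination (2 * S.A i q * S.A j q * √2 * √2 / 2) * h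

theorem corr_eq_zero {G : Fin 3 → Dir → ℤ → SPF} {m : ℤ} (h : ∀ j i, G j i m = 0) (i : Dir) :
    S.corr G i m = 0 := by simp [corr, h]

theorem c_eq_zero {m : ℤ} (h : ∀ i, S.a i m = 0) (i : Dir) : S.c i m = 0 :=
  S.corr_eq_zero (fun j i => by rw [h, map_zero]) i

theorem lin_zero (u : Dir → SPF) (i : Dir) : lin u (fun _ => 0) i = 0 := by simp [lin]

theorem lead_eq_zero {m : ℤ} (h : ∀ i, S.a i m = 0) (i : Dir) : S.lead i m = 0 := by
  simp [lead, h, c_eq_zero S h, lin_zero]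

theorem sub_eq_zero {m : ℤ} (h : ∀ i, S.a i m = 0) (i : Dir) : S.sub i m = 0 := by
  simp [sub, h, c_eq_zero S h, lin_zero]

theorem quad_eq_zero {r : ℤ × ℤ → ℝ} {m : ℤ × ℤ} (h : ∀ i j, S.a i m.1 * S.a j m.2 = 0)
    (i : Dir) : S.quad r i m = 0 := by
  simp [quad, h]

theorem a_mem (i : Dir) (m : ℤ) : S.a i m ∈ vanish S.O := Ideal.mul_mem_left _ _ (S.A_mem i)

theorem c_mem (i : Dir) (m : ℤ) : S.c i m ∈ vanish S.O :=
  smul_mem_vanish _ (sum_mem fun _ _ => sub_mem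
    (smul_mem_vanish _ (pd_mem_vanish S.isOpen _ (S.a_mem _ _)))
    (smul_mem_vanish _ (pd_mem_vanish S.isOpen _ (S.a_mem _ _))))

end Stage

theorem lin_mem {O : Set ℝ} (hO : IsOpen O) {u F : Dir → SPF} (hF : ∀ i, F i ∈ vanish O) (i : Dir) :
    lin u F i ∈ vanish O := by
  have hp : ∀ d i, pd d (F i) ∈ vanish O := fun d i => pd_mem_vanish hO d (hF i)
  refine sub_mem (sub_mem (add_mem (add_mem (add_mem (hp _ _) (sum_mem fun j _ =>
    Ideal.mul_mem_left _ _ (hp _ _))) (Ideal.mul_mem_right _ _ (hF _))) (sum_mem fun j _ =>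
    Ideal.mul_mem_right _ _ (hF _))) (pd_mem_vanish hO _ (hp _ _))) ?_
  split_ifs
  exacts [hF _, zero_mem _]

namespace Stage

variable {N : ℕ} {V M₀ : ℝ} {k : Fin 3 → ℤ} (S : Stage N V M₀ k)

theorem lead_mem (i : Dir) (m : ℤ) : S.lead i m ∈ vanish S.O :=
  add_mem (lin_mem S.isOpen (fun i => S.a_mem i m) i)
    (smul_mem_vanish _ (Ideal.mul_mem_left _ _ (S.c_mem _ _)))

theorem sub_mem (i : Dir) (m : ℤ) : S.sub i m ∈ vanish S.O :=
  _root_.sub_mem (lin_mem S.isOpen (fun i => S.c_mem i m) i)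
    (smul_mem_vanish _ (Ideal.mul_mem_left _ _ (S.a_mem _ _)))

theorem quad_mem (r : ℤ × ℤ → ℝ) (i : Dir) (m : ℤ × ℤ) : S.quad r i m ∈ vanish S.O :=
  smul_mem_vanish _ (sum_mem fun _ _ =>
    pd_mem_vanish S.isOpen _ (Ideal.mul_mem_right _ _ (S.a_mem _ _)))

end Stage

theorem lin_add (u F G : Dir → SPF) (i : Dir) :
    lin u (fun i => F i + G i) i = lin u F i + lin u G i := by
  simp only [lin, map_add, mul_add, add_mul, Finset.sum_add_distrib]
  split_ifs <;> ring

theorem lin_sum {ι : Type} (u : Dir → SPF) (t : Finset ι) (F : Dir → ι → SPF) (i : Dir) :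
    lin u (fun i => ∑ m ∈ t, F i m) i = ∑ m ∈ t, lin u (fun i => F i m) i := by
  classical
  induction t using Finset.induction_on with
  | empty => simp [lin]
  | insert m t hm ih => simp only [Finset.sum_insert hm, lin_add, ih]

section Pw

variable {k : Fin 3 → ℤ} (lam : ℕ) (ν : ℤ) (ω σ : ℝ)

theorem pd_pw_some (j : Fin 3) :
    pd (some j) (pw k lam ν ω σ) = (ν * lam * k j : ℝ) • pw k lam ν ω (σ + Real.pi / 2) := by
  rw [pw, pd_wave]
  simp [pw]

theorem pd_pw_none : pd none (pw k lam ν ω σ) = ω • pw k lam ν ω (σ + Real.pi / 2) := by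
  rw [pw, pd_wave]
  simp [pw]

theorem pw_half_pi : pw k lam ν ω (Real.pi / 2) = -pw k lam ν ω (-(Real.pi / 2)) := by
  ext q
  simp only [pw, wave_apply, neg_apply]
  rw [← Real.cos_add_pi]
  congr 1
  ring

theorem pw_mul_pw (ν' : ℤ) (ω' : ℝ) : pw k lam ν ω 0 * pw k lam ν' ω' 0 =
    (1 / 2 : ℝ) • pw k lam (ν + ν') (ω + ω') 0 + (1 / 2 : ℝ) • pw k lam (ν - ν') (ω - ω') 0 := by
  ext q
  simp only [pw, wave_apply, mul_apply, add_apply, smul_apply]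
  have h := Real.cos_add (ω * q.1 + ∑ j, ((ν * lam * k j : ℤ) : ℝ) * q.2 j)
    (ω' * q.1 + ∑ j, ((ν' * lam * k j : ℤ) : ℝ) * q.2 j)
  have h' := Real.cos_sub (ω * q.1 + ∑ j, ((ν * lam * k j : ℤ) : ℝ) * q.2 j)
    (ω' * q.1 + ∑ j, ((ν' * lam * k j : ℤ) : ℝ) * q.2 j)
  simp only [add_zero]
  have e1 : (ω + ω') * q.1 + ∑ j, (((ν + ν') * lam * k j : ℤ) : ℝ) * q.2 j =
      (ω * q.1 + ∑ j, ((ν * lam * k j : ℤ) : ℝ) * q.2 j) +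
        (ω' * q.1 + ∑ j, ((ν' * lam * k j : ℤ) : ℝ) * q.2 j) := by
    simp only [Fin.sum_univ_three]; push_cast; ring
  have e2 : (ω - ω') * q.1 + ∑ j, (((ν - ν') * lam * k j : ℤ) : ℝ) * q.2 j =
      (ω * q.1 + ∑ j, ((ν * lam * k j : ℤ) : ℝ) * q.2 j) -
        (ω' * q.1 + ∑ j, ((ν' * lam * k j : ℤ) : ℝ) * q.2 j) := by
    simp only [Fin.sum_univ_three]; push_cast; ring
  rw [e1, e2, h, h']
  ring

theorem pw_zero : pw k lam 0 0 0 = 1 := by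
  ext q; simp [pw, wave_apply]

/-- The linearised operator on a modulated plane wave. -/
theorem lin_mul_pw {k : Fin 3 → ℤ} (hk : Horizontal k) (lam : ℕ) (ν : ℤ) (ω σ : ℝ)
    (u F : Dir → SPF) (i : Dir) :
    lin u (fun i => F i * pw k lam ν ω σ) i = lin u F i * pw k lam ν ω σ +
      F i * (algebraMap ℝ SPF ω + ∑ j, (ν * lam * k j : ℝ) • u (some j)) *
        pw k lam ν ω (σ + Real.pi / 2) := by
  have hz : pd (some 2) (pw k lam ν ω σ) = 0 := by simp [pd_pw_some, hk.two]
  simp only [lin, pd_mul, hz, mul_zero, add_zero, pd_pw_some, pd_pw_none,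
    Algebra.smul_def, Fin.sum_univ_three]
  split_ifs <;> ring

end Pw

/-- The average over the spatial torus. -/
def mean3 : SPF →ₗ[ℝ] SPF := mean 2 ∘ₗ mean 1 ∘ₗ mean 0

theorem mean3_apply (g : SPF) : mean3 g = mean 2 (mean 1 (mean 0 g)) := rfl

theorem mean3_pd (j : Fin 3) (g : SPF) : mean3 (pd (some j) g) = 0 := by
  rw [mean3_apply]
  match j with
  | 0 => rw [mean_pd_self, map_zero, map_zero]
  | 1 => rw [← pd_mean, mean_pd_self, map_zero]
  | 2 => rw [← pd_mean, ← pd_mean, mean_pd_self]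

theorem pd_mean3 (d : Dir) (g : SPF) : pd d (mean3 g) = mean3 (pd d g) := by
  simp only [mean3_apply, pd_mean]

/-- For divergence-free `F` of zero mean the linearised operator has zero mean. -/
theorem mean3_lin (u F : Dir → SPF) (hdiv : ∑ j, pd (some j) (F (some j)) = 0)
    (hF : ∀ i, mean3 (F i) = 0) (i : Dir) : mean3 (lin u F i) = 0 := by
  have e : lin u F i = pd none (F i) + ∑ j, pd (some j) (u (some j) * F i + u i * F (some j))
      - pd (some 2) (pd (some 2) (F i)) - if i = some 2 then F none else 0 := by
    rw [lin]
    simp only [Fin.sum_univ_three, map_add, pd_mul] at hdiv ⊢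
    linear_combination (-u i) * hdiv
  rw [e]
  simp only [map_sub, map_add, map_sum, mean3_pd, Finset.sum_const_zero, add_zero, sub_zero]
  rw [← pd_mean3, hF, map_zero, zero_sub, neg_eq_zero]
  split_ifs
  exacts [hF _, map_zero _]

namespace Stage

variable {N : ℕ} {V M₀ : ℝ} {k : Fin 3 → ℤ} (S : Stage N V M₀ k)

/-- Temporal frequency of the `m`-th wave. -/
def ω (m : ℤ) : ℝ := -(S.rate m * m)

/-- The `m`-th wave with phase shift `σ`. -/
def wv (σ : ℝ) (m : ℤ) : SPF := pw k S.lam (par m) (S.ω m) σ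

/-- The relevant indices. -/
def idx (S : Stage N V M₀ k) : Finset ℤ :=
  Finset.Icc (-(⌈2 * S.μ * V⌉ + 2)) (⌈2 * S.μ * V⌉ + 2)

def P (i : Dir) : SPF := ∑ m ∈ S.idx, S.a i m * S.wv 0 m

def Q (i : Dir) : SPF := ∑ m ∈ S.idx, S.c i m * S.wv (-(Real.pi / 2)) m

/-- The perturbation. -/
def W (i : Dir) : SPF := S.P i + S.Q i

theorem transport (m : ℤ) : algebraMap ℝ SPF (S.ω m) +
    ∑ j, ((par m : ℝ) * S.lam * k j) • S.u (some j) =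
      S.rate m • (S.s - algebraMap ℝ SPF m) := by
  ext q
  have h := S.μ_pos.ne'
  simp only [s, ω, rate, add_apply, algebraMap_apply, smul_apply, sub_apply, Fin.sum_univ_three]
  field_simp
  ring

theorem lin_W (hk : Horizontal k) (i : Dir) : lin S.u S.W i =
    ∑ m ∈ S.idx, S.lead i m * S.wv 0 m + ∑ m ∈ S.idx, S.sub i m * S.wv (-(Real.pi / 2)) m := by
  have e : lin S.u S.W i = lin S.u (fun i => S.P i + S.Q i) i := rfl
  rw [e, lin_add]
  unfold P Q
  rw [lin_sum, lin_sum, ← Finset.sum_add_distrib, ← Finset.sum_add_distrib]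
  refine Finset.sum_congr rfl fun m _ => ?_
  simp only [wv]
  rw [lin_mul_pw hk, lin_mul_pw hk, transport, zero_add, pw_half_pi, neg_add_cancel, lead, sub]
  simp only [Algebra.smul_def]
  ring

/-- The potential of the perturbation. -/
def B (i : Dir) (j : Fin 3) : SPF := ∑ m ∈ S.idx, ((par m * S.lam * len2 k)⁻¹ : ℝ) •
  (((k j : ℝ) • S.a i m - coeff k i • S.a (some j) m) * S.wv (-(Real.pi / 2)) m)

theorem sum_k_a (m : ℤ) : ∑ j, (k j : ℝ) • S.a (some j) m = 0 := by
  have h := congrArg (fun g => S.cut unitBump_bump m * g) S.orth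
  simpa only [a, loc, Finset.mul_sum, mul_smul_comm, mul_zero] using h

theorem div_B (hk : Horizontal k) (i : Dir) : ∑ j, pd (some j) (S.B i j) = S.W i := by
  have hl : len2 k ≠ 0 := (zero_lt_one.trans_le hk.one_le).ne'
  simp only [B, map_sum]
  rw [Finset.sum_comm, W, P, Q, ← Finset.sum_add_distrib]
  refine Finset.sum_congr rfl fun m _ => ?_
  have hs := S.sum_k_a m
  have hp : (par m : ℝ) ≠ 0 := by linarith [one_le_par m]
  have hlam := S.lam_pos'.ne'
  have e : ∀ j, pd (some j) (((par m * S.lam * len2 k)⁻¹ : ℝ) •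
      (((k j : ℝ) • S.a i m - coeff k i • S.a (some j) m) * S.wv (-(Real.pi / 2)) m)) =
      ((par m * S.lam * len2 k)⁻¹ : ℝ) • (((k j : ℝ) • pd (some j) (S.a i m) -
        coeff k i • pd (some j) (S.a (some j) m)) * S.wv (-(Real.pi / 2)) m) +
      (k j / len2 k : ℝ) • (((k j : ℝ) • S.a i m - coeff k i • S.a (some j) m) * S.wv 0 m) := by
    intro j
    simp only [wv, Derivation.map_smul, pd_mul, map_sub, pd_pw_some, neg_add_cancel, smul_add]
    congr 1
    rw [mul_smul_comm, smul_smul]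
    congr 1
    field_simp
  simp only [e, Finset.sum_add_distrib]
  rw [add_comm]
  congr 1
  · have h3 : ∑ j, (k j / len2 k : ℝ) • (((k j : ℝ) • S.a i m - coeff k i • S.a (some j) m) *
        S.wv 0 m) = (((len2 k)⁻¹ * ∑ j, (k j : ℝ) * k j) • S.a i m -
          ((len2 k)⁻¹ * coeff k i) • ∑ j, (k j : ℝ) • S.a (some j) m) * S.wv 0 m := by
      ext q
      simp only [add_apply, smul_apply, mul_apply, sub_apply, Fin.sum_univ_three]
      ring
    have h4 : (len2 k)⁻¹ * ∑ j, (k j : ℝ) * k j = 1 := by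
      rw [inv_mul_eq_one₀ hl, len2, Fin.sum_univ_three, hk.two]
      simp; ring
    rw [h3, hs, h4, one_smul, smul_zero, sub_zero]
  · simp only [c, corr, smul_mul_assoc, Finset.sum_mul, Finset.smul_sum]

theorem div_W (hk : Horizontal k) : ∑ j, pd (some j) (S.W (some j)) = 0 := by
  have h : ∀ i j, S.B (some i) j = -S.B (some j) i := fun i j => by
    simp only [B, ← Finset.sum_neg_distrib]
    refine Finset.sum_congr rfl fun m _ => ?_
    rw [← smul_neg]
    congr 1
    simp only [coeff_some]
    ring
  simp only [← S.div_B hk, map_sum]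
  have hd : ∀ j, S.B (some j) j = 0 := fun j => by simp [B]
  simp only [Fin.sum_univ_three, hd, h 1 0, h 2 0, h 2 1, map_neg, map_zero, pd_comm (some 1)
    (some 0), pd_comm (some 2) (some 0), pd_comm (some 2) (some 1)]
  ring

theorem mean3_W (hk : Horizontal k) (i : Dir) : mean3 (S.W i) = 0 := by
  simp only [← S.div_B hk, map_sum, mean3_pd, Finset.sum_const_zero]

theorem W_mem (i : Dir) : S.W i ∈ vanish S.O :=
  add_mem (sum_mem fun _ _ => Ideal.mul_mem_right _ _ (S.a_mem _ _))
    (sum_mem fun _ _ => Ideal.mul_mem_right _ _ (S.c_mem _ _))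

/-- Weights of the interactions of differing waves. -/
def offDiag (m : ℤ × ℤ) : ℝ := if m.1 = m.2 then 0 else 1 / 2

theorem floor_mem_idx (hk : Horizontal k) (q : SpaceTime) :
    ⌊S.s q⌋ ∈ S.idx ∧ ⌊S.s q⌋ + 1 ∈ S.idx := by
  have hs := abs_le.1 (S.abs_s_le hk q)
  have hc := Int.le_ceil (2 * S.μ * V)
  have hf := Int.floor_le (S.s q)
  have hf' := Int.lt_floor_add_one (S.s q)
  have b1 : -(⌈2 * S.μ * V⌉ + 2) ≤ ⌊S.s q⌋ := by
    have : (-(⌈2 * S.μ * V⌉ + 2) : ℝ) ≤ ⌊S.s q⌋ := by linarith [hs.1]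
    exact_mod_cast this
  have b2 : ⌊S.s q⌋ + 1 ≤ ⌈2 * S.μ * V⌉ + 2 := by
    have : (⌊S.s q⌋ + 1 : ℝ) ≤ ⌈2 * S.μ * V⌉ + 2 := by linarith [hs.2]
    exact_mod_cast this
  exact ⟨Finset.mem_Icc.2 ⟨b1, by omega⟩, Finset.mem_Icc.2 ⟨by omega, b2⟩⟩

theorem sum_diag (hk : Horizontal k) (i j : Dir) :
    ∑ m ∈ S.idx, (1 / 2 : ℝ) • (S.a i m * S.a j m) = S.A i * S.A j := by
  ext q
  simp only [sum_apply, smul_apply, mul_apply, a, loc, cut_apply, bump]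
  rw [sum_profile_eq (s := S.s q) (S.floor_mem_idx hk q).1 (S.floor_mem_idx hk q).2 _
    (fun m hm => by rw [hm]; ring)]
  have h1 := profile_sq_add (S.s q)
  have h2 : √2 * √2 = (2 : ℝ) := Real.mul_self_sqrt zero_le_two
  linear_combination (S.A i q * S.A j q) * h1 + (1 / 2 * S.A i q * S.A j q *
    (profile (S.s q - ⌊S.s q⌋) ^ 2 + profile (S.s q - (⌊S.s q⌋ + 1 : ℤ)) ^ 2)) * h2

theorem P_mul_P (hk : Horizontal k) (i j : Dir) : S.P i * S.P j = S.A i * S.A j +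
    ∑ m ∈ S.idx ×ˢ S.idx, (1 / 2 : ℝ) • (S.a i m.1 * S.a j m.2 *
      pw k S.lam (par m.1 + par m.2) (S.ω m.1 + S.ω m.2) 0) +
    ∑ m ∈ S.idx ×ˢ S.idx, offDiag m • (S.a i m.1 * S.a j m.2 *
      pw k S.lam (par m.1 - par m.2) (S.ω m.1 - S.ω m.2) 0) := by
  have hd : S.A i * S.A j = ∑ m ∈ S.idx ×ˢ S.idx, (if m.1 = m.2 then (1 / 2 : ℝ) else 0) •
      (S.a i m.1 * S.a j m.2 * pw k S.lam (par m.1 - par m.2) (S.ω m.1 - S.ω m.2) 0) := by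
    rw [← S.sum_diag hk, Finset.sum_product]
    refine Finset.sum_congr rfl fun m hm => ?_
    rw [Finset.sum_eq_single_of_mem m hm fun m' _ h => by simp [Ne.symm h]]
    simp [pw_zero]
  rw [hd, add_right_comm, ← Finset.sum_add_distrib, ← Finset.sum_add_distrib, P, P,
    Finset.sum_mul_sum, ← Finset.sum_product']
  refine Finset.sum_congr rfl fun m _ => ?_
  have e : S.a i m.1 * S.wv 0 m.1 * (S.a j m.2 * S.wv 0 m.2) =
      S.a i m.1 * S.a j m.2 * (S.wv 0 m.1 * S.wv 0 m.2) := by ring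
  rw [e, wv, wv, pw_mul_pw, offDiag, ← add_smul, mul_add, mul_smul_comm, mul_smul_comm, add_comm]
  split_ifs <;> norm_num

theorem div_quad (r : ℤ × ℤ → ℝ) (ν : ℤ × ℤ → ℤ) (ω : ℤ × ℤ → ℝ) (t : Finset (ℤ × ℤ)) (i : Dir) :
    ∑ j, pd (some j) (∑ m ∈ t, r m • (S.a i m.1 * S.a (some j) m.2 * pw k S.lam (ν m) (ω m) 0)) =
      ∑ m ∈ t, S.quad r i m * pw k S.lam (ν m) (ω m) 0 := by
  simp only [map_sum]
  rw [Finset.sum_comm]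
  refine Finset.sum_congr rfl fun m _ => ?_
  have h := S.sum_k_a m.2
  simp only [Derivation.map_smul, pd_mul (some _) (_ * _) (pw _ _ _ _ _), pd_pw_some, quad]
  simp only [Algebra.smul_def, Fin.sum_univ_three, map_mul] at h ⊢
  linear_combination (algebraMap ℝ SPF (r m) * S.a i m.1 * algebraMap ℝ SPF (ν m) *
    algebraMap ℝ SPF S.lam * pw k S.lam (ν m) (ω m) (0 + Real.pi / 2)) * h

theorem div_P_mul_P (hk : Horizontal k) (i : Dir) :
    ∑ j, pd (some j) (S.P i * S.P (some j)) = ∑ j, pd (some j) (S.A i * S.A (some j)) +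
    ∑ m ∈ S.idx ×ˢ S.idx, S.quad (fun _ => 1 / 2) i m *
      pw k S.lam (par m.1 + par m.2) (S.ω m.1 + S.ω m.2) 0 +
    ∑ m ∈ S.idx ×ˢ S.idx, S.quad offDiag i m *
      pw k S.lam (par m.1 - par m.2) (S.ω m.1 - S.ω m.2) 0 := by
  simp only [P_mul_P S hk, map_add, Finset.sum_add_distrib]
  congr 1
  · congr 1
    exact S.div_quad (fun _ => 1 / 2) (fun m => par m.1 + par m.2) (fun m => S.ω m.1 + S.ω m.2) _ i
  · exact S.div_quad offDiag (fun m => par m.1 - par m.2) (fun m => S.ω m.1 - S.ω m.2) _ i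

end Stage

namespace Stage

variable {n : ℕ} {V M₀ : ℝ} {k : Fin 3 → ℤ}

/-- Derivative cost of the waves. -/
def wf (S : Stage n V M₀ k) (d : Dir) : ℝ := if d = some 2 then S.w (some 2) else 8 * (V + 1) * S.lam

theorem w_le_wf (S : Stage n V M₀ k) (d : Dir) : S.w d ≤ S.wf d := by
  unfold wf
  split_ifs with h
  · rw [h]
  · have h1 := S.w_le_lam d
    have h2 := S.V_nonneg
    have h3 := S.lam_pos'
    have h4 := S.w_pos d
    nlinarith

theorem wf_nonneg (S : Stage n V M₀ k) (d : Dir) : 0 ≤ S.wf d := (S.w_nonneg d).trans (S.w_le_wf d)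

theorem wf_le (S : Stage n V M₀ k) (d : Dir) : S.wf d ≤ 8 * (V + 1) * S.lam := by
  unfold wf
  split_ifs with h
  · have h1 := S.w_le_lam (some 2)
    have h2 := S.V_nonneg
    have h3 := S.lam_pos'
    have h4 := S.w_pos (some 2)
    nlinarith
  · exact le_rfl

theorem wf_none (S : Stage n V M₀ k) : S.wf none = 8 * (V + 1) * S.lam := rfl

theorem abs_le_wf (S : Stage n V M₀ k) (hk : Horizontal k) {r : ℝ} (hr : |r| ≤ 4) (j : Fin 3) :
    |r * S.lam * k j| ≤ S.wf (some j) := by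
  have hV := S.V_nonneg
  have hl := S.lam_pos'
  match j with
  | 2 => rw [hk.two]; simpa using S.wf_nonneg _
  | 0 =>
    rw [abs_mul, abs_mul, abs_of_pos hl]
    have h := hk.abs_coeff_le (some 0)
    simp only [coeff_some] at h
    calc |r| * S.lam * |(k 0 : ℝ)| ≤ 4 * S.lam * 1 :=
          mul_le_mul (mul_le_mul_of_nonneg_right hr hl.le) h (abs_nonneg _) (by positivity)
      _ ≤ 8 * (V + 1) * S.lam := by nlinarith
  | 1 =>
    rw [abs_mul, abs_mul, abs_of_pos hl]
    have h := hk.abs_coeff_le (some 1)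
    simp only [coeff_some] at h
    calc |r| * S.lam * |(k 1 : ℝ)| ≤ 4 * S.lam * 1 :=
          mul_le_mul (mul_le_mul_of_nonneg_right hr hl.le) h (abs_nonneg _) (by positivity)
      _ ≤ 8 * (V + 1) * S.lam := by nlinarith

theorem abs_ω_le (S : Stage n V M₀ k) (hk : Horizontal k) (m : ℤ) :
    (∀ i, S.a i m = 0) ∨ |S.ω m| ≤ 4 * (V + 1) * S.lam := by
  by_cases hm : 2 * S.μ * V + 1 ≤ |(m : ℝ)|
  · exact Or.inl (S.a_eq_zero hk hm)
  · right
    rw [ω, abs_neg, abs_mul]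
    have hμ := S.μ_pos
    have hl := S.lam_pos'
    have hV := S.V_nonneg
    calc |S.rate m| * |(m : ℝ)| ≤ 2 * S.lam / S.μ * (2 * S.μ * V + 1) :=
          mul_le_mul (S.abs_rate_le m) (not_le.1 hm).le (abs_nonneg _) (by positivity)
      _ = 4 * V * S.lam + 2 * S.lam / S.μ := by field_simp; ring
      _ ≤ 4 * V * S.lam + 2 * S.lam := by
          gcongr
          exact div_le_self (by positivity) S.μ_ge
      _ ≤ _ := by nlinarith

theorem abs_par (m : ℤ) : |(par m : ℝ)| ≤ 2 := by
  rw [abs_of_nonneg (by linarith [one_le_par m])]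
  exact par_le_two m

theorem freq_wv (S : Stage n V M₀ k) (hk : Horizontal k) (m : ℤ) :
    (∀ i, S.a i m = 0) ∨ (par m ≠ 0 ∧ |S.ω m| ≤ S.wf none ∧
      ∀ j, |(par m * S.lam * k j : ℝ)| ≤ S.wf (some j)) := by
  refine (S.abs_ω_le hk m).imp id fun h => ⟨?_, ?_, S.abs_le_wf hk ((abs_par m).trans (by norm_num))⟩
  · have := one_le_par m
    intro h0
    rw [h0] at this
    norm_num at this
  · rw [wf_none]
    nlinarith [S.V_nonneg, S.lam_pos']

theorem freq_pair (S : Stage n V M₀ k) (hk : Horizontal k) {τ : ℤ} (hτ : |τ| = 1) (m : ℤ × ℤ)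
    (h0 : par m.1 + τ * par m.2 = 0 → ∀ i j, S.a i m.1 * S.a j m.2 = 0) :
    (∀ i j, S.a i m.1 * S.a j m.2 = 0) ∨ (par m.1 + τ * par m.2 ≠ 0 ∧
      |S.ω m.1 + τ * S.ω m.2| ≤ S.wf none ∧
      ∀ j, |(((par m.1 + τ * par m.2 : ℤ) : ℝ) * S.lam * k j : ℝ)| ≤ S.wf (some j)) := by
  have hτ' : |(τ : ℝ)| = 1 := by exact_mod_cast hτ
  by_cases hz : par m.1 + τ * par m.2 = 0
  · exact Or.inl (h0 hz)
  rcases S.abs_ω_le hk m.1 with h | h1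
  · exact Or.inl fun i j => by rw [h, zero_mul]
  rcases S.abs_ω_le hk m.2 with h | h2
  · exact Or.inl fun i j => by rw [h, mul_zero]
  refine Or.inr ⟨hz, ?_, S.abs_le_wf hk ?_⟩
  · refine (abs_add_le _ _).trans ?_
    rw [abs_mul, hτ', wf_none]
    linarith
  · push_cast
    refine (abs_add_le _ _).trans ?_
    rw [abs_mul, hτ']
    linarith [abs_par m.1, abs_par m.2]

/-- Contraction factor of one step of the oscillating inverse. -/
def θ (S : Stage n V M₀ k) : ℝ := 15 * S.w none / S.lam

theorem θ_nonneg (S : Stage n V M₀ k) : 0 ≤ S.θ :=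
  div_nonneg (mul_nonneg (by norm_num) (S.w_nonneg _)) S.lam_pos'.le

theorem θ_le (S : Stage n V M₀ k) : S.θ ≤ 1 / 2 := by
  rw [θ, div_le_iff₀ S.lam_pos']
  linarith [S.w_le_lam none]

theorem w_some_le (S : Stage n V M₀ k) (d : Dir) : S.w d ≤ S.w none := by
  have h1 : S.sc d ≤ S.sc none := S.sc_le d
  have := S.K_pos
  have := S.δ_pos
  unfold w
  gcongr

/-- Size of the coefficients of the oscillating terms. -/
def Y (S : Stage n V M₀ k) : ℝ := S.E + S.δ * S.lam / S.K

theorem E_le_Y (S : Stage n V M₀ k) : S.E ≤ S.Y :=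
  le_add_of_nonneg_right (div_pos (mul_pos S.δ_pos S.lam_pos') S.K_pos).le

theorem Y_nonneg (S : Stage n V M₀ k) : 0 ≤ S.Y := S.E_nonneg.trans S.E_le_Y

/-- `g` is, up to a small remainder, the divergence of a small tensor. -/
def Inverts (S : Stage n V M₀ k) (J N : ℕ) (C : ℝ) (g : Dir → SPF) : Prop :=
  ∃ (T : Dir → Fin 3 → SPF) (r : Dir → SPF), (∀ i, g i = ∑ j, pd (some j) (T i j) + r i) ∧
    (∀ i j, T (some i) j = T (some j) i) ∧ (∀ i j, T i j ∈ vanish S.O) ∧ (∀ i, r i ∈ vanish S.O) ∧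
    (∀ i j, Bd1 S.wf N (C * (S.Y / S.lam)) (T i j)) ∧ ∀ i, Bd1 S.wf N (C * (S.θ ^ J * S.Y)) (r i)

theorem Inverts.add {S : Stage n V M₀ k} {J N : ℕ} {C C' : ℝ} {g g' : Dir → SPF}
    (h : S.Inverts J N C g) (h' : S.Inverts J N C' g') :
    S.Inverts J N (C + C') fun i => g i + g' i := by
  obtain ⟨T1, r1, e1, s1, v1, v1', b1, b1'⟩ := h
  obtain ⟨T2, r2, e2, s2, v2, v2', b2, b2'⟩ := h'
  refine ⟨fun i j => T1 i j + T2 i j, fun i => r1 i + r2 i, fun i => ?_, fun i j => ?_,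
    fun i j => add_mem (v1 i j) (v2 i j), fun i => add_mem (v1' i) (v2' i),
    fun i j => ((b1 i j).add (b2 i j)).mono_right S.wf_nonneg (le_of_eq (by ring)),
    fun i => ((b1' i).add (b2' i)).mono_right S.wf_nonneg (le_of_eq (by ring))⟩
  · simp only [map_add, Finset.sum_add_distrib, e1, e2]
    ring
  · simp only [s1 i j, s2 i j]

theorem exists_inverts {ι : Type} (hk : Horizontal k) (J N : ℕ)
    {F : Stage n V M₀ k → Dir → ι → SPF}
    (hF : ∀ i, IsO w (N + J) Y fun S => F S i) (t : Stage n V M₀ k → Finset ι) (ν : ι → ℤ)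
    (ω : Stage n V M₀ k → ι → ℝ) (σ : ℝ)
    (hν : ∀ S m, (∀ i, F S i m = 0) ∨ (ν m ≠ 0 ∧ |ω S m| ≤ S.wf none ∧
      ∀ j, |(ν m * S.lam * k j : ℝ)| ≤ S.wf (some j)))
    (hv : ∀ S i m, F S i m ∈ vanish S.O) :
    ∃ C, 0 ≤ C ∧ ∀ S : Stage n V M₀ k, S.Inverts J N C fun i =>
      ∑ m ∈ t S, F S i m * pw k S.lam (ν m) (ω S m) σ := by
  choose C hC h using hF
  have hC' : ∀ i, C i ≤ ∑ i, C i := fun i => Finset.single_le_sum (fun i _ => hC i) (Finset.mem_univ i)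
  have hC0 : 0 ≤ ∑ i, C i := Finset.sum_nonneg fun i _ => hC i
  refine ⟨2 ^ N * 10 * ∑ i, C i, by positivity, fun S => ?_⟩
  obtain ⟨T, r, h1, h2, h3, h4, h5, h6⟩ := exists_oscillating_inverse hk S.lam_pos S.w_nonneg
    S.w_le_wf (W := S.w none) (fun j => S.w_some_le _) S.θ_le S.isOpen J N (t S)
    (A := (∑ i, C i) * S.Y) (F := F S) σ
    (fun i => (h i S).mono_right S.w_nonneg (mul_le_mul_of_nonneg_right (hC' i) S.Y_nonneg))
    (hν S) (hv S)
  refine ⟨T, r, h1, h2, h3, h4, fun i j => (h5 i j).mono_right S.wf_nonneg (le_of_eq (by ring)),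
    fun i => (h6 i).mono_right S.wf_nonneg ?_⟩
  have : 0 ≤ S.θ ^ J * S.Y := mul_nonneg (pow_nonneg S.θ_nonneg J) S.Y_nonneg
  calc 2 ^ N * (S.θ ^ J * ((∑ i, C i) * S.Y)) = 2 ^ N * 1 * (∑ i, C i) * (S.θ ^ J * S.Y) := by ring
    _ ≤ _ := by gcongr; norm_num

/-- Sums of modulated waves. -/
theorem isO_waves (hk : Horizontal k) {N : ℕ} {F : Stage n V M₀ k → ℤ → SPF} {Y : Stage n V M₀ k → ℝ}
    (hF : IsO w N Y F) (h0 : ∀ S m, (∀ i, S.a i m = 0) → F S m = 0) (σ : ℝ) :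
    IsO wf N Y fun S (_ : Unit) => ∑ m ∈ S.idx, F S m * S.wv σ m := by
  obtain ⟨C, hC, h⟩ := hF
  refine ⟨2 ^ N * C, by positivity, fun S => ?_⟩
  have h1 := ((h S).mono S.w_nonneg S.w_le_wf le_rfl le_rfl).mul S.wf_nonneg zero_le_one
    (g := fun m => S.wv σ m) fun m => (S.freq_wv hk m).imp (h0 S m) fun h =>
      bd1_wave S.wf_nonneg h.2.1 (fun j => by exact_mod_cast h.2.2 j) σ
  refine (h1.total _).mono_right S.wf_nonneg (le_of_eq (by ring))

theorem isO_P (hk : Horizontal k) (i : Dir) :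
    IsO (D := Stage n V M₀ k) wf n (fun S => √S.κ) fun S (_ : Unit) => S.P i :=
  isO_waves hk (isO_a hk i) (fun _ _ h => h i) 0

theorem isO_Q (hk : Horizontal k) (i : Dir) :
    IsO (D := Stage n V M₀ k) wf n (fun S => (S.lam : ℝ)⁻¹ * (√S.κ * S.μ * S.Λ))
      fun S (_ : Unit) => S.Q i :=
  isO_waves hk (isO_c hk i) (fun S _ h => S.c_eq_zero h i) _

end Stage

namespace Stage

variable {n : ℕ} {V M₀ : ℝ} {k : Fin 3 → ℤ}

theorem par_eq_iff {m m' : ℤ} (h : par m = par m') : Even m ↔ Even m' := by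
  unfold par at h
  split_ifs at h with h1 h2 h2
  · exact iff_of_true h1 h2
  · norm_num at h
  · norm_num at h
  · exact iff_of_false h1 h2

theorem abs_offDiag_le (m : ℤ × ℤ) : |offDiag m| ≤ 1 := by
  unfold offDiag
  split_ifs <;> norm_num [abs_of_pos]

theorem isO_W (hk : Horizontal k) (i : Dir) :
    IsO (D := Stage n V M₀ k) wf n (fun S => √S.κ + (S.lam : ℝ)⁻¹ * (√S.κ * S.μ * S.Λ))
      fun S (_ : Unit) => S.W i := by
  refine ((isO_P hk i).mono wf_nonneg le_rfl 1 zero_le_one fun S => ?_).add wf_nonneg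
    ((isO_Q hk i).mono wf_nonneg le_rfl 1 zero_le_one fun S => ?_)
  · have := mul_pos (inv_pos.2 S.lam_pos') (mul_pos (mul_pos S.sqrt_pos S.μ_pos) S.Λ_pos)
    linarith
  · linarith [S.sqrt_pos]

/-- The products involving a corrector. -/
def corrFlux (S : Stage n V M₀ k) (i : Dir) (j : Fin 3) : SPF :=
  S.P i * S.Q (some j) + S.Q i * S.P (some j) + S.Q i * S.Q (some j)

theorem μ_Λ_le (S : Stage n V M₀ k) : (S.lam : ℝ)⁻¹ * (S.μ * S.Λ) ≤ 1 := by
  have hl := S.lam_pos'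
  rw [inv_mul_le_iff₀ hl, mul_one]
  refine le_trans ?_ (S.w_le_lam none)
  have := S.μ_sc_le none
  have h2 := S.w_pos none
  change 2 * (S.μ * S.Λ) ≤ _ at this
  linarith [mul_pos S.μ_pos S.Λ_pos]

theorem isO_corrFlux (hk : Horizontal k) (i : Dir) (j : Fin 3) :
    IsO (D := Stage n V M₀ k) wf n (fun S => S.Y / S.lam) fun S (_ : Unit) => S.corrFlux i j := by
  have hs : ∀ S : Stage n V M₀ k, √S.κ * ((S.lam : ℝ)⁻¹ * (√S.κ * S.μ * S.Λ)) ≤ 1 * (S.Y / S.lam) :=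
    fun S => by
      rw [one_mul, div_eq_inv_mul, mul_left_comm]
      refine mul_le_mul_of_nonneg_left (le_trans ?_ (S.le_E.trans S.E_le_Y)) (inv_pos.2 S.lam_pos').le
      exact mul_le_of_le_one_left (mul_pos (mul_pos S.sqrt_pos S.μ_pos) S.Λ_pos).le S.sqrt_le
  have hq : ∀ S : Stage n V M₀ k, (S.lam : ℝ)⁻¹ * (√S.κ * S.μ * S.Λ) ≤ √S.κ := fun S => by
    have := mul_le_mul_of_nonneg_left S.μ_Λ_le S.sqrt_pos.le
    linarith
  refine ((((isO_P hk i).mul wf_nonneg (isO_Q hk (some j))).mono wf_nonneg le_rfl 1 zero_le_one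
    hs).add wf_nonneg (((isO_Q hk i).mul wf_nonneg (isO_P hk (some j))).mono wf_nonneg le_rfl 1
    zero_le_one fun S => ?_)).add wf_nonneg (((isO_Q hk i).mul wf_nonneg (isO_Q hk (some j))).mono
    wf_nonneg le_rfl 1 zero_le_one fun S => ?_)
  · rw [mul_comm]; exact hs S
  · refine le_trans (mul_le_mul_of_nonneg_right (hq S) ?_) (hs S)
    exact (mul_pos (inv_pos.2 S.lam_pos') (mul_pos (mul_pos S.sqrt_pos S.μ_pos) S.Λ_pos)).le

theorem exists_inverts_div (hk : Horizontal k) (J N : ℕ) :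
    ∃ C, 0 ≤ C ∧ ∀ S : Stage (N + J + 2) V M₀ k, S.Inverts J N C fun i => lin S.u S.W i +
      ∑ j, pd (some j) (S.P i * S.P (some j)) - ∑ j, pd (some j) (S.A i * S.A (some j)) := by
  have hE : ∀ S : Stage (N + J + 2) V M₀ k, S.E ≤ 1 * S.Y := fun S => by
    rw [one_mul]; exact S.E_le_Y
  have hE' : ∀ {ι : Type} {F : Stage (N + J + 2) V M₀ k → Dir → ι → SPF},
      (∀ i, IsO w (N + J) E fun S => F S i) → ∀ i, IsO w (N + J) Y fun S => F S i :=
    fun h i => (h i).mono w_nonneg le_rfl 1 zero_le_one hE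
  obtain ⟨C1, p1, H1⟩ := exists_inverts hk J N (F := lead (k := k))
    (hE' (isO_lead hk)) idx par ω 0
    (fun S m => (S.freq_wv hk m).imp (S.lead_eq_zero) id) lead_mem
  obtain ⟨C2, p2, H2⟩ := exists_inverts hk J N (F := sub (k := k)) (isO_sub hk)
    idx par ω (-(Real.pi / 2)) (fun S m => (S.freq_wv hk m).imp (S.sub_eq_zero) id) sub_mem
  obtain ⟨C3, p3, H3⟩ := exists_inverts hk J N (F := fun S => quad (k := k) S fun _ => 1 / 2)
    (hE' (isO_quad hk fun _ => by norm_num [abs_of_pos]))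
    (fun S => S.idx ×ˢ S.idx) (fun m => par m.1 + par m.2) (fun S m => S.ω m.1 + S.ω m.2) 0
    (fun S m => by
      have := S.freq_pair hk (τ := 1) (by norm_num) m fun h => by
        have h1 := one_le_par m.1
        have h2 := one_le_par m.2
        have h3 : (par m.1 : ℝ) + par m.2 = 0 := by
          rw [one_mul] at h
          exact_mod_cast h
        linarith
      simp only [one_mul, Int.cast_one] at this
      exact this.imp (S.quad_eq_zero) id) (fun S => S.quad_mem _)
  obtain ⟨C4, p4, H4⟩ := exists_inverts hk J N (F := fun S => quad (k := k) S offDiag)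
    (hE' (isO_quad hk abs_offDiag_le))
    (fun S => S.idx ×ˢ S.idx) (fun m => par m.1 - par m.2) (fun S m => S.ω m.1 - S.ω m.2) 0
    (fun S m => by
      by_cases hm : m.1 = m.2
      · exact Or.inl fun i => by simp [quad, offDiag, hm]
      have := S.freq_pair hk (τ := -1) (by norm_num) m fun h i j =>
        S.a_mul_a hm (par_eq_iff (by linarith)) i j
      simp only [neg_one_mul, Int.cast_neg, Int.cast_one, ← sub_eq_add_neg] at this
      exact this.imp (S.quad_eq_zero) id) (fun S => S.quad_mem _)
  refine ⟨C1 + C2 + C3 + C4, by positivity, fun S => ?_⟩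
  have h := (((H1 S).add (H2 S)).add (H3 S)).add (H4 S)
  convert h using 2 with i
  rw [S.lin_W hk, S.div_P_mul_P hk]
  simp only [wv]
  ring

/-- The new error is the divergence of a small tensor. -/
theorem exists_flux (hk : Horizontal k) (J N : ℕ) :
    ∃ C, 0 ≤ C ∧ ∀ S : Stage (N + 1 + J + 2) V M₀ k, ∃ T : Dir → Fin 3 → SPF,
      (∀ i, lin S.u S.W i + ∑ j, pd (some j) (S.W i * S.W (some j)) =
        ∑ j, pd (some j) (S.A i * S.A (some j)) + ∑ j, pd (some j) (T i j)) ∧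
      (∀ i j, T (some i) j = T (some j) i) ∧ (∀ i j, T i j ∈ vanish S.O) ∧
      ∀ i j, Bd1 S.wf N (C * (S.Y / S.lam * (1 + S.lam ^ 2 * S.θ ^ J))) (T i j) := by
  obtain ⟨C, hC, H⟩ := exists_inverts_div (V := V) (M₀ := M₀) hk J (N + 1)
  choose C5 p5 H5 using fun i j => isO_corrFlux (n := N + 1 + J + 2) (V := V) (M₀ := M₀) hk i j
  have hC5 : ∃ C', 0 ≤ C' ∧ ∀ i j, C5 i j ≤ C' := ⟨∑ i, ∑ j, C5 i j,
    Finset.sum_nonneg fun i _ => Finset.sum_nonneg fun j _ => p5 i j, fun i j =>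
    (Finset.single_le_sum (fun j _ => p5 i j) (Finset.mem_univ j)).trans
      (Finset.single_le_sum (f := fun i => ∑ j, C5 i j)
        (fun i _ => Finset.sum_nonneg fun j _ => p5 i j) (Finset.mem_univ i))⟩
  obtain ⟨C', hC', hC5⟩ := hC5
  refine ⟨C + C' + 180 * (8 * (|V| + 1)) * C, by positivity, fun S => ?_⟩
  obtain ⟨T, r, e1, s1, v1, v1', b1, b1'⟩ := H S
  have hV0 := S.V_nonneg
  have hl := S.lam_pos'
  have hl1 : (1 : ℝ) ≤ S.lam := by exact_mod_cast S.lam_pos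
  have hYl : 0 ≤ S.Y / S.lam := div_nonneg S.Y_nonneg hl.le
  have hW : ∀ i, lin S.u S.W i + ∑ j, pd (some j) (S.W i * S.W (some j)) =
      ∑ j, pd (some j) (S.A i * S.A (some j)) + ∑ j, pd (some j)
        (T i j + S.corrFlux i j) + r i := by
    intro i
    have e : ∀ j, pd (some j) (S.W i * S.W (some j)) =
        pd (some j) (S.P i * S.P (some j)) + pd (some j) (S.corrFlux i j) := fun j => by
      rw [← map_add, W, W, corrFlux]
      congr 1
      ring
    simp only [e, map_add, Finset.sum_add_distrib]
    linear_combination e1 i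
  have hm : ∀ i, mean3 (r i) = 0 := fun i => by
    have h1 := mean3_lin S.u S.W (S.div_W hk) (S.mean3_W hk) i
    have h2 := congrArg mean3 (hW i)
    rw [map_add, map_add, map_add, h1] at h2
    simp only [map_sum, mean3_pd, Finset.sum_const_zero, zero_add] at h2
    exact h2.symm
  obtain ⟨T', e5, s5, v5, b5⟩ := exists_antidivergence (N := N) S.wf_nonneg (W := 8 * (V + 1) * S.lam)
    (fun j => S.wf_le _) (by nlinarith) S.isOpen b1' v1' hm
  refine ⟨fun i j => T i j + S.corrFlux i j + T' i j, fun i => ?_,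
    fun i j => ?_, fun i j => ?_, fun i j => ?_⟩
  · rw [hW i, ← e5 i, add_assoc, ← Finset.sum_add_distrib]
    simp only [map_add]
  · simp only [s1 i j, s5 i j, corrFlux]
    ring
  · have hP : ∀ i, S.P i ∈ vanish S.O := fun i =>
      sum_mem fun _ _ => Ideal.mul_mem_right _ _ (S.a_mem _ _)
    have hQ : ∀ i, S.Q i ∈ vanish S.O := fun i =>
      sum_mem fun _ _ => Ideal.mul_mem_right _ _ (S.c_mem _ _)
    refine add_mem (add_mem (v1 i j) ?_) (v5 i j)
    exact add_mem (add_mem (Ideal.mul_mem_right _ _ (hP _)) (Ideal.mul_mem_right _ _ (hQ _)))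
      (Ideal.mul_mem_right _ _ (hQ _))
  · have hc := (H5 i j S).mono_right S.wf_nonneg (mul_le_mul_of_nonneg_right (hC5 i j) hYl)
    refine ((((b1 i j).of_le S.wf_nonneg (Nat.le_succ N)).add
      (hc.of_le S.wf_nonneg (by omega))).add (b5 i j)).mono_right S.wf_nonneg ?_
    have hθ : 0 ≤ S.lam ^ 2 * S.θ ^ J := mul_nonneg (sq_nonneg _) (pow_nonneg S.θ_nonneg J)
    have e : 180 * (8 * (V + 1) * S.lam) * (C * (S.θ ^ J * S.Y)) =
        180 * (8 * (V + 1)) * C * (S.Y / S.lam * (S.lam ^ 2 * S.θ ^ J)) := by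
      field_simp
    rw [e, abs_of_nonneg hV0]
    have q1 : 0 ≤ (C + C') * (S.Y / S.lam * (S.lam ^ 2 * S.θ ^ J)) := by positivity
    have q2 : 0 ≤ 180 * (8 * (V + 1)) * C * (S.Y / S.lam) := by positivity
    linarith

end Stage

namespace Stage

variable {n : ℕ} {V M₀ : ℝ} {k : Fin 3 → ℤ}

theorem abs_P_le (S : Stage n V M₀ k) (hk : Horizontal k) (i : Dir) (q : SpaceTime) :
    |S.P i q| ≤ 3 * M₀ * √S.κ := by
  simp only [P, sum_apply, mul_apply, a, loc, cut_apply, bump]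
  rw [sum_profile_eq (s := S.s q) (S.floor_mem_idx hk q).1 (S.floor_mem_idx hk q).2 _
    (fun m hm => by rw [hm]; ring)]
  have h2 : √2 * √2 = (2 : ℝ) := Real.mul_self_sqrt zero_le_two
  have h3 : √2 ≤ (3 / 2 : ℝ) := by nlinarith [Real.sqrt_nonneg 2]
  have hA : 0 ≤ M₀ * √S.κ := mul_nonneg S.M_nonneg S.sqrt_pos.le
  have key : ∀ m : ℤ, |√2 * profile (S.s q - m) * S.A i q * S.wv 0 m q| ≤
      3 / 2 * (M₀ * √S.κ) := fun m => by
    rw [abs_mul, abs_mul, abs_mul, abs_of_nonneg (Real.sqrt_nonneg 2)]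
    calc √2 * |profile (S.s q - m)| * |S.A i q| * |S.wv 0 m q|
        ≤ 3 / 2 * 1 * (M₀ * √S.κ) * 1 := by
          gcongr
          · exact profile_abs_le _
          · exact S.A_le i q
          · exact wave_abs_le _ _ _ _
      _ = _ := by ring
  refine (abs_add_le _ _).trans ((add_le_add (key _) (key _)).trans (le_of_eq (by ring)))

/-- The perturbation has the size of the amplitude, up to a small corrector. -/
theorem exists_abs_W_le (hk : Horizontal k) (V M₀ : ℝ) : ∃ C, 0 ≤ C ∧ ∀ (S : Stage n V M₀ k) i q,
    |S.W i q| ≤ (3 * M₀ + C * ((S.lam : ℝ)⁻¹ * (S.μ * S.Λ))) * √S.κ := by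
  choose C hC h using fun i => isO_Q (n := n) (V := V) (M₀ := M₀) hk i
  refine ⟨∑ i, C i, Finset.sum_nonneg fun i _ => hC i, fun S i q => ?_⟩
  have h1 := S.abs_P_le hk i q
  have h2 := (h i S).abs_le () q
  have h3 : C i ≤ ∑ i, C i := Finset.single_le_sum (fun i _ => hC i) (Finset.mem_univ i)
  have h4 : 0 ≤ (S.lam : ℝ)⁻¹ * (S.μ * S.Λ) * √S.κ :=
    mul_nonneg (mul_nonneg (inv_pos.2 S.lam_pos').le (mul_pos S.μ_pos S.Λ_pos).le) S.sqrt_pos.le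
  calc |S.W i q| ≤ |S.P i q| + |S.Q i q| := abs_add_le _ _
    _ ≤ 3 * M₀ * √S.κ + C i * ((S.lam : ℝ)⁻¹ * (√S.κ * S.μ * S.Λ)) := add_le_add h1 h2
    _ = 3 * M₀ * √S.κ + C i * ((S.lam : ℝ)⁻¹ * (S.μ * S.Λ) * √S.κ) := by ring
    _ ≤ 3 * M₀ * √S.κ + (∑ i, C i) * ((S.lam : ℝ)⁻¹ * (S.μ * S.Λ) * √S.κ) := by gcongr
    _ = _ := by ring

theorem pd_z_wv (S : Stage n V M₀ k) (hk : Horizontal k) (σ : ℝ) (m : ℤ) :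
    pd (some 2) (S.wv σ m) = 0 := by
  simp [wv, pd_pw_some, hk.two]

theorem isO_pd_z_W (hk : Horizontal k) (i : Dir) :
    IsO (D := Stage (n + 1) V M₀ k) wf n (fun S => √S.κ * S.μ * S.Z)
      fun S (_ : Unit) => pd (some 2) (S.W i) := by
  have e : ∀ S : Stage (n + 1) V M₀ k, pd (some 2) (S.W i) =
      ∑ m ∈ S.idx, pd (some 2) (S.a i m) * S.wv 0 m +
        ∑ m ∈ S.idx, pd (some 2) (S.c i m) * S.wv (-(Real.pi / 2)) m := fun S => by
    simp only [W, P, Q, map_add, map_sum, pd_mul, S.pd_z_wv hk, mul_zero, add_zero]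
  simp only [e]
  refine IsO.add wf_nonneg (isO_waves hk (((isO_pd_a hk (some 2) i).of_le w_nonneg
    (Nat.le_succ n)).mono w_nonneg le_rfl 1 zero_le_one fun S => ?_)
    (fun S m h => by rw [h i, map_zero]) 0) (isO_waves hk ((IsO.pd (isO_c hk i) (some 2)).mono
    w_nonneg le_rfl 1 zero_le_one fun S => ?_) (fun S m h => by rw [S.c_eq_zero h, map_zero]) _)
  · rw [one_mul]; exact le_rfl
  · rw [one_mul]
    have hl := S.lam_pos'
    have h1 : S.w (some 2) * ((S.lam : ℝ)⁻¹ * S.Λ) ≤ S.Z := by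
      have h2 := S.lam_ge
      have hδ := S.δ_pos
      have hZ := S.Z_pos
      have hK := S.K_pos
      have hΛ := S.Λ_pos
      rw [div_le_iff₀ hδ] at h2
      change 3 * S.K * S.Z / S.δ * ((S.lam : ℝ)⁻¹ * S.Λ) ≤ S.Z
      rw [inv_mul_eq_div, div_mul_div_comm, div_le_iff₀ (by positivity)]
      nlinarith [mul_pos hK hΛ]
    calc S.w (some 2) * ((S.lam : ℝ)⁻¹ * (√S.κ * S.μ * S.Λ))
        = √S.κ * S.μ * (S.w (some 2) * ((S.lam : ℝ)⁻¹ * S.Λ)) := by ring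
      _ ≤ _ := mul_le_mul_of_nonneg_left h1 (mul_pos S.sqrt_pos S.μ_pos).le

/-- Size of the first derivatives of the perturbation. -/
def W' (S : Stage n V M₀ k) (d : Dir) : ℝ := scale (√S.κ * S.lam) (√S.κ * S.μ * S.Z) d

theorem W'_nonneg (S : Stage n V M₀ k) (d : Dir) : 0 ≤ S.W' d :=
  scale_nonneg (mul_pos S.sqrt_pos S.lam_pos').le
    (mul_pos (mul_pos S.sqrt_pos S.μ_pos) S.Z_pos).le d

theorem isO_pd_W (hk : Horizontal k) (d i : Dir) :
    IsO (D := Stage (n + 1) V M₀ k) wf n (fun S => S.W' d) fun S (_ : Unit) => pd d (S.W i) := by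
  by_cases hd : d = some 2
  · subst hd
    exact isO_pd_z_W hk i
  · refine (IsO.pd (isO_W hk i) d).mono wf_nonneg le_rfl (8 * (|V| + 1) * 2) (by positivity)
      fun S => ?_
    have h1 : S.wf d = 8 * (V + 1) * S.lam := if_neg hd
    have h2 : S.W' d = √S.κ * S.lam := if_neg hd
    have h3 := mul_le_mul_of_nonneg_right S.μ_Λ_le S.sqrt_pos.le
    have hV := S.V_nonneg
    have hl := S.lam_pos'
    rw [h1, h2, abs_of_nonneg hV]
    calc 8 * (V + 1) * S.lam * (√S.κ + (S.lam : ℝ)⁻¹ * (√S.κ * S.μ * S.Λ))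
        = 8 * (V + 1) * S.lam * (√S.κ + (S.lam : ℝ)⁻¹ * (S.μ * S.Λ) * √S.κ) := by ring
      _ ≤ 8 * (V + 1) * S.lam * (√S.κ + 1 * √S.κ) := by gcongr
      _ = _ := by ring

theorem exists_pd_W (hk : Horizontal k) (V M₀ : ℝ) : ∃ C, 0 ≤ C ∧
    ∀ (S : Stage (n + 1) V M₀ k) d i, Bd1 S.wf n (C * S.W' d) (pd d (S.W i)) := by
  choose C hC h using fun d i => isO_pd_W (n := n) (V := V) (M₀ := M₀) hk d i
  refine ⟨∑ d, ∑ i, C d i, Finset.sum_nonneg fun d _ => Finset.sum_nonneg fun i _ => hC d i,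
    fun S d i => (h d i S).mono_right S.wf_nonneg (mul_le_mul_of_nonneg_right ?_ (S.W'_nonneg d))⟩
  exact (Finset.single_le_sum (fun i _ => hC d i) (Finset.mem_univ i)).trans
    (Finset.single_le_sum (f := fun d => ∑ i, C d i)
      (fun d _ => Finset.sum_nonneg fun i _ => hC d i) (Finset.mem_univ d))

theorem W_eq_zero (S : Stage n V M₀ k) {i : Dir} (hi : coeff k i = 0) (h : S.A i = 0) :
    S.W i = 0 := by
  have ha : ∀ m, S.a i m = 0 := fun m => by rw [a, loc, h, mul_zero]
  have hc : ∀ m, S.c i m = 0 := fun m => by simp [c, corr, ha, hi]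
  simp [W, P, Q, ha, hc]

end Stage

/-- The Boussinesq operator (velocity and temperature components), without the pressure. -/
def NL (U : Dir → SPF) (i : Dir) : SPF :=
  pd none (U i) + ∑ j, pd (some j) (U i * U (some j)) - pd (some 2) (pd (some 2) (U i))
    - if i = some 2 then U none else 0

theorem NL_add (u e W : Dir → SPF) (hW : ∑ j, pd (some j) (W (some j)) = 0) (i : Dir) :
    NL (fun i => u i + e i + W i) i = NL (fun i => u i + e i) i + lin u W i +
      ∑ j, pd (some j) (W i * W (some j)) +
      ∑ j, pd (some j) (W i * e (some j) + e i * W (some j)) := by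
  have h : W i * ∑ j, pd (some j) (u (some j)) + ∑ j, u (some j) * pd (some j) (W i) +
      ∑ j, W (some j) * pd (some j) (u i) =
      ∑ j, pd (some j) (u i * W (some j) + W i * u (some j)) := by
    have h1 : u i * ∑ j, pd (some j) (W (some j)) = 0 := by rw [hW, mul_zero]
    rw [Finset.mul_sum] at h1 ⊢
    rw [← sub_eq_zero, ← neg_eq_zero, ← h1, ← Finset.sum_add_distrib, ← Finset.sum_add_distrib,
      ← Finset.sum_sub_distrib, ← Finset.sum_neg_distrib]
    refine Finset.sum_congr rfl fun j _ => ?_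
    rw [map_add, pd_mul, pd_mul]
    ring
  have h2 : ∑ j, pd (some j) ((u i + e i + W i) * (u (some j) + e (some j) + W (some j))) =
      ∑ j, pd (some j) ((u i + e i) * (u (some j) + e (some j))) +
      ∑ j, pd (some j) (u i * W (some j) + W i * u (some j)) +
      ∑ j, pd (some j) (W i * W (some j)) +
      ∑ j, pd (some j) (W i * e (some j) + e i * W (some j)) := by
    simp only [← Finset.sum_add_distrib, ← map_add]
    refine Finset.sum_congr rfl fun j _ => ?_
    congr 1
    ring
  simp only [NL, lin]
  rw [h2, ← h]
  simp only [map_add]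
  split_ifs <;> ring

namespace Stage

variable {n : ℕ} {V M₀ : ℝ} {k : Fin 3 → ℤ}

/-- Lower bound for admissible frequencies. -/
def X (S : Stage n V M₀ k) : ℝ := S.κ * S.Λ / S.δ ^ 2 + S.κ * S.Z ^ 2 / S.δ ^ 3

/-- Size of first derivatives after the step. -/
def sc' (S : Stage n V M₀ k) (Γ : ℝ) (d : Dir) : ℝ :=
  scale (Γ * (√S.κ * S.lam)) (Γ * (S.κ / S.δ * S.Z)) d

theorem le_X' (S : Stage n V M₀ k) : S.κ * S.Λ / S.δ ^ 2 ≤ S.X :=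
  le_add_of_nonneg_right (div_nonneg (mul_nonneg S.κ_pos.le (sq_nonneg _))
    (pow_nonneg S.δ_pos.le 3))

theorem le_X (S : Stage n V M₀ k) : S.Λ / S.δ ≤ S.X := by
  refine le_trans ?_ S.le_X'
  have := S.δ_pos
  rw [div_le_div_iff₀ this (by positivity)]
  nlinarith [mul_le_mul_of_nonneg_right S.δ_le_κ (mul_pos S.Λ_pos this).le]

theorem one_le_X (S : Stage n V M₀ k) : 1 ≤ S.X := by
  refine le_trans ?_ S.le_X
  rw [le_div_iff₀ S.δ_pos]
  linarith [S.δ_le_one, S.Λ_ge]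

theorem E_le (S : Stage n V M₀ k) : S.E ≤ 3 * S.K ^ 2 * (S.δ * S.X) := by
  have hδ := S.δ_pos
  have e : S.E = S.K * S.κ / S.δ * S.Λ + 3 * S.K ^ 2 * S.κ * S.Z ^ 2 / S.δ ^ 2 := by
    change √S.κ * (S.K * √S.κ / S.δ) * (S.Λ + S.Z * (3 * S.K * S.Z / S.δ)) = _
    have h1 : √S.κ * (S.K * √S.κ / S.δ) = S.K * S.κ / S.δ := by
      linear_combination (S.K / S.δ) * S.sq_sqrt
    rw [h1]
    field_simp
  have e2 : 3 * S.K ^ 2 * (S.δ * S.X) =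
      3 * S.K ^ 2 * (S.κ / S.δ * S.Λ) + 3 * S.K ^ 2 * S.κ * S.Z ^ 2 / S.δ ^ 2 := by
    rw [X]; field_simp
  rw [e, e2]
  have h2 : 0 ≤ S.κ / S.δ * S.Λ := mul_nonneg (div_pos S.κ_pos hδ).le S.Λ_pos.le
  have h3 : S.K ≤ 3 * S.K ^ 2 := by nlinarith [S.K_ge]
  have := mul_le_mul_of_nonneg_right h3 h2
  have e3 : S.K * S.κ / S.δ * S.Λ = S.K * (S.κ / S.δ * S.Λ) := by ring
  linarith

theorem lam_inv_X_le (S : Stage n V M₀ k) {Γ : ℝ} (hΓ : 1 ≤ Γ) (hX : Γ * S.X ≤ S.lam) :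
    S.X / S.lam ≤ Γ⁻¹ := by
  rw [div_le_iff₀ S.lam_pos', inv_mul_eq_div, le_div_iff₀ (by linarith)]
  linarith

theorem μ_Λ_le' (S : Stage n V M₀ k) {Γ : ℝ} (hΓ : 1 ≤ Γ) (hX : Γ * S.X ≤ S.lam) :
    (S.lam : ℝ)⁻¹ * (S.μ * S.Λ) ≤ S.K * Γ⁻¹ := by
  have h1 : S.μ * S.Λ ≤ S.K * S.X := by
    have h2 : S.μ * S.Λ = S.K * √S.κ * (S.Λ / S.δ) := by rw [μ]; ring
    rw [h2]
    exact mul_le_mul (mul_le_of_le_one_right S.K_pos.le S.sqrt_le) S.le_X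
      (div_pos S.Λ_pos S.δ_pos).le S.K_pos.le
  calc (S.lam : ℝ)⁻¹ * (S.μ * S.Λ) ≤ (S.lam : ℝ)⁻¹ * (S.K * S.X) :=
        mul_le_mul_of_nonneg_left h1 (inv_pos.2 S.lam_pos').le
    _ = S.K * (S.X / S.lam) := by ring
    _ ≤ _ := mul_le_mul_of_nonneg_left (S.lam_inv_X_le hΓ hX) S.K_pos.le

theorem Y_div_le (S : Stage n V M₀ k) {Γ : ℝ} (hΓ : 1 ≤ Γ) (hX : Γ * S.X ≤ S.lam) :
    S.Y / S.lam ≤ S.δ * (3 * S.K ^ 2 * Γ⁻¹ + S.K⁻¹) := by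
  have hl := S.lam_pos'
  have e : S.Y / S.lam = S.E / S.lam + S.δ * S.K⁻¹ := by
    rw [Y, add_div]
    congr 1
    have := S.K_pos.ne'
    field_simp
  have h : S.E / S.lam ≤ 3 * S.K ^ 2 * (S.δ * Γ⁻¹) := by
    calc S.E / S.lam ≤ 3 * S.K ^ 2 * (S.δ * S.X) / S.lam := by gcongr; exact S.E_le
      _ = 3 * S.K ^ 2 * (S.δ * (S.X / S.lam)) := by ring
      _ ≤ _ := by
        have := S.δ_pos
        gcongr
        exact S.lam_inv_X_le hΓ hX
  rw [e]
  linarith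

theorem θ_pow_le (S : Stage n V M₀ k) {Γ : ℝ} (hΓ : 1 ≤ Γ) {J : ℕ}
    (hJ : Γ * S.X ^ J * S.lam ^ 2 ≤ S.lam ^ J) :
    (S.lam : ℝ) ^ 2 * S.θ ^ J ≤ (45 * S.K) ^ J * Γ⁻¹ := by
  have hl := S.lam_pos'
  have h1 : S.θ ≤ 45 * S.K * (S.X / S.lam) := by
    have e : S.θ = 45 * S.K * (S.Λ / S.δ / S.lam) := by
      change 15 * (3 * S.K * S.Λ / S.δ) / S.lam = _
      ring
    rw [e]
    have := S.K_pos
    gcongr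
    exact S.le_X
  have h2 : S.X ^ J * S.lam ^ 2 / S.lam ^ J ≤ Γ⁻¹ := by
    rw [div_le_iff₀ (by positivity), inv_mul_eq_div, le_div_iff₀ (by linarith)]
    linarith
  calc (S.lam : ℝ) ^ 2 * S.θ ^ J ≤ (S.lam : ℝ) ^ 2 * (45 * S.K * (S.X / S.lam)) ^ J := by
        have := S.θ_nonneg
        gcongr
    _ = (45 * S.K) ^ J * (S.X ^ J * S.lam ^ 2 / S.lam ^ J) := by
        rw [mul_pow, div_pow]; ring
    _ ≤ _ := by
        have := S.K_pos
        gcongr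

theorem sc'_nonneg (S : Stage n V M₀ k) {Γ : ℝ} (hΓ : 1 ≤ Γ) (d : Dir) : 0 ≤ S.sc' Γ d := by
  have h1 := mul_pos S.sqrt_pos S.lam_pos'
  have h2 := mul_pos (div_pos S.κ_pos S.δ_pos) S.Z_pos
  exact scale_nonneg (by positivity) (by positivity) d

theorem sc_le_sc' (S : Stage n V M₀ k) {Γ : ℝ} (hΓ : 1 ≤ Γ) (hX : Γ * S.X ≤ S.lam) (d : Dir) :
    S.sc d ≤ S.sc' Γ d * Γ⁻¹ := by
  have hδ := S.δ_pos
  have hΓ0 : 0 < Γ := by linarith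
  rw [← div_eq_mul_inv, le_div_iff₀ hΓ0, mul_comm, sc, sc', scale, scale]
  split_ifs
  · refine mul_le_mul_of_nonneg_left ?_ hΓ0.le
    refine le_mul_of_one_le_left S.Z_pos.le ?_
    rw [one_le_div hδ]
    exact S.δ_le_κ
  · refine mul_le_mul_of_nonneg_left ?_ hΓ0.le
    have h1 : S.Λ ≤ √S.κ * (S.κ * S.Λ / S.δ ^ 2) := by
      rw [mul_div_assoc', le_div_iff₀ (by positivity)]
      have h3 : S.δ ^ 2 ≤ S.κ * √S.κ := by nlinarith [S.δ_le, S.δ_le_one]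
      nlinarith [S.Λ_pos]
    have h2 : S.X ≤ S.lam := le_trans (le_mul_of_one_le_left (by linarith [S.one_le_X]) hΓ) hX
    exact h1.trans (mul_le_mul_of_nonneg_left (S.le_X'.trans h2) S.sqrt_pos.le)

theorem δ_le_sqrt (S : Stage n V M₀ k) : S.δ ≤ √S.κ := S.δ_le_κ.trans S.κ_le_sqrt

theorem wf_le_sc' (S : Stage n V M₀ k) {Γ : ℝ} (h1 : 8 * (V + 1) ≤ Γ) (h2 : 3 * S.K ≤ Γ) (d : Dir) :
    S.wf d ≤ S.sc' Γ d / S.δ := by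
  have hδ := S.δ_pos
  have hl := S.lam_pos'
  have hV := S.V_nonneg
  have hK := S.K_pos
  have hZ := S.Z_pos
  rw [wf, sc', scale]
  split_ifs
  · change 3 * S.K * S.Z / S.δ ≤ _
    refine div_le_div_of_nonneg_right ?_ hδ.le
    refine mul_le_mul h2 (le_mul_of_one_le_left S.Z_pos.le ?_) hZ.le (by linarith)
    rw [one_le_div hδ]
    exact S.δ_le_κ
  · rw [le_div_iff₀ hδ]
    calc 8 * (V + 1) * S.lam * S.δ ≤ Γ * S.lam * √S.κ := by
          exact mul_le_mul (mul_le_mul_of_nonneg_right h1 hl.le) S.δ_le_sqrt hδ.le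
            (mul_nonneg (by linarith) hl.le)
      _ = _ := by ring

theorem W'_le_sc' (S : Stage n V M₀ k) {Γ : ℝ} (hΓ : 1 ≤ Γ) (d : Dir) :
    S.W' d ≤ S.K * (S.sc' Γ d * Γ⁻¹) := by
  have hΓ0 : Γ ≠ 0 := by linarith
  rw [W', sc', scale, scale]
  split_ifs
  · refine le_of_eq ?_
    rw [μ]
    have h := mul_inv_cancel₀ hΓ0
    linear_combination (S.K * S.Z / S.δ) * S.sq_sqrt - (S.K * S.κ * S.Z / S.δ) * h
  · have e : Γ * (√S.κ * S.lam) * Γ⁻¹ = √S.κ * S.lam := by field_simp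
    rw [e]
    exact le_mul_of_one_le_left (mul_pos S.sqrt_pos S.lam_pos').le S.K_ge

/-- A perturbation `W` of a field `u + e`, `u` being the background of the stage `S`, that realises
the stress of the amplitude of `S` up to an error `T`. -/
structure Perturbs (S : Stage n V M₀ k) (c Γ : ℝ) (N : ℕ) (e W : Dir → SPF)
    (T : Dir → Fin 3 → SPF) : Prop where
  div : ∑ j, pd (some j) (W (some j)) = 0
  mem : ∀ i, W i ∈ vanish S.O
  mem' : ∀ i j, T i j ∈ vanish S.O
  symm : ∀ i j, T (some i) j = T (some j) i
  abs_le : ∀ i q, |W i q| ≤ (3 * M₀ + 1) * √S.κ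
  pd_le : ∀ d i, Bd1 (fun d => S.sc' Γ d / S.δ) N (S.sc' Γ d) (pd d (S.u i + W i))
  abs_le' : ∀ i j q, |T i j q| ≤ c * S.δ
  pd_le' : ∀ d i j q, |pd d (T i j) q| ≤ S.sc' Γ d
  eq : ∀ i, NL (fun i => S.u i + e i + W i) i = NL (fun i => S.u i + e i) i +
    ∑ j, pd (some j) (S.A i * S.A (some j) + T i j)
  eq_zero : S.A none = 0 → W none = 0

theorem abs_mul_add_le {f g f' g' : SPF} {q : SpaceTime} {a b a' b' : ℝ} (h1 : |f q| ≤ a)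
    (h2 : |g q| ≤ b) (h3 : |f' q| ≤ a') (h4 : |g' q| ≤ b') :
    |(f * g + f' * g') q| ≤ a * b + a' * b' := by
  rw [add_apply, mul_apply, mul_apply]
  refine (abs_add_le _ _).trans (add_le_add ?_ ?_)
  · rw [abs_mul]
    exact mul_le_mul h1 h2 (abs_nonneg _) ((abs_nonneg _).trans h1)
  · rw [abs_mul]
    exact mul_le_mul h3 h4 (abs_nonneg _) ((abs_nonneg _).trans h3)

/-- The interaction of the perturbation with a small non-smooth part of the field is small. -/
theorem abs_cross_le (S : Stage n V M₀ k) {c Γ C : ℝ} (hc : 0 < c) (hc1 : c ≤ 1) (hΓ : 1 ≤ Γ)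
    (hΓ' : 4 * (C * S.K + 3 * M₀ + 1) ≤ Γ) (hX : Γ * S.X ≤ S.lam) {e W : Dir → SPF} (hC : 0 ≤ C)
    (he : ∀ i q, |e i q| ≤ c / (4 * (3 * M₀ + 1)) * S.δ) (he' : ∀ d i q, |pd d (e i) q| ≤ S.sc d)
    (hW : ∀ i q, |W i q| ≤ (3 * M₀ + 1) * √S.κ) (hW' : ∀ d i q, |pd d (W i) q| ≤ C * S.W' d)
    (i : Dir) (j : Fin 3) :
    (∀ q, |(W i * e (some j) + e i * W (some j)) q| ≤ c / 2 * S.δ) ∧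
      ∀ d q, |pd d (W i * e (some j) + e i * W (some j)) q| ≤ 1 / 2 * S.sc' Γ d := by
  have hM := S.M_nonneg
  have hδ := S.δ_pos
  have hs := S.sqrt_pos
  have hε : c / (4 * (3 * M₀ + 1)) * S.δ ≤ 1 := by
    refine mul_le_one₀ ?_ hδ.le S.δ_le_one
    rw [div_le_one (by positivity)]
    linarith
  have hε0 : 0 ≤ c / (4 * (3 * M₀ + 1)) * S.δ := by positivity
  refine ⟨fun q => ?_, fun d q => ?_⟩
  · refine (abs_mul_add_le (hW i q) (he (some j) q) (he i q) (hW (some j) q)).trans ?_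
    have e1 : (3 * M₀ + 1) * √S.κ * (c / (4 * (3 * M₀ + 1)) * S.δ) +
        c / (4 * (3 * M₀ + 1)) * S.δ * ((3 * M₀ + 1) * √S.κ) = c / 2 * S.δ * √S.κ := by
      field_simp
      ring
    rw [e1]
    exact mul_le_of_le_one_right (by positivity) S.sqrt_le
  · have e2 : pd d (W i * e (some j) + e i * W (some j)) =
        (pd d (W i) * e (some j) + W i * pd d (e (some j))) +
          (e i * pd d (W (some j)) + pd d (e i) * W (some j)) := by
      rw [map_add, pd_mul, pd_mul]
      ring
    have h0 := S.W'_nonneg d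
    have hsc := S.sc_pos d
    have hp : ∀ i q, |W i q| ≤ 3 * M₀ + 1 := fun i q =>
      (hW i q).trans (mul_le_of_le_one_right (by positivity) S.sqrt_le)
    rw [e2, add_apply]
    refine (abs_add_le _ _).trans ((add_le_add
      (abs_mul_add_le (hW' d i q) ((he (some j) q).trans hε) (hp i q) (he' d (some j) q))
      (abs_mul_add_le ((he i q).trans hε) (hW' d (some j) q) (he' d i q) (hp (some j) q))).trans ?_)
    have h1 := mul_le_mul_of_nonneg_left (S.W'_le_sc' hΓ d) hC
    have h2 := mul_le_mul_of_nonneg_left (S.sc_le_sc' hΓ hX d) (by positivity : 0 ≤ 3 * M₀ + 1)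
    have h3 := S.sc'_nonneg hΓ d
    have h4 : 4 * (C * S.K + 3 * M₀ + 1) * (S.sc' Γ d * Γ⁻¹) ≤ S.sc' Γ d := by
      rw [← mul_assoc, ← div_eq_mul_inv, div_le_iff₀ (by linarith), mul_comm]
      exact mul_le_mul_of_nonneg_left hΓ' h3
    linarith

theorem bd_flux_le (S : Stage n V M₀ k) {c Γ C : ℝ} {J : ℕ} (hc : 0 < c) (hΓ : 1 ≤ Γ) (hC : 0 ≤ C)
    (hK : 16 * C / c ≤ S.K) (h1 : (45 * S.K) ^ J ≤ Γ) (h2 : 3 * S.K ^ 3 ≤ Γ)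
    (hX : Γ * S.X ≤ S.lam) (hJ : Γ * S.X ^ J * S.lam ^ 2 ≤ S.lam ^ J) :
    C * (S.Y / S.lam * (1 + S.lam ^ 2 * S.θ ^ J)) ≤ c / 2 * S.δ := by
  have hΓ0 : 0 < Γ := by linarith
  have hK0 := S.K_pos
  have hδ := S.δ_pos
  have a1 : (S.lam : ℝ) ^ 2 * S.θ ^ J ≤ 1 := (S.θ_pow_le hΓ hJ).trans (by
    rw [← div_eq_mul_inv, div_le_one hΓ0]
    exact h1)
  have a2 : 3 * S.K ^ 2 * Γ⁻¹ ≤ S.K⁻¹ := by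
    rw [← div_eq_mul_inv, div_le_iff₀ hΓ0, inv_mul_eq_div, le_div_iff₀ hK0]
    linarith
  have a3 : S.Y / S.lam ≤ S.δ * (2 * S.K⁻¹) := (S.Y_div_le hΓ hX).trans
    (mul_le_mul_of_nonneg_left (by linarith) hδ.le)
  have hY : 0 ≤ S.Y / S.lam := div_nonneg S.Y_nonneg S.lam_pos'.le
  have hθ : 0 ≤ (S.lam : ℝ) ^ 2 * S.θ ^ J := mul_nonneg (sq_nonneg _) (pow_nonneg S.θ_nonneg J)
  calc C * (S.Y / S.lam * (1 + S.lam ^ 2 * S.θ ^ J)) ≤ C * (S.δ * (2 * S.K⁻¹) * (1 + 1)) := by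
        gcongr
    _ = 4 * C * S.K⁻¹ * S.δ := by ring
    _ ≤ c / 2 * S.δ := by
        gcongr
        rw [← div_eq_mul_inv, div_le_iff₀ hK0]
        rw [div_le_iff₀ hc] at hK
        linarith

/-- One perturbation step. -/
theorem exists_perturbs (hk : Horizontal k) (V : ℝ) (hM : 0 ≤ M₀) {c : ℝ} (hc : 0 < c) (hc1 : c ≤ 1)
    (J N : ℕ) : ∃ N₀ : ℕ, ∃ K : ℝ, 1 ≤ K ∧ ∃ Γ₀ : ℝ, 1 ≤ Γ₀ ∧ ∀ Γ, Γ₀ ≤ Γ →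
    ∀ S : Stage N₀ V M₀ k, S.K = K → Γ * S.X ≤ S.lam → Γ * S.X ^ J * S.lam ^ 2 ≤ S.lam ^ J →
    ∀ e : Dir → SPF, (∀ i q, |e i q| ≤ c / (4 * (3 * M₀ + 1)) * S.δ) →
    (∀ d i q, |pd d (e i) q| ≤ S.sc d) → ∃ W T, S.Perturbs c Γ N e W T := by
  obtain ⟨C, hC, H⟩ := exists_flux (V := V) (M₀ := M₀) hk J (N + 1)
  obtain ⟨C1, hC1, H1⟩ := exists_abs_W_le (n := N + 1 + 1 + J + 2) hk V M₀
  obtain ⟨C2, hC2, H2⟩ := exists_pd_W (n := N + 1 + 1 + J + 1) hk V M₀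
  obtain ⟨K, hK⟩ : ∃ K, K = 1 + 16 * C / c := ⟨_, rfl⟩
  have hK1 : 1 ≤ K := by
    rw [hK]
    have : 0 ≤ 16 * C / c := by positivity
    linarith
  have g1 : 0 ≤ 8 * (|V| + 1) := by positivity
  have g2 : 0 ≤ (45 * K) ^ J := by positivity
  have g3 : 0 ≤ 3 * K ^ 3 := by positivity
  have g4 : 0 ≤ 4 * (C2 * K + 3 * M₀ + 1) := by positivity
  have g5 : 0 ≤ C1 * K := by positivity
  refine ⟨N + 1 + 1 + J + 2, K, hK1,
    1 + 8 * (|V| + 1) + 3 * K + (45 * K) ^ J + 3 * K ^ 3 + 4 * (C2 * K + 3 * M₀ + 1) + C1 * K,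
    by linarith, fun Γ hΓ S hS hX hJ e he he' => ?_⟩
  subst hS
  have hΓ1 : 1 ≤ Γ := by linarith
  have hΓ0 : 0 < Γ := by linarith
  obtain ⟨T, hT, hTs, hTm, hTb⟩ := H S
  have hWb : ∀ i q, |S.W i q| ≤ (3 * M₀ + 1) * √S.κ := fun i q => by
    refine (H1 S i q).trans (mul_le_mul_of_nonneg_right ?_ S.sqrt_pos.le)
    have h1 := mul_le_mul_of_nonneg_left (S.μ_Λ_le' hΓ1 hX) hC1
    have h2 : C1 * (S.K * Γ⁻¹) ≤ 1 := by
      rw [← mul_assoc, ← div_eq_mul_inv, div_le_one hΓ0]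
      linarith
    linarith
  have hwf : ∀ d, S.wf d ≤ S.sc' Γ d / S.δ := S.wf_le_sc'
    (by rw [abs_of_nonneg S.V_nonneg] at hΓ; linarith [S.V_nonneg]) (by linarith)
  have hx := S.abs_cross_le hc hc1 hΓ1 (by linarith) hX hC2 he he' hWb
    (fun d i q => (H2 S d i).abs_le () q)
  have hTf := S.bd_flux_le hc hΓ1 hC (by linarith) (by linarith) (by linarith) hX hJ
  have hδ := S.δ_pos
  refine ⟨S.W, fun i j => T i j + (S.W i * e (some j) + e i * S.W (some j)), S.div_W hk, S.W_mem,
    fun i j => add_mem (hTm i j) (add_mem (Ideal.mul_mem_right _ _ (S.W_mem i))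
      (Ideal.mul_mem_left _ _ (S.W_mem _))), fun i j => ?_, hWb, fun d i => ?_, fun i j q => ?_,
    fun d i j q => ?_, fun i => ?_, S.W_eq_zero rfl⟩
  · rw [hTs]
    ring
  · have h1 := (S.pd_u d i).mono S.w0_nonneg (w' := fun d => S.sc' Γ d / S.δ) (n := N) (fun d => ?_)
      (by omega) (S.sc_le_sc' hΓ1 hX d)
    · have h2 := (H2 S d i).mono S.wf_nonneg hwf (n := N) (by omega)
        (mul_le_mul_of_nonneg_left (S.W'_le_sc' hΓ1 d) hC2)
      rw [map_add]
      refine (h1.add h2).mono_right (fun d => div_nonneg (S.sc'_nonneg hΓ1 d) hδ.le) ?_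
      have h3 := S.sc'_nonneg hΓ1 d
      calc S.sc' Γ d * Γ⁻¹ + C2 * (S.K * (S.sc' Γ d * Γ⁻¹))
          = (1 + C2 * S.K) * Γ⁻¹ * S.sc' Γ d := by ring
        _ ≤ 1 * S.sc' Γ d := by
            gcongr
            rw [← div_eq_mul_inv, div_le_one hΓ0]
            linarith
        _ = _ := one_mul _
    · refine div_le_div_of_nonneg_right ((S.sc_le_sc' hΓ1 hX d).trans ?_) hδ.le
      exact mul_le_of_le_one_right (S.sc'_nonneg hΓ1 d) (inv_le_one_of_one_le₀ hΓ1)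
  · have := ((hTb i j).abs_le () q).trans hTf
    rw [add_apply]
    refine (abs_add_le _ _).trans ((add_le_add this ((hx i j).1 q)).trans (le_of_eq (by ring)))
  · have h1 := ((hTb i j).pd d).abs_le () q
    have h2 : S.wf d * (C * (S.Y / S.lam * (1 + S.lam ^ 2 * S.θ ^ J))) ≤ 1 / 2 * S.sc' Γ d := by
      refine (mul_le_mul (hwf d) hTf (hTb i j).nonneg
        (div_nonneg (S.sc'_nonneg hΓ1 d) hδ.le)).trans ?_
      have e1 : S.sc' Γ d / S.δ * (c / 2 * S.δ) = c / 2 * S.sc' Γ d := by field_simp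
      rw [e1]
      exact mul_le_mul_of_nonneg_right (by linarith) (S.sc'_nonneg hΓ1 d)
    rw [map_add, add_apply]
    refine (abs_add_le _ _).trans ((add_le_add (h1.trans h2) ((hx i j).2 d q)).trans
      (le_of_eq (by ring)))
  · rw [NL_add _ _ _ (S.div_W hk)]
    have := hT i
    simp only [map_add, Finset.sum_add_distrib] at this ⊢
    linear_combination this

end Stage

/-- A field `u + e` with a smooth part `u` and a small rough part `e`, together with amplitudes. -/
structure Data (V M₀ c : ℝ) (k : ℕ → Fin 3 → ℤ) where
  δ : ℝ
  κ : ℝ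
  Λ : ℝ
  Z : ℝ
  O : Set ℝ
  u : Dir → SPF
  e : Dir → SPF
  A : ℕ → Dir → SPF
  δ_pos : 0 < δ
  κ_pos : 0 < κ
  κ_le : κ ≤ 1
  δ_le : δ ≤ κ * √κ
  Z_ge : 1 ≤ Z
  Z_le : Z ≤ Λ
  isOpen : IsOpen O
  u_le : ∀ (j : Fin 3) q, |u (some j) q| ≤ V
  e_le : ∀ i q, |e i q| ≤ c / (4 * (3 * M₀ + 1)) * δ
  pd_e : ∀ d i q, |pd d (e i) q| ≤ scale Λ Z d
  A_le : ∀ l i q, |A l i q| ≤ M₀ * √κ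
  orth : ∀ l, ∑ j, (k l j : ℝ) • A l (some j) = 0
  A_mem : ∀ l i, A l i ∈ vanish O

namespace Data

variable {V M₀ c : ℝ} {k : ℕ → Fin 3 → ℤ}

/-- Bounds for higher derivatives. -/
structure Smooth (D : Data V M₀ c k) (N : ℕ) : Prop where
  pd_u : ∀ d i, Bd1 (fun d => scale D.Λ D.Z d / D.δ) N (scale D.Λ D.Z d) (pd d (D.u i))
  pd_A : ∀ l d i, Bd1 (fun d => scale D.Λ D.Z d / D.δ) N (D.κ / D.δ * scale D.Λ D.Z d)
    (pd d (D.A l i))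

def Λs (D : Data V M₀ c k) (Γ : ℝ) (lam : ℕ → ℕ) : ℕ → ℝ
  | 0 => D.Λ
  | l + 1 => Γ * (√D.κ * lam l)

def Zs (D : Data V M₀ c k) (Γ : ℝ) : ℕ → ℝ
  | 0 => D.Z
  | l + 1 => Γ * (D.κ / D.δ * Zs D Γ l)

/-- First-derivative sizes after `l` steps. -/
def sc (D : Data V M₀ c k) (Γ : ℝ) (lam : ℕ → ℕ) (l : ℕ) (d : Dir) : ℝ :=
  scale (D.Λs Γ lam l) (D.Zs Γ l) d

def Xs (D : Data V M₀ c k) (Γ : ℝ) (lam : ℕ → ℕ) (l : ℕ) : ℝ :=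
  D.κ * D.Λs Γ lam l / D.δ ^ 2 + D.κ * D.Zs Γ l ^ 2 / D.δ ^ 3

/-- The frequencies `lam` are large enough for `n` steps. -/
def Fast (D : Data V M₀ c k) (Γ : ℝ) (lam : ℕ → ℕ) (J n : ℕ) : Prop :=
  ∀ l < n, Γ * D.Xs Γ lam l ≤ lam l ∧ Γ * D.Xs Γ lam l ^ J * lam l ^ 2 ≤ (lam l : ℝ) ^ J

/-- The outcome of `n` perturbation steps. -/
structure Chain (D : Data V M₀ c k) (Γ : ℝ) (lam : ℕ → ℕ) (n N : ℕ) (W : Dir → SPF)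
    (T : Dir → Fin 3 → SPF) : Prop where
  Z_ge : 1 ≤ D.Zs Γ n
  Z_le : D.Zs Γ n ≤ D.Λs Γ lam n
  sc_le : ∀ d, D.sc Γ lam 0 d ≤ D.sc Γ lam n d
  div : ∑ j, pd (some j) (W (some j)) = 0
  mem : ∀ i, W i ∈ vanish D.O
  mem' : ∀ i j, T i j ∈ vanish D.O
  symm : ∀ i j, T (some i) j = T (some j) i
  abs_le : ∀ i q, |W i q| ≤ n * ((3 * M₀ + 1) * √D.κ)
  pd_le : ∀ d i, Bd1 (fun d => D.sc Γ lam n d / D.δ) N (D.sc Γ lam n d) (pd d (D.u i + W i))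
  abs_le' : ∀ i j q, |T i j q| ≤ n * (c * D.δ)
  pd_le' : ∀ d i j q, |pd d (T i j) q| ≤ n * D.sc Γ lam n d
  eq : ∀ i, NL (fun i => D.u i + D.e i + W i) i = NL (fun i => D.u i + D.e i) i +
    ∑ j, pd (some j) (∑ l ∈ Finset.range n, D.A l i * D.A l (some j) + T i j)
  temp : ∀ m ≤ n, (∀ l, m ≤ l → D.A l none = 0) → ∀ d q,
    |pd d (D.u none + W none) q| ≤ D.sc Γ lam m d

theorem w_nonneg (D : Data V M₀ c k) (d : Dir) : 0 ≤ scale D.Λ D.Z d / D.δ :=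
  div_nonneg (scale_nonneg (by linarith [D.Z_ge, D.Z_le]) (by linarith [D.Z_ge]) d) D.δ_pos.le

theorem Smooth.of_le {D : Data V M₀ c k} {N n : ℕ} (h : D.Smooth N) (hn : n ≤ N) : D.Smooth n :=
  ⟨fun d i => (h.pd_u d i).of_le D.w_nonneg hn, fun l d i => (h.pd_A l d i).of_le D.w_nonneg hn⟩

theorem chain_zero (D : Data V M₀ c k) {N : ℕ} (h : D.Smooth N) (Γ : ℝ) (lam : ℕ → ℕ) :
    D.Chain Γ lam 0 N 0 0 where
  Z_ge := D.Z_ge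
  Z_le := D.Z_le
  sc_le _ := le_rfl
  div := by simp
  mem _ := zero_mem _
  mem' _ _ := zero_mem _
  symm _ _ := rfl
  abs_le i q := by simp
  pd_le d i := by
    have := h.pd_u d i
    rw [← add_zero (D.u i)] at this
    exact this
  abs_le' i j q := by simp
  pd_le' d i j q := by simp
  eq i := by simp
  temp m hm _ d q := by
    obtain rfl : m = 0 := by omega
    rw [Pi.zero_apply, add_zero]
    exact (h.pd_u d none).abs_le () q

/-- The stage reached after `n` steps. -/
def stage (D : Data V M₀ c k) {Γ : ℝ} {lam : ℕ → ℕ} {n N : ℕ} {W : Dir → SPF}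
    {T : Dir → Fin 3 → SPF} (h : D.Chain Γ lam n N W T) (hs : D.Smooth N) {K : ℝ} (hK : 1 ≤ K)
    (hl : 90 * K * D.Λs Γ lam n / D.δ ≤ lam n) :
    Stage N (V + n * (3 * M₀ + 1)) M₀ (k n) where
  δ := D.δ
  κ := D.κ
  Λ := D.Λs Γ lam n
  Z := D.Zs Γ n
  K := K
  lam := lam n
  O := D.O
  u := fun i => D.u i + W i
  A := D.A n
  δ_pos := D.δ_pos
  κ_pos := D.κ_pos
  κ_le := D.κ_le
  δ_le := D.δ_le
  Z_ge := h.Z_ge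
  Z_le := h.Z_le
  K_ge := hK
  lam_ge := hl
  isOpen := D.isOpen
  u_le := fun j q => by
    have h0 := D.A_le 0 none 0
    have h3 := Real.sqrt_pos.2 D.κ_pos
    have hM : 0 ≤ M₀ := nonneg_of_mul_nonneg_left ((abs_nonneg _).trans h0) h3
    have h1 : (n : ℝ) * ((3 * M₀ + 1) * √D.κ) ≤ n * (3 * M₀ + 1) := by
      gcongr
      exact mul_le_of_le_one_right (by positivity) (Real.sqrt_le_one.2 D.κ_le)
    exact (abs_add_le _ _).trans (add_le_add (D.u_le j q) ((h.abs_le _ q).trans h1))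
  pd_u := h.pd_le
  A_le := D.A_le n
  pd_A := fun d i => (hs.pd_A n d i).mono D.w_nonneg
    (fun d => div_le_div_of_nonneg_right (h.sc_le d) D.δ_pos.le) le_rfl
    (mul_le_mul_of_nonneg_left (h.sc_le d) (div_pos D.κ_pos D.δ_pos).le)
  orth := D.orth n
  A_mem := D.A_mem n

theorem chain_succ (D : Data V M₀ c k) {Γ : ℝ} (hΓ : 1 ≤ Γ) {lam : ℕ → ℕ} {n N N' : ℕ}
    {W W' : Dir → SPF} {T T' : Dir → Fin 3 → SPF} (h : D.Chain Γ lam n N W T) (hs : D.Smooth N)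
    {K : ℝ} (hK : 1 ≤ K) (hl : 90 * K * D.Λs Γ lam n / D.δ ≤ lam n)
    (hX : Γ * D.Xs Γ lam n ≤ lam n)
    (h' : (D.stage h hs hK hl).Perturbs c Γ N' D.e W' T') :
    D.Chain Γ lam (n + 1) N' (fun i => W i + W' i) (fun i j => T i j + T' i j) := by
  have hsc : ∀ d, D.sc Γ lam n d ≤ D.sc Γ lam (n + 1) d := fun d => by
    refine ((D.stage h hs hK hl).sc_le_sc' hΓ hX d).trans ?_
    exact mul_le_of_le_one_right ((D.stage h hs hK hl).sc'_nonneg hΓ d) (inv_le_one_of_one_le₀ hΓ)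
  have hκδ : 1 ≤ D.κ / D.δ := (one_le_div D.δ_pos).2 (D.stage h hs hK hl).δ_le_κ
  have hu : ∀ i, D.u i + W i + W' i = D.u i + (W i + W' i) := fun i => add_assoc _ _ _
  refine ⟨?_, ?_, fun d => (h.sc_le d).trans (hsc d), ?_, fun i => add_mem (h.mem i) (h'.mem i),
    fun i j => add_mem (h.mem' i j) (h'.mem' i j), fun i j => ?_, fun i q => ?_, fun d i => ?_,
    fun i j q => ?_, fun d i j q => ?_, fun i => ?_, fun m hm hA d q => ?_⟩
  · exact one_le_mul_of_one_le_of_one_le hΓ (one_le_mul_of_one_le_of_one_le hκδ h.Z_ge)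
  · have h1 := (D.stage h hs hK hl).le_X'
    have h2 : D.κ * D.Λs Γ lam n / D.δ ^ 2 ≤ lam n := h1.trans (le_trans (le_mul_of_one_le_left
      (by linarith [(D.stage h hs hK hl).one_le_X]) hΓ) hX)
    have h3 : D.δ ≤ √D.κ := (D.stage h hs hK hl).δ_le_sqrt
    change Γ * (D.κ / D.δ * D.Zs Γ n) ≤ Γ * (√D.κ * lam n)
    refine mul_le_mul_of_nonneg_left ?_ (by linarith)
    have hδ := D.δ_pos
    have hκ := D.κ_pos
    have hΛ : 0 < D.Λs Γ lam n := (D.stage h hs hK hl).Λ_pos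
    calc D.κ / D.δ * D.Zs Γ n ≤ D.κ / D.δ * D.Λs Γ lam n := by
          have := h.Z_le
          gcongr
      _ = D.δ * (D.κ * D.Λs Γ lam n / D.δ ^ 2) := by field_simp
      _ ≤ √D.κ * lam n := by gcongr
  · simp only [map_add, Finset.sum_add_distrib, h.div, h'.div, add_zero]
  · simp only [h.symm i j, h'.symm i j]
  · refine (abs_add_le _ _).trans ((add_le_add (h.abs_le i q) (h'.abs_le i q)).trans (le_of_eq ?_))
    change _ + (3 * M₀ + 1) * √D.κ = _
    push_cast
    ring
  · have := h'.pd_le d i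
    change Bd1 _ _ _ (pd d (D.u i + W i + W' i)) at this
    rw [hu] at this
    exact this
  · refine (abs_add_le _ _).trans ((add_le_add (h.abs_le' i j q) (h'.abs_le' i j q)).trans
      (le_of_eq ?_))
    change _ + c * D.δ = _
    push_cast
    ring
  · rw [map_add]
    refine (abs_add_le _ _).trans ((add_le_add (h.pd_le' d i j q) (h'.pd_le' d i j q)).trans ?_)
    change _ + D.sc Γ lam (n + 1) d ≤ _
    push_cast
    have := mul_le_mul_of_nonneg_left (hsc d) n.cast_nonneg
    linarith
  · have h1 := h'.eq i
    have h2 := h.eq i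
    have e1 : ∀ i, (D.stage h hs hK hl).u i + D.e i + W' i = D.u i + D.e i + (W i + W' i) :=
      fun i => by
        change D.u i + W i + D.e i + W' i = _
        ring
    have e2 : ∀ i, (D.stage h hs hK hl).u i + D.e i = D.u i + D.e i + W i := fun i => by
      change D.u i + W i + D.e i = _
      ring
    rw [funext e1, funext e2] at h1
    rw [h1, h2]
    simp only [Finset.sum_range_succ, map_add, Finset.sum_add_distrib]
    change _ + (∑ j, pd (some j) (D.A n i * D.A n (some j)) + _) = _
    ring
  · rcases Nat.lt_or_ge n m with hlt | hge
    · obtain rfl : m = n + 1 := by omega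
      have := (h'.pd_le d none).abs_le () q
      change |pd d (D.u none + W none + W' none) q| ≤ _ at this
      rw [hu] at this
      exact this
    · rw [h'.eq_zero (hA n hge), add_zero]
      exact h.temp m hge hA d q

/-- Iterating the perturbation step. -/
theorem exists_chain (hk : ∀ l, Horizontal (k l)) (V : ℝ) (hM : 0 ≤ M₀) (hc : 0 < c) (hc1 : c ≤ 1)
    (J n N : ℕ) : ∃ N₀ : ℕ, ∃ Γ₀ : ℝ, 1 ≤ Γ₀ ∧ ∀ Γ, Γ₀ ≤ Γ → ∀ D : Data V M₀ c k, D.Smooth N₀ →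
    ∀ lam, D.Fast Γ lam J n → ∃ W T, D.Chain Γ lam n N W T := by
  induction n generalizing N with
  | zero => exact ⟨N, 1, le_rfl, fun Γ _ D h lam _ => ⟨0, 0, D.chain_zero h Γ lam⟩⟩
  | succ n ih =>
    obtain ⟨N₁, K, hK, Γ₁, hΓ₁, H₁⟩ := Stage.exists_perturbs (hk n) (V + n * (3 * M₀ + 1)) hM hc hc1 J N
    obtain ⟨N₀, Γ₀, hΓ₀, H₀⟩ := ih N₁
    refine ⟨N₀ + N₁, Γ₀ + Γ₁ + 90 * K, by linarith, fun Γ hΓ D hD lam hlam => ?_⟩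
    obtain ⟨W, T, h⟩ := H₀ Γ (by linarith) D (hD.of_le (by omega)) lam
      fun l hl => hlam l (by omega)
    obtain ⟨hX, hJ⟩ := hlam n (by omega)
    have hs : D.Smooth N₁ := hD.of_le (by omega)
    have hl : 90 * K * D.Λs Γ lam n / D.δ ≤ lam n := by
      refine le_trans ?_ hX
      have hδ := D.δ_pos
      have hκ := D.κ_pos
      have hΛ : 0 < D.Λs Γ lam n := by linarith [h.Z_ge, h.Z_le]
      have hs1 := Real.sqrt_le_one.2 D.κ_le
      have hδκ : D.δ ≤ D.κ := D.δ_le.trans (mul_le_of_le_one_right hκ.le hs1)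
      have h1 : D.Λs Γ lam n / D.δ ≤ D.Xs Γ lam n := by
        refine le_trans ?_ (le_add_of_nonneg_right (by positivity))
        rw [div_le_div_iff₀ hδ (by positivity)]
        nlinarith [mul_le_mul_of_nonneg_right hδκ (mul_pos hΛ hδ).le]
      rw [mul_div_assoc]
      exact mul_le_mul (by linarith) h1 (by positivity) (by linarith)
    obtain ⟨W', T', h'⟩ := H₁ Γ (by linarith) (D.stage h hs hK hl) rfl hX hJ D.e D.e_le
      fun d i q => (D.pd_e d i q).trans (h.sc_le d)
    exact ⟨_, _, D.chain_succ (by linarith) h hs hK hl hX h'⟩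

end Data
end SPF

/-- A smooth function that is constant near both ends has bounded derivatives. -/
theorem exists_iteratedDeriv_bound {F : ℝ → ℝ} (hF : ContDiff ℝ (⊤ : ℕ∞) F) {B : ℝ}
    (h1 : ∀ s, B ≤ s → F s = F B) (h2 : ∀ s, s ≤ -B → F s = F (-B)) (N : ℕ) :
    ∃ C, 0 ≤ C ∧ ∀ j ≤ N, ∀ s, |iteratedDeriv j F s| ≤ C := by
  have hev : ∀ (j : ℕ) (s c : ℝ), F =ᶠ[nhds s] (fun _ => c) → |iteratedDeriv j F s| ≤ |c| := by
    intro j s c h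
    rw [h.iteratedDeriv_eq, iteratedDeriv_const]
    split_ifs
    · exact le_rfl
    · simp
  have key : ∀ j : ℕ, ∃ C, 0 ≤ C ∧ ∀ s, |iteratedDeriv j F s| ≤ C := by
    intro j
    have hc : Continuous (iteratedDeriv j F) := hF.continuous_iteratedDeriv j (by
      exact_mod_cast le_top)
    obtain ⟨C, hC⟩ := (isCompact_Icc (a := -B) (b := B)).exists_bound_of_continuousOn
      hc.continuousOn
    refine ⟨|C| + |F B| + |F (-B)|, by positivity, fun s => ?_⟩
    have p1 := abs_nonneg C
    have p2 := abs_nonneg (F B)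
    have p3 := abs_nonneg (F (-B))
    rcases lt_or_ge B s with hs | hs
    · have := hev j s (F B) (by
        filter_upwards [lt_mem_nhds hs] with x hx using h1 x hx.le)
      linarith
    rcases lt_or_ge s (-B) with hs' | hs'
    · have := hev j s (F (-B)) (by
        filter_upwards [gt_mem_nhds hs'] with x hx using h2 x hx.le)
      linarith
    · have := hC s ⟨hs', hs⟩
      rw [Real.norm_eq_abs] at this
      linarith [le_abs_self C]
  choose C hC0 hC using key
  exact ⟨∑ j ∈ Finset.range (N + 1), C j, Finset.sum_nonneg fun j _ => hC0 j, fun j hj s =>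
    (hC j s).trans (Finset.single_le_sum (f := C) (fun j _ => hC0 j) (by simp; omega))⟩

namespace SPF

theorem line_sub_abs_le {g : SPF} {d : Dir} {B : ℝ} (hB : ∀ q, |pd d g q| ≤ B) (q : SpaceTime)
    {s : ℝ} (hs : 0 ≤ s) : |g (q + s • dvec d) - g q| ≤ B * s := by
  have := (convex_Icc 0 s).norm_image_sub_le_of_norm_hasDerivWithin_le
    (f := fun s : ℝ => g (q + s • dvec d)) (x := 0) (y := s) (C := B)
    (fun x _ => (hasDerivAt_line g q (dvec d) x).hasDerivWithinAt)
    (fun x _ => hB (q + x • dvec d)) (Set.left_mem_Icc.2 hs) (Set.right_mem_Icc.2 hs)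
  simpa [abs_of_nonneg hs] using this

/-- The forward average over a segment of length `ℓ` in the direction `d`. -/
def stek (d : Dir) (ℓ : ℝ) : SPF →ₗ[ℝ] SPF :=
  avg d 0 ℓ (fun s => 0 * s + ℓ⁻¹) (by fun_prop)

theorem pd_stek (e d : Dir) (ℓ : ℝ) (g : SPF) : pd e (stek d ℓ g) = stek d ℓ (pd e g) := pd_avg e g

variable {ℓ : ℝ} {d : Dir} {g : SPF} {A : ℝ}

theorem stek_abs_le' (hℓ : 0 < ℓ) (q : SpaceTime)
    (hg : ∀ s ∈ Set.Ioc 0 ℓ, |g (q + s • dvec d)| ≤ A) : |stek d ℓ g q| ≤ A := by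
  have := avg_abs_le (d := d) (W := ℓ⁻¹) (ω := fun s => 0 * s + ℓ⁻¹) (hω := by fun_prop) hℓ.le
    (fun s _ => by rw [zero_mul, zero_add, abs_of_pos (inv_pos.2 hℓ)]) g q hg
  refine this.trans (le_of_eq ?_)
  field_simp
  ring

theorem stek_abs_le (hℓ : 0 < ℓ) (hg : ∀ q, |g q| ≤ A) (q : SpaceTime) : |stek d ℓ g q| ≤ A :=
  stek_abs_le' hℓ q fun _ _ => hg _

theorem pd_stek_abs_le (hℓ : 0 < ℓ) (hg : ∀ q, |g q| ≤ A) (q : SpaceTime) :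
    |pd d (stek d ℓ g) q| ≤ 2 / ℓ * A := by
  rw [pd_stek, stek, avg_pd_affine]
  simp only [zero_mul, zero_add, sub_zero]
  rw [← mul_sub, abs_mul, abs_of_pos (inv_pos.2 hℓ)]
  have := (abs_sub _ _).trans (add_le_add (hg (q + ℓ • dvec d)) (hg (q + (0 : ℝ) • dvec d)))
  calc _ ≤ ℓ⁻¹ * (A + A) := mul_le_mul_of_nonneg_left this (inv_pos.2 hℓ).le
    _ = _ := by ring

theorem stek_sub_abs_le (hℓ : 0 < ℓ) (hg : ∀ q, |pd d g q| ≤ A) (q : SpaceTime) :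
    |stek d ℓ g q - g q| ≤ ℓ * A := by
  have hA : 0 ≤ A := (abs_nonneg _).trans (hg 0)
  have e : stek d ℓ g q - g q = stek d ℓ (g - algebraMap ℝ SPF (g q)) q := by
    rw [map_sub, sub_apply]
    congr 1
    rw [stek, avg_apply]
    simp only [algebraMap_apply, zero_mul, zero_add, intervalIntegral.integral_const, sub_zero,
      smul_eq_mul]
    field_simp
  rw [e]
  refine stek_abs_le' hℓ q fun s hs => ?_
  rw [sub_apply, algebraMap_apply]
  refine (line_sub_abs_le hg q hs.1.le).trans ?_
  rw [mul_comm]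
  exact mul_le_mul_of_nonneg_right hs.2 hA

/-- Average over a box. -/
def box (ℓ : Dir → ℝ) : SPF →ₗ[ℝ] SPF :=
  stek none (ℓ none) ∘ₗ stek (some 0) (ℓ (some 0)) ∘ₗ stek (some 1) (ℓ (some 1)) ∘ₗ
    stek (some 2) (ℓ (some 2))

variable {ℓ : Dir → ℝ}

theorem pd_box (e : Dir) (g : SPF) : pd e (box ℓ g) = box ℓ (pd e g) := by
  simp only [box, LinearMap.comp_apply, pd_stek]

theorem box_abs_le (hℓ : ∀ d, 0 < ℓ d) (hg : ∀ q, |g q| ≤ A) (q : SpaceTime) : |box ℓ g q| ≤ A :=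
  stek_abs_le (hℓ _) (stek_abs_le (hℓ _) (stek_abs_le (hℓ _) (stek_abs_le (hℓ _) hg))) q

theorem pd_box_abs_le (hℓ : ∀ d, 0 < ℓ d) (hg : ∀ q, |g q| ≤ A) (d : Dir) (q : SpaceTime) :
    |pd d (box ℓ g) q| ≤ 2 / ℓ d * A := by
  have h : ∀ d, ∀ X : SPF, (∀ q, |X q| ≤ A) → ∀ q, |stek d (ℓ d) X q| ≤ A :=
    fun d X hX => stek_abs_le (hℓ d) hX
  have h' : ∀ d, ∀ X : SPF, (∀ q, |X q| ≤ A) → ∀ q, |pd d (stek d (ℓ d) X) q| ≤ 2 / ℓ d * A :=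
    fun d X hX => pd_stek_abs_le (hℓ d) hX
  simp only [box, LinearMap.comp_apply]
  rcases d with _ | d
  · exact h' _ _ (h _ _ (h _ _ (h _ _ hg))) q
  rw [pd_stek]
  refine stek_abs_le (hℓ _) ?_ q
  obtain rfl | rfl | rfl : d = 0 ∨ d = 1 ∨ d = 2 := by omega
  · exact h' _ _ (h _ _ (h _ _ hg))
  · rw [pd_stek]
    exact stek_abs_le (hℓ _) (h' _ _ (h _ _ hg))
  · rw [pd_stek, pd_stek]
    exact stek_abs_le (hℓ _) (stek_abs_le (hℓ _) (h' _ _ hg))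

theorem box_sub_abs_le (hℓ : ∀ d, 0 < ℓ d) {E : ℝ} (hg : ∀ d q, |pd d g q| ≤ E / ℓ d)
    (q : SpaceTime) : |box ℓ g q - g q| ≤ 4 * E := by
  have h : ∀ d, ∀ X : SPF, (∀ d q, |pd d X q| ≤ E / ℓ d) →
      (∀ e q, |pd e (stek d (ℓ d) X) q| ≤ E / ℓ e) ∧ ∀ q, |stek d (ℓ d) X q - X q| ≤ E :=
    fun d X hX => ⟨fun e => by
      rw [pd_stek]
      exact stek_abs_le (hℓ d) (hX e), fun q => by
      refine (stek_sub_abs_le (hℓ d) (hX d) q).trans (le_of_eq ?_)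
      rw [mul_div_cancel₀ _ (hℓ d).ne']⟩
  obtain ⟨h1, e1⟩ := h (some 2) g hg
  obtain ⟨h2, e2⟩ := h (some 1) _ h1
  obtain ⟨h3, e3⟩ := h (some 0) _ h2
  obtain ⟨-, e4⟩ := h none _ h3
  have := abs_le.1 (e1 q)
  have := abs_le.1 (e2 q)
  have := abs_le.1 (e3 q)
  have := abs_le.1 (e4 q)
  simp only [box, LinearMap.comp_apply]
  rw [abs_le]
  constructor <;> linarith

theorem box_eq_zero (hℓ : ∀ d, 0 < ℓ d) {a b : ℝ} (hg : ∀ q, q.1 ≤ a ∨ b ≤ q.1 → g q = 0)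
    (q : SpaceTime) (hq : q.1 ≤ a - ℓ none ∨ b ≤ q.1) : box ℓ g q = 0 := by
  have h0 : ∀ {ℓ : ℝ}, 0 < ℓ → ∀ {d : Dir} {X : SPF} {q : SpaceTime},
      (∀ s ∈ Set.Ioc 0 ℓ, X (q + s • dvec d) = 0) → stek d ℓ X q = 0 := fun hℓ d X q h => by
    refine abs_nonpos_iff.1 (stek_abs_le' hℓ q fun s hs => ?_)
    rw [h s hs, abs_zero]
  have h1 : ∀ (i : Fin 3) (X : SPF), (∀ q, q.1 ≤ a ∨ b ≤ q.1 → X q = 0) →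
      ∀ q, q.1 ≤ a ∨ b ≤ q.1 → stek (some i) (ℓ (some i)) X q = 0 := fun i X hX q hq =>
    h0 (hℓ _) fun s _ => hX _ (by simpa [dvec] using hq)
  refine h0 (hℓ _) fun s hs => h1 _ _ (h1 _ _ (h1 _ _ hg)) _ ?_
  have e : (q + s • dvec none).1 = q.1 + s := by simp [dvec]
  rw [e]
  rcases hq with hq | hq
  · exact Or.inl (by linarith [hs.2])
  · exact Or.inr (by linarith [hs.1])

/-- Iterated box averages. -/
def mol (ℓ : Dir → ℝ) : ℕ → SPF →ₗ[ℝ] SPF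
  | 0 => LinearMap.id
  | n + 1 => mol ℓ n ∘ₗ box ℓ

theorem pd_mol (n : ℕ) (e : Dir) (g : SPF) : pd e (mol ℓ n g) = mol ℓ n (pd e g) := by
  induction n generalizing g with
  | zero => rfl
  | succ n ih => simp only [mol, LinearMap.comp_apply, ih, pd_box]

theorem mol_abs_le (hℓ : ∀ d, 0 < ℓ d) (n : ℕ) (hg : ∀ q, |g q| ≤ A) (q : SpaceTime) :
    |mol ℓ n g q| ≤ A := by
  induction n generalizing g with
  | zero => exact hg q
  | succ n ih => exact ih (box_abs_le hℓ hg)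

theorem bd1_mol (hℓ : ∀ d, 0 < ℓ d) (n : ℕ) (hg : ∀ q, |g q| ≤ A) :
    Bd1 (fun d => 2 / ℓ d) n A (mol ℓ n g) := by
  induction n generalizing g A with
  | zero => exact bd1_of_abs_le hg
  | succ n ih =>
    refine bd1_succ (mol_abs_le hℓ _ hg) fun d => ?_
    have := ih (pd_box_abs_le hℓ hg d)
    rw [← pd_mol] at this
    exact this

theorem mol_sub_abs_le (hℓ : ∀ d, 0 < ℓ d) {E : ℝ} (n : ℕ) (hg : ∀ d q, |pd d g q| ≤ E / ℓ d)
    (q : SpaceTime) : |mol ℓ n g q - g q| ≤ n * (4 * E) := by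
  induction n generalizing g with
  | zero => simp [mol]
  | succ n ih =>
    have h1 := ih (g := box ℓ g) fun d => by
      rw [pd_box]
      exact box_abs_le hℓ (hg d)
    have := abs_le.1 h1
    have := abs_le.1 (box_sub_abs_le hℓ hg q)
    simp only [mol, LinearMap.comp_apply]
    push_cast
    rw [abs_le]
    constructor <;> linarith

theorem mol_eq_zero (hℓ : ∀ d, 0 < ℓ d) {a b : ℝ} (n : ℕ) (hg : ∀ q, q.1 ≤ a ∨ b ≤ q.1 → g q = 0)
    (q : SpaceTime) (hq : q.1 ≤ a - n * ℓ none ∨ b ≤ q.1) : mol ℓ n g q = 0 := by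
  induction n generalizing g a with
  | zero => exact hg q (by simpa using hq)
  | succ n ih =>
    refine ih (box_eq_zero hℓ hg) (hq.imp_left fun h => h.trans (le_of_eq ?_))
    push_cast
    ring

end SPF

namespace SPF

/-- A bounded function whose derivatives have size `s`, at frequencies `w`. -/
structure Lip (w s : Dir → ℝ) (N : ℕ) (C : ℝ) (X : SPF) : Prop where
  abs_le : ∀ q, |X q| ≤ C
  pd : ∀ d, Bd1 w N (C * s d) (SPF.pd d X)

section Lip

variable {w s : Dir → ℝ} {N : ℕ} {C C' : ℝ} {X Y : SPF}

theorem Lip.nonneg (h : Lip w s N C X) : 0 ≤ C := (abs_nonneg _).trans (h.abs_le 0)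

theorem Lip.mono (hs : ∀ d, 0 ≤ s d) (hw : ∀ d, s d ≤ w d) (h : Lip w s N C X) (hC : C ≤ C') :
    Lip w s N C' X :=
  ⟨fun q => (h.abs_le q).trans hC, fun d => (h.pd d).mono_right (fun d => (hs d).trans (hw d))
    (mul_le_mul_of_nonneg_right hC (hs d))⟩

theorem Lip.bd1 (hs : ∀ d, 0 ≤ s d) (hw : ∀ d, s d ≤ w d) (h : Lip w s N C X) :
    Bd1 w N C X := by
  have hw0 : ∀ d, 0 ≤ w d := fun d => (hs d).trans (hw d)
  refine Bd.of_le hw0 (bd1_succ (N := N) h.abs_le fun d => ?_) (Nat.le_succ N)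
  refine (h.pd d).mono_right hw0 ?_
  rw [mul_comm]
  exact mul_le_mul_of_nonneg_right (hw d) h.nonneg

theorem Lip.add (h : Lip w s N C X) (h' : Lip w s N C' Y) : Lip w s N (C + C') (X + Y) :=
  ⟨fun q => (abs_add_le _ _).trans (add_le_add (h.abs_le q) (h'.abs_le q)), fun d => by
    rw [map_add, add_mul]
    exact Bd.add (h.pd d) (h'.pd d)⟩

theorem Lip.smul (h : Lip w s N C X) {c : ℝ} {c' : ℝ} (hc : |c| ≤ c') :
    Lip w s N (c' * C) (c • X) :=
  ⟨fun q => by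
    rw [smul_apply, abs_mul]
    exact mul_le_mul hc (h.abs_le q) (abs_nonneg _) ((abs_nonneg _).trans hc), fun d => by
    rw [Derivation.map_smul, mul_assoc]
    exact Bd.smul (h.pd d) (r := fun _ => c) ((abs_nonneg _).trans hc) fun _ => hc⟩

theorem lip_const (hs : ∀ d, 0 ≤ s d) (hw : ∀ d, s d ≤ w d) (c : ℝ) :
    Lip w s N |c| (algebraMap ℝ SPF c) :=
  ⟨fun q => le_rfl, fun d => by
    rw [Derivation.map_algebraMap]
    exact bd_zero (fun d => (hs d).trans (hw d)) (mul_nonneg (abs_nonneg c) (hs d))⟩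

theorem Lip.mul (hs : ∀ d, 0 ≤ s d) (hw : ∀ d, s d ≤ w d) (h : Lip w s N C X)
    (h' : Lip w s N C' Y) : Lip w s N (2 * 2 ^ N * (C * C')) (X * Y) := by
  have hw0 : ∀ d, 0 ≤ w d := fun d => (hs d).trans (hw d)
  have hC := mul_nonneg h.nonneg h'.nonneg
  refine ⟨fun q => ?_, fun d => ?_⟩
  · rw [mul_apply, abs_mul]
    refine (mul_le_mul (h.abs_le q) (h'.abs_le q) (abs_nonneg _) h.nonneg).trans ?_
    have : (1 : ℝ) ≤ 2 ^ N := one_le_pow₀ one_le_two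
    nlinarith
  · rw [pd_mul]
    exact (((h.pd d).mul hw0 (h'.bd1 hs hw)).add ((h.bd1 hs hw).mul hw0 (h'.pd d))).mono_right hw0
      (le_of_eq (by ring))

theorem lip_comp (hs : ∀ d, 0 ≤ s d) (hw : ∀ d, s d ≤ w d) {F : ℝ → ℝ}
    (hF : ContDiff ℝ (⊤ : ℕ∞) F) {K : ℝ} (hK : ∀ j ≤ N + 1, ∀ x, |iteratedDeriv j F x| ≤ K)
    (hC : ∀ d, C * s d ≤ w d) (hC0 : 0 ≤ C) (h : ∀ d, Bd1 w N (C * s d) (pd d X)) :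
    Lip w s N (K + 2 ^ N * (compConst N * K * C)) (comp F hF X) := by
  have hw0 : ∀ d, 0 ≤ w d := fun d => (hs d).trans (hw d)
  have hK0 : 0 ≤ K := (abs_nonneg _).trans (hK 0 (by omega) 0)
  have hc : 0 ≤ compConst N := zero_le_one.trans (one_le_compConst N)
  refine ⟨fun q => ?_, fun d => ?_⟩
  · have := hK 0 (by omega) (X q)
    rw [iteratedDeriv_zero] at this
    rw [comp_apply]
    exact this.trans (le_add_of_nonneg_right (by positivity))
  · rw [pd_comp]
    have h1 : Bd1 w N (compConst N * K) (comp (deriv F) (contDiff_deriv hF) X) :=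
      bd_comp hw0 (fun _ : Unit => contDiff_deriv hF) (fun j hj x t => by
        rw [← iteratedDeriv_succ']
        refine (Finset.sum_le_sum_of_subset_of_nonneg (Finset.subset_univ t)
          fun _ _ _ => abs_nonneg _).trans ?_
        simpa using hK (j + 1) (by omega) x)
        fun d => (h d).mono_right hw0 (hC d)
    refine (h1.mul hw0 (h d)).mono_right hw0 ?_
    rw [← mul_assoc, ← mul_assoc, ← mul_assoc]
    exact mul_le_mul_of_nonneg_right (le_add_of_nonneg_left hK0 |>.trans (le_of_eq (by ring))) (hs d)

end Lip

/-- A positive function equal to the identity on `[1, 7/2]`. -/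
def plateau (x : ℝ) : ℝ :=
  2⁻¹ + (x - 2⁻¹) * (Real.smoothTransition (4 * x - 2) * Real.smoothTransition (5 - x))

theorem plateau_pos (x : ℝ) : 0 < plateau x := by
  have h1 := Real.smoothTransition.nonneg (4 * x - 2)
  have h2 := Real.smoothTransition.nonneg (5 - x)
  rcases le_total x 2⁻¹ with h | h
  · rw [plateau, Real.smoothTransition.zero_of_nonpos (by linarith)]
    norm_num
  · have : 0 ≤ (x - 2⁻¹) * (Real.smoothTransition (4 * x - 2) * Real.smoothTransition (5 - x)) :=
      mul_nonneg (sub_nonneg.2 h) (mul_nonneg h1 h2)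
    rw [plateau]
    positivity

theorem plateau_eq {x : ℝ} (h1 : 1 ≤ x) (h2 : x ≤ 7 / 2) : plateau x = x := by
  rw [plateau, Real.smoothTransition.one_of_one_le (by linarith),
    Real.smoothTransition.one_of_one_le (by linarith)]
  ring

theorem plateau_eq_of_le {x : ℝ} (h : x ≤ -5) : plateau x = 2⁻¹ := by
  rw [plateau, Real.smoothTransition.zero_of_nonpos (by linarith)]
  ring

theorem plateau_eq_of_ge {x : ℝ} (h : 5 ≤ x) : plateau x = 2⁻¹ := by
  rw [plateau, Real.smoothTransition.zero_of_nonpos (x := 5 - x) (by linarith)]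
  ring

theorem contDiff_plateau : ContDiff ℝ (⊤ : ℕ∞) plateau := by
  have hT : ContDiff ℝ (⊤ : ℕ∞) Real.smoothTransition := Real.smoothTransition.contDiff
  exact contDiff_const.add ((contDiff_id.sub contDiff_const).mul
    ((hT.comp ((contDiff_const.mul contDiff_id).sub contDiff_const)).mul
      (hT.comp (contDiff_const.sub contDiff_id))))

/-- A smooth bounded version of the square root. -/
def root (x : ℝ) : ℝ := √(plateau x)

theorem contDiff_root : ContDiff ℝ (⊤ : ℕ∞) root :=
  contDiff_plateau.sqrt fun x => (plateau_pos x).ne'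

theorem root_pos (x : ℝ) : 0 < root x := Real.sqrt_pos.2 (plateau_pos x)

theorem contDiff_inv_root : ContDiff ℝ (⊤ : ℕ∞) fun x => (root x)⁻¹ :=
  contDiff_root.inv fun x => (root_pos x).ne'

theorem root_mul_self {x : ℝ} (h1 : 1 ≤ x) (h2 : x ≤ 7 / 2) : root x * root x = x := by
  rw [root, Real.mul_self_sqrt (plateau_pos x).le, plateau_eq h1 h2]

theorem one_le_root {x : ℝ} (h1 : 1 ≤ x) (h2 : x ≤ 7 / 2) : 1 ≤ root x := by
  rw [root, Real.one_le_sqrt, plateau_eq h1 h2]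
  exact h1

theorem root_le {x : ℝ} (h1 : 1 ≤ x) (h2 : x ≤ 7 / 2) : root x ≤ 2 := by
  rw [root, plateau_eq h1 h2, Real.sqrt_le_left (by norm_num)]
  linarith

/-- Directions of the amplitudes. -/
def ampDir : ℕ → Fin 3 → ℤ
  | 0 => ![1, 1, 0]
  | 1 => ![1, 0, 1]
  | 2 => ![0, 1, 1]
  | 3 => ![1, -1, 0]
  | 4 => ![1, 0, -1]
  | _ => ![0, 1, -1]

/-- Horizontal wave vectors orthogonal to the amplitudes. -/
def waveDir : ℕ → Fin 3 → ℤ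
  | 0 => ![1, -1, 0]
  | 1 => ![0, 1, 0]
  | 2 => ![1, 0, 0]
  | 3 => ![1, 1, 0]
  | 4 => ![0, 1, 0]
  | _ => ![1, 0, 0]

theorem horizontal_waveDir (l : ℕ) : Horizontal (waveDir l) := by
  constructor <;> rcases l with _ | _ | _ | _ | _ | l <;> simp only [waveDir] <;> decide

theorem waveDir_orth (l : ℕ) : ∑ j, waveDir l j * ampDir l j = 0 := by
  rcases l with _ | _ | _ | _ | _ | l <;> simp only [waveDir, ampDir] <;> decide

theorem ampDir_abs_le (l : ℕ) (i : Fin 3) : |(ampDir l i : ℝ)| ≤ 1 := by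
  have : ∀ i, |ampDir l i| ≤ 1 := by
    rcases l with _ | _ | _ | _ | _ | l <;> simp only [ampDir] <;> decide
  exact_mod_cast this i

/-- The coefficients of `9 Id - S` with respect to the squares of the amplitude directions. -/
def ampSq (S : Dir → Fin 3 → SPF) : ℕ → SPF
  | 0 => algebraMap ℝ SPF (9 / 4) + ((-4⁻¹ : ℝ) • S (some 0) 0 + ((-4⁻¹ : ℝ) • S (some 1) 1 +
      ((4⁻¹ : ℝ) • S (some 2) 2 + (-2⁻¹ : ℝ) • S (some 0) 1)))
  | 1 => algebraMap ℝ SPF (9 / 4) + ((-4⁻¹ : ℝ) • S (some 0) 0 + ((4⁻¹ : ℝ) • S (some 1) 1 +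
      ((-4⁻¹ : ℝ) • S (some 2) 2 + (-2⁻¹ : ℝ) • S (some 0) 2)))
  | 2 => algebraMap ℝ SPF (9 / 4) + ((4⁻¹ : ℝ) • S (some 0) 0 + ((-4⁻¹ : ℝ) • S (some 1) 1 +
      ((-4⁻¹ : ℝ) • S (some 2) 2 + (-2⁻¹ : ℝ) • S (some 1) 2)))
  | 3 => algebraMap ℝ SPF (9 / 4) + ((-4⁻¹ : ℝ) • S (some 0) 0 + ((-4⁻¹ : ℝ) • S (some 1) 1 +
      ((4⁻¹ : ℝ) • S (some 2) 2 + (2⁻¹ : ℝ) • S (some 0) 1)))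
  | 4 => algebraMap ℝ SPF (9 / 4) + ((-4⁻¹ : ℝ) • S (some 0) 0 + ((4⁻¹ : ℝ) • S (some 1) 1 +
      ((-4⁻¹ : ℝ) • S (some 2) 2 + (2⁻¹ : ℝ) • S (some 0) 2)))
  | _ => algebraMap ℝ SPF (9 / 4) + ((4⁻¹ : ℝ) • S (some 0) 0 + ((-4⁻¹ : ℝ) • S (some 1) 1 +
      ((-4⁻¹ : ℝ) • S (some 2) 2 + (2⁻¹ : ℝ) • S (some 1) 2)))

/-- The coefficients of the heat flux in the first three amplitude directions. -/
def ampLin (S : Dir → Fin 3 → SPF) : ℕ → SPF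
  | 0 => (2⁻¹ : ℝ) • S none 0 + ((2⁻¹ : ℝ) • S none 1 + (-2⁻¹ : ℝ) • S none 2)
  | 1 => (2⁻¹ : ℝ) • S none 0 + ((-2⁻¹ : ℝ) • S none 1 + (2⁻¹ : ℝ) • S none 2)
  | 2 => (-2⁻¹ : ℝ) • S none 0 + ((2⁻¹ : ℝ) • S none 1 + (2⁻¹ : ℝ) • S none 2)
  | _ => 0

section Coefficients

variable {S : Dir → Fin 3 → SPF}

theorem abs_ampSq_le (hS : ∀ i j q, |S i j q| ≤ 1) (l : ℕ) (q : SpaceTime) :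
    1 ≤ ampSq S l q ∧ ampSq S l q ≤ 7 / 2 := by
  have h := fun i j => abs_le.1 (hS i j q)
  rcases l with _ | _ | _ | _ | _ | l <;>
  · simp only [ampSq, add_apply, algebraMap_apply, smul_apply]
    constructor <;>
    linarith [(h (some 0) 0).1, (h (some 0) 0).2, (h (some 1) 1).1, (h (some 1) 1).2,
      (h (some 2) 2).1, (h (some 2) 2).2, (h (some 0) 1).1, (h (some 0) 1).2, (h (some 0) 2).1,
      (h (some 0) 2).2, (h (some 1) 2).1, (h (some 1) 2).2]

theorem abs_ampLin_le (hS : ∀ i j q, |S i j q| ≤ 1) (l : ℕ) (q : SpaceTime) :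
    |ampLin S l q| ≤ 3 / 2 := by
  have h := fun i j => abs_le.1 (hS i j q)
  rw [abs_le]
  rcases l with _ | _ | _ | l <;>
  · simp only [ampLin, add_apply, zero_apply, smul_apply]
    constructor <;>
    linarith [(h none 0).1, (h none 0).2, (h none 1).1, (h none 1).2, (h none 2).1, (h none 2).2]

variable {w s : Dir → ℝ} {N : ℕ}

theorem lip_ampSq (hs : ∀ d, 0 ≤ s d) (hw : ∀ d, s d ≤ w d) (hS : ∀ i j, Lip w s N 1 (S i j))
    (l : ℕ) : Lip w s N 4 (ampSq S l) := by
  have hc := lip_const (N := N) hs hw (9 / 4)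
  have p4 := fun i j => (hS i j).smul (c := 4⁻¹) (c' := 4⁻¹) (by norm_num [abs_of_pos])
  have m4 := fun i j => (hS i j).smul (c := -4⁻¹) (c' := 4⁻¹) (by norm_num [abs_of_pos])
  have p2 := fun i j => (hS i j).smul (c := 2⁻¹) (c' := 2⁻¹) (by norm_num [abs_of_pos])
  have m2 := fun i j => (hS i j).smul (c := -2⁻¹) (c' := 2⁻¹) (by norm_num [abs_of_pos])
  have e : |(9 / 4 : ℝ)| = 9 / 4 := abs_of_pos (by norm_num)
  rw [e] at hc
  rcases l with _ | _ | _ | _ | _ | l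
  · exact (hc.add ((m4 _ _).add ((m4 _ _).add ((p4 _ _).add (m2 _ _))))).mono hs hw (by norm_num)
  · exact (hc.add ((m4 _ _).add ((p4 _ _).add ((m4 _ _).add (m2 _ _))))).mono hs hw (by norm_num)
  · exact (hc.add ((p4 _ _).add ((m4 _ _).add ((m4 _ _).add (m2 _ _))))).mono hs hw (by norm_num)
  · exact (hc.add ((m4 _ _).add ((m4 _ _).add ((p4 _ _).add (p2 _ _))))).mono hs hw (by norm_num)
  · exact (hc.add ((m4 _ _).add ((p4 _ _).add ((m4 _ _).add (p2 _ _))))).mono hs hw (by norm_num)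
  · exact (hc.add ((p4 _ _).add ((m4 _ _).add ((m4 _ _).add (p2 _ _))))).mono hs hw (by norm_num)

theorem lip_ampLin (hs : ∀ d, 0 ≤ s d) (hw : ∀ d, s d ≤ w d) (hS : ∀ i j, Lip w s N 1 (S i j))
    (l : ℕ) : Lip w s N 2 (ampLin S l) := by
  have p2 := fun i j => (hS i j).smul (c := 2⁻¹) (c' := 2⁻¹) (by norm_num [abs_of_pos])
  have m2 := fun i j => (hS i j).smul (c := -2⁻¹) (c' := 2⁻¹) (by norm_num [abs_of_pos])
  rcases l with _ | _ | _ | l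
  · exact ((p2 _ _).add ((p2 _ _).add (m2 _ _))).mono hs hw (by norm_num)
  · exact ((p2 _ _).add ((m2 _ _).add (p2 _ _))).mono hs hw (by norm_num)
  · exact ((m2 _ _).add ((p2 _ _).add (p2 _ _))).mono hs hw (by norm_num)
  · have := lip_const (N := N) hs hw 0
    rw [map_zero] at this
    exact this.mono hs hw (by norm_num)

end Coefficients

/-- A smooth step in time. -/
def ramp (m c : ℝ) : SPF :=
  comp Real.smoothTransition Real.smoothTransition.contDiff (m • time + algebraMap ℝ SPF c)

theorem ramp_apply (m c : ℝ) (q : SpaceTime) :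
    ramp m c q = Real.smoothTransition (m * q.1 + c) := rfl

theorem pd_ramp (m c : ℝ) (j : Fin 3) : pd (some j) (ramp m c) = 0 := by
  rw [ramp, pd_comp, map_add, Derivation.map_smul, pd_time, Derivation.map_algebraMap]
  simp

/-- A smooth time cutoff, equal to `1` on `[a - κ / 4, b + κ / 4]`. -/
def cutoff (κ a b : ℝ) : SPF :=
  ramp (4 / κ) (-(4 / κ) * (a - κ / 2)) * ramp (-(4 / κ)) (4 / κ * (b + κ / 2))

section Cutoff

variable {κ a b : ℝ}

theorem pd_cutoff (j : Fin 3) : pd (some j) (cutoff κ a b) = 0 := by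
  rw [cutoff, pd_mul, pd_ramp, pd_ramp, zero_mul, mul_zero, add_zero]

theorem abs_cutoff_le (q : SpaceTime) : |cutoff κ a b q| ≤ 1 := by
  rw [cutoff, mul_apply, ramp_apply, ramp_apply,
    abs_of_nonneg (mul_nonneg (Real.smoothTransition.nonneg _) (Real.smoothTransition.nonneg _))]
  exact mul_le_one₀ (Real.smoothTransition.le_one _) (Real.smoothTransition.nonneg _)
    (Real.smoothTransition.le_one _)

theorem cutoff_eq_one (hκ : 0 < κ) {q : SpaceTime} (h1 : a - κ / 4 ≤ q.1) (h2 : q.1 ≤ b) :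
    cutoff κ a b q = 1 := by
  rw [cutoff, mul_apply, ramp_apply, ramp_apply, Real.smoothTransition.one_of_one_le,
    Real.smoothTransition.one_of_one_le, mul_one]
  · have : -(4 / κ) * q.1 + 4 / κ * (b + κ / 2) = 4 / κ * (b - q.1) + 2 := by field_simp; ring
    rw [this]
    have := mul_nonneg (div_pos four_pos hκ).le (sub_nonneg.2 h2)
    linarith
  · have : 4 / κ * q.1 + -(4 / κ) * (a - κ / 2) = 4 / κ * (q.1 - (a - κ / 4)) + 1 := by
      field_simp; ring
    rw [this]
    have := mul_nonneg (div_pos four_pos hκ).le (sub_nonneg.2 h1)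
    linarith

theorem cutoff_mem (hκ : 0 < κ) :
    cutoff κ a b ∈ vanish {t | t < a - κ / 2 ∨ b + κ / 2 < t} := by
  rintro q (h | h)
  · rw [cutoff, mul_apply, ramp_apply, Real.smoothTransition.zero_of_nonpos, zero_mul]
    have := mul_nonneg (div_pos four_pos hκ).le (sub_nonneg.2 h.le)
    linarith
  · rw [cutoff, mul_apply, ramp_apply, ramp_apply,
      Real.smoothTransition.zero_of_nonpos (x := -(4 / κ) * q.1 + _), mul_zero]
    have := mul_nonneg (div_pos four_pos hκ).le (sub_nonneg.2 h.le)
    linarith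

variable {w s : Dir → ℝ} {N : ℕ} {K : ℝ}

/-- The constant of `lip_comp` for functions of slope at most four. -/
def flatConst (N : ℕ) (K : ℝ) : ℝ := K + 2 ^ N * (compConst N * K * 4)

theorem lip_ramp (hκ : 0 < κ) (hs : ∀ d, κ⁻¹ ≤ s d) (hw : ∀ d, 4 * s d ≤ w d)
    (hK : ∀ j ≤ N + 1, ∀ x, |iteratedDeriv j Real.smoothTransition x| ≤ K) {m : ℝ}
    (hm : |m| = 4 / κ) (c : ℝ) : Lip w s N (flatConst N K) (ramp m c) := by
  have hs0 : ∀ d, 0 ≤ s d := fun d => (inv_pos.2 hκ).le.trans (hs d)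
  have hw' : ∀ d, s d ≤ w d := fun d => by linarith [hs0 d, hw d]
  refine lip_comp hs0 hw' _ hK hw (by norm_num) fun d => ?_
  rw [map_add, Derivation.map_smul, pd_time, Derivation.map_algebraMap, add_zero]
  have hw0 : ∀ d, 0 ≤ w d := fun d => (hs0 d).trans (hw' d)
  refine (Bd.smul (r := fun _ => m) (bd1_const hw0 _) (abs_nonneg m) fun _ => le_rfl).mono_right
    hw0 ?_
  have h1 : |(if d = none then (1 : ℝ) else 0)| ≤ 1 := by split_ifs <;> simp
  rw [hm]
  calc 4 / κ * |(if d = none then (1 : ℝ) else 0)| ≤ 4 / κ * 1 :=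
        mul_le_mul_of_nonneg_left h1 (by positivity)
    _ = 4 * κ⁻¹ := by ring
    _ ≤ _ := mul_le_mul_of_nonneg_left (hs d) (by norm_num)

theorem lip_cutoff (hκ : 0 < κ) (hs : ∀ d, κ⁻¹ ≤ s d) (hw : ∀ d, 4 * s d ≤ w d)
    (hK : ∀ j ≤ N + 1, ∀ x, |iteratedDeriv j Real.smoothTransition x| ≤ K) :
    Lip w s N (2 * 2 ^ N * (flatConst N K * flatConst N K)) (cutoff κ a b) := by
  have hs0 : ∀ d, 0 ≤ s d := fun d => (inv_pos.2 hκ).le.trans (hs d)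
  have hp : |4 / κ| = 4 / κ := abs_of_pos (div_pos four_pos hκ)
  exact (lip_ramp hκ hs hw hK hp _).mul hs0 (fun d => by linarith [hs0 d, hw d])
    (lip_ramp hκ hs hw hK ((abs_neg _).trans hp) _)

end Cutoff

theorem contDiff_smoothTransition : ContDiff ℝ (⊤ : ℕ∞) Real.smoothTransition :=
  Real.smoothTransition.contDiff

/-- A common bound for the derivatives of the three profile functions. -/
theorem exists_profile_bound (N : ℕ) : ∃ K : ℝ, 1 ≤ K ∧ ∀ j ≤ N, ∀ x : ℝ,
    |iteratedDeriv j Real.smoothTransition x| ≤ K ∧ |iteratedDeriv j root x| ≤ K ∧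
    |iteratedDeriv j (fun x => (root x)⁻¹) x| ≤ K := by
  obtain ⟨K1, h1, H1⟩ := exists_iteratedDeriv_bound contDiff_smoothTransition (B := 5)
    (fun s hs => by
      rw [Real.smoothTransition.one_of_one_le (by linarith),
        Real.smoothTransition.one_of_one_le (by norm_num)])
    (fun s hs => by
      rw [Real.smoothTransition.zero_of_nonpos (by linarith),
        Real.smoothTransition.zero_of_nonpos (by norm_num)]) N
  have r1 : ∀ s : ℝ, 5 ≤ s → root s = root 5 := fun s hs => by
    rw [root, root, plateau_eq_of_ge hs, plateau_eq_of_ge le_rfl]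
  have r2 : ∀ s : ℝ, s ≤ -5 → root s = root (-5) := fun s hs => by
    rw [root, root, plateau_eq_of_le hs, plateau_eq_of_le le_rfl]
  obtain ⟨K2, h2, H2⟩ := exists_iteratedDeriv_bound contDiff_root r1 r2 N
  obtain ⟨K3, h3, H3⟩ := exists_iteratedDeriv_bound contDiff_inv_root (B := 5)
    (fun s hs => by rw [r1 s hs]) (fun s hs => by rw [r2 s hs]) N
  refine ⟨1 + K1 + K2 + K3, by linarith, fun j hj x => ⟨?_, ?_, ?_⟩⟩
  · linarith [H1 j hj x]
  · linarith [H2 j hj x]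
  · linarith [H3 j hj x]

/-- Normalized amplitudes. -/
def amp (S : Dir → Fin 3 → SPF) (ρ : SPF) (l : ℕ) : Dir → SPF
  | none => -(ρ * (ampLin S l * comp (fun x => (root x)⁻¹) contDiff_inv_root (ampSq S l)))
  | some i => (ampDir l i : ℝ) • (ρ * comp root contDiff_root (ampSq S l))

section Amplitude

variable {S : Dir → Fin 3 → SPF} {ρ : SPF}

theorem abs_amp_le (hS : ∀ i j q, |S i j q| ≤ 1) (hρ : ∀ q, |ρ q| ≤ 1) (l : ℕ) (i : Dir)
    (q : SpaceTime) : |amp S ρ l i q| ≤ 2 := by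
  obtain ⟨h1, h2⟩ := abs_ampSq_le hS l q
  have h3 := one_le_root h1 h2
  cases i with
  | none =>
    have h4 : |(root (ampSq S l q))⁻¹| ≤ 1 := by
      rw [abs_of_pos (inv_pos.2 (root_pos _))]
      exact inv_le_one_of_one_le₀ h3
    simp only [amp, neg_apply, mul_apply, comp_apply, abs_neg, abs_mul]
    calc |ρ q| * (|ampLin S l q| * |(root (ampSq S l q))⁻¹|) ≤ 1 * (3 / 2 * 1) := by
          gcongr
          exacts [hρ q, abs_ampLin_le hS l q]
      _ ≤ 2 := by norm_num
  | some i =>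
    have h4 : |root (ampSq S l q)| ≤ 2 := by
      rw [abs_of_pos (root_pos _)]
      exact root_le h1 h2
    simp only [amp, smul_apply, mul_apply, comp_apply, abs_mul]
    calc |(ampDir l i : ℝ)| * (|ρ q| * |root (ampSq S l q)|) ≤ 1 * (1 * 2) := by
          gcongr
          exacts [ampDir_abs_le l i, hρ q]
      _ = 2 := by norm_num

theorem amp_orth (l : ℕ) : ∑ j, (waveDir l j : ℝ) • amp S ρ l (some j) = 0 := by
  simp only [amp, smul_smul, ← Finset.sum_smul]
  have : (∑ j, (waveDir l j : ℝ) * ampDir l j) = 0 := by exact_mod_cast waveDir_orth l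
  rw [this, zero_smul]

theorem amp_temp {l : ℕ} (hl : 3 ≤ l) : amp S ρ l none = 0 := by
  obtain ⟨m, rfl⟩ : ∃ m, l = m + 3 := ⟨l - 3, by omega⟩
  simp [amp, ampLin]

theorem amp_mem {O : Set ℝ} (hρ : ρ ∈ vanish O) (l : ℕ) (i : Dir) : amp S ρ l i ∈ vanish O := by
  cases i with
  | none => exact neg_mem (Ideal.mul_mem_right _ _ hρ)
  | some i => exact smul_mem_vanish _ (Ideal.mul_mem_right _ _ hρ)

/-- The amplitudes produce the stress `-S` up to a multiple of the identity. -/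
theorem sum_amp_mul (hS : ∀ i j q, |S i j q| ≤ 1) (hsymm : ∀ i j, S (some i) j = S (some j) i)
    (hρ : ∀ i j, ρ * (ρ * S i j) = S i j) (i : Dir) (j : Fin 3) :
    ∑ l ∈ Finset.range 6, amp S ρ l i * amp S ρ l (some j) =
      (if i = some j then (9 : ℝ) • (ρ * ρ) else 0) - S i j := by
  have hsq : ∀ l, (comp root contDiff_root (ampSq S l)) * comp root contDiff_root (ampSq S l) =
      ampSq S l := fun l => by
    ext q
    rw [mul_apply, comp_apply]
    exact root_mul_self (abs_ampSq_le hS l q).1 (abs_ampSq_le hS l q).2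
  have hinv : ∀ l, comp (fun x => (root x)⁻¹) contDiff_inv_root (ampSq S l) *
      comp root contDiff_root (ampSq S l) = 1 := fun l => by
    ext q
    rw [mul_apply, comp_apply, comp_apply, one_apply]
    exact inv_mul_cancel₀ (root_pos _).ne'
  rw [← hρ i j]
  cases i with
  | none =>
    have h : ∀ l, amp S ρ l none * amp S ρ l (some j) =
        -(ρ * (ρ * ((ampDir l j : ℝ) • ampLin S l))) := fun l => by
      have := hinv l
      simp only [amp, mul_smul_comm]
      rw [← smul_neg]
      congr 1
      linear_combination (-(ρ * ρ * ampLin S l)) * this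
    simp only [h, reduceCtorEq, if_false, zero_sub, Finset.sum_neg_distrib, ← Finset.mul_sum]
    congr 3
    simp only [Finset.sum_range_succ, Finset.sum_range_zero, ampLin]
    ext q
    fin_cases j <;> simp [ampDir] <;> ring
  | some i =>
    have h : ∀ l, amp S ρ l (some i) * amp S ρ l (some j) =
        ρ * (ρ * ((ampDir l i * ampDir l j : ℝ) • ampSq S l)) := fun l => by
      have := hsq l
      simp only [amp, mul_smul_comm, smul_mul_assoc, smul_smul]
      congr 1
      · ring
      · linear_combination (ρ * ρ) * this
    have e : (if (some i : Dir) = some j then (9 : ℝ) • (ρ * ρ) else 0) =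
        ρ * (ρ * (if i = j then algebraMap ℝ SPF 9 else 0)) := by
      by_cases hij : i = j
      · rw [if_pos hij, if_pos (by rw [hij]), Algebra.smul_def]
        ring
      · rw [if_neg hij, if_neg (by simpa using hij)]
        ring
    simp only [h, e, ← mul_sub, ← Finset.mul_sum]
    congr 2
    simp only [Finset.sum_range_succ, Finset.sum_range_zero, ampSq]
    have e1 := hsymm 1 0
    have e2 := hsymm 2 0
    have e3 := hsymm 2 1
    ext q
    fin_cases i <;> fin_cases j <;> simp [ampDir, e1, e2, e3] <;> ring

end Amplitude

/-- Existence of amplitudes compensating a given normalized stress. -/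
theorem exists_amplitude (N : ℕ) : ∃ C : ℝ, 1 ≤ C ∧ ∀ (κ a b : ℝ), 0 < κ → ∀ (w s : Dir → ℝ),
    (∀ d, κ⁻¹ ≤ s d) → (∀ d, C * s d ≤ w d) → ∀ S : Dir → Fin 3 → SPF,
    (∀ i j, Lip w s N 1 (S i j)) → (∀ i j, S (some i) j = S (some j) i) →
    (∀ i j q, q.1 ≤ a - κ / 4 ∨ b ≤ q.1 → S i j q = 0) →
    ∃ B : ℕ → Dir → SPF, (∀ l i q, |B l i q| ≤ 2) ∧
      (∀ l i d, Bd1 w N (C * s d) (pd d (B l i))) ∧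
      (∀ l, ∑ j, (waveDir l j : ℝ) • B l (some j) = 0) ∧ (∀ l, 3 ≤ l → B l none = 0) ∧
      (∀ l i, B l i ∈ vanish {t | t < a - κ / 2 ∨ b + κ / 2 < t}) ∧
      ∀ i, ∑ j, pd (some j) (∑ l ∈ Finset.range 6, B l i * B l (some j)) =
        -∑ j, pd (some j) (S i j) := by
  obtain ⟨K, hK, H⟩ := exists_profile_bound (N + 1)
  have hK0 : 0 ≤ K := by linarith
  have hc : 0 ≤ compConst N := zero_le_one.trans (one_le_compConst N)
  set P := flatConst N K with hP
  have hP0 : 0 ≤ P := by rw [hP, flatConst]; positivity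
  set Q := 2 * 2 ^ N * (P * P) with hQ
  have hQ0 : 0 ≤ Q := by positivity
  set C1 := 2 * 2 ^ N * (Q * P) with hC1
  set C2 := 2 * 2 ^ N * (Q * (2 * 2 ^ N * (2 * P))) with hC2
  have hC1' : 0 ≤ C1 := by positivity
  have hC2' : 0 ≤ C2 := by positivity
  refine ⟨4 + C1 + C2, by linarith, fun κ a b hκ w s hs hw S hS hsymm hzero => ?_⟩
  have hs0 : ∀ d, 0 ≤ s d := fun d => (inv_pos.2 hκ).le.trans (hs d)
  have hw4 : ∀ d, 4 * s d ≤ w d := fun d => (mul_le_mul_of_nonneg_right (by linarith)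
    (hs0 d)).trans (hw d)
  have hw1 : ∀ d, s d ≤ w d := fun d => by linarith [hs0 d, hw4 d]
  have hρ : Lip w s N Q (cutoff κ a b) := lip_cutoff hκ hs hw4 fun j hj x => (H j hj x).1
  have hq := fun l => lip_ampSq hs0 hw1 hS l
  have hF := fun l => lip_comp hs0 hw1 contDiff_root (fun j hj x => (H j hj x).2.1) hw4
    (by norm_num) (hq l).pd
  have hG := fun l => lip_comp hs0 hw1 contDiff_inv_root (fun j hj x => (H j hj x).2.2) hw4
    (by norm_num) (hq l).pd
  have hS1 : ∀ i j q, |S i j q| ≤ 1 := fun i j q => (hS i j).abs_le q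
  refine ⟨amp S (cutoff κ a b), abs_amp_le hS1 abs_cutoff_le, fun l i => ?_, amp_orth,
    fun l hl => amp_temp hl, amp_mem (cutoff_mem hκ), fun i => ?_⟩
  · refine Lip.pd ?_
    cases i with
    | none =>
      have := (hρ.mul hs0 hw1 ((lip_ampLin hs0 hw1 hS l).mul hs0 hw1 (hG l))).smul (c := -1)
        (c' := 1) (by norm_num)
      rw [neg_one_smul] at this
      exact this.mono hs0 hw1 (by rw [one_mul]; change C2 ≤ _; linarith)
    | some i =>
      refine ((hρ.mul hs0 hw1 (hF l)).smul (ampDir_abs_le l i)).mono hs0 hw1 ?_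
      rw [one_mul]
      change C1 ≤ _
      linarith
  · have hρS : ∀ i j, cutoff κ a b * (cutoff κ a b * S i j) = S i j := fun i j => by
      ext q
      rw [mul_apply, mul_apply]
      by_cases h : q.1 ≤ a - κ / 4 ∨ b ≤ q.1
      · rw [hzero i j q h, mul_zero, mul_zero]
      · push Not at h
        rw [cutoff_eq_one hκ h.1.le h.2.le, one_mul, one_mul]
    simp only [sum_amp_mul hS1 hsymm hρS, map_sub, Finset.sum_sub_distrib]
    rw [Finset.sum_eq_zero, zero_sub]
    intro j _
    split_ifs
    · rw [Derivation.map_smul, pd_mul, pd_cutoff, zero_mul, mul_zero, add_zero, smul_zero]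
    · exact map_zero _

/-- A solution `U` of the equations with stress `S`, and size parameters. -/
structure Input (V : ℝ) where
  δ : ℝ
  κ : ℝ
  Λ : ℝ
  Z : ℝ
  a : ℝ
  b : ℝ
  U : Dir → SPF
  S : Dir → Fin 3 → SPF
  δ_pos : 0 < δ
  κ_pos : 0 < κ
  κ_le : κ ≤ 1
  δ_le : δ ≤ κ * √κ
  Z_ge : 1 ≤ Z
  Z_le : Z ≤ Λ
  U_le : ∀ (j : Fin 3) q, |U (some j) q| ≤ V
  pd_U : ∀ d i q, |pd d (U i) q| ≤ scale Λ Z d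
  S_le : ∀ i j q, |S i j q| ≤ κ
  pd_S : ∀ d i j q, |pd d (S i j) q| ≤ scale Λ Z d
  symm : ∀ i j, S (some i) j = S (some j) i
  zero : ∀ i j q, q.1 ≤ a ∨ b ≤ q.1 → S i j q = 0

/-- Sizes of the derivatives along an iteration. -/
def lamSeq (Γ κ Λ : ℝ) (lam : ℕ → ℕ) : ℕ → ℝ
  | 0 => Λ
  | l + 1 => Γ * (√κ * lam l)

/-- Sizes of the `z`-derivatives along an iteration. -/
def zSeq (Γ κ δ Z : ℝ) : ℕ → ℝ
  | 0 => Z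
  | l + 1 => Γ * (κ / δ * zSeq Γ κ δ Z l)

def xSeq (Γ κ δ Λ Z : ℝ) (lam : ℕ → ℕ) (l : ℕ) : ℝ :=
  κ * lamSeq Γ κ Λ lam l / δ ^ 2 + κ * zSeq Γ κ δ Z l ^ 2 / δ ^ 3

theorem Data.Λs_eq {V M₀ c : ℝ} {k : ℕ → Fin 3 → ℤ} (D : Data V M₀ c k) (Γ : ℝ) (lam : ℕ → ℕ) :
    D.Λs Γ lam = lamSeq Γ D.κ D.Λ lam := by
  funext l
  cases l <;> rfl

theorem Data.Zs_eq {V M₀ c : ℝ} {k : ℕ → Fin 3 → ℤ} (D : Data V M₀ c k) (Γ : ℝ) :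
    D.Zs Γ = zSeq Γ D.κ D.δ D.Z := by
  funext l
  induction l with
  | zero => rfl
  | succ l ih => rw [Data.Zs, zSeq, ih]

namespace Input

variable {V : ℝ} (I : Input V)

def sc (d : Dir) : ℝ := scale I.Λ I.Z d

theorem sc_ge (d : Dir) : 1 ≤ I.sc d := I.Z_ge.trans (le_scale I.Z_le d)
theorem sc_pos (d : Dir) : 0 < I.sc d := zero_lt_one.trans_le (I.sc_ge d)
theorem sqrt_pos : 0 < √I.κ := Real.sqrt_pos.2 I.κ_pos
theorem sqrt_le : √I.κ ≤ 1 := Real.sqrt_le_one.2 I.κ_le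
theorem δ_le_κ : I.δ ≤ I.κ := I.δ_le.trans (mul_le_of_le_one_right I.κ_pos.le I.sqrt_le)

/-- The averaging lengths. -/
def len (N : ℕ) (d : Dir) : ℝ := (2000 * ((N : ℝ) + 1))⁻¹ * I.δ / I.sc d

theorem len_pos (N : ℕ) (d : Dir) : 0 < I.len N d :=
  div_pos (mul_pos (by positivity) I.δ_pos) (I.sc_pos d)

theorem sub_mol_le (N : ℕ) {g : SPF} (hg : ∀ d q, |pd d g q| ≤ I.sc d) (q : SpaceTime) :
    |g q - mol (I.len N) N g q| ≤ I.δ / 500 := by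
  rw [abs_sub_comm]
  have hc : (0 : ℝ) < 2000 * (N + 1) := by positivity
  refine (mol_sub_abs_le (I.len_pos N) (E := (2000 * ((N : ℝ) + 1))⁻¹ * I.δ) N
    (fun d q => (hg d q).trans (le_of_eq ?_)) q).trans ?_
  · have := I.sc_pos d
    have := I.δ_pos
    rw [len]
    field_simp
  · have h1 : (N : ℝ) * (2000 * ((N : ℝ) + 1))⁻¹ ≤ 1 / 2000 := by
      rw [← div_eq_mul_inv, div_le_div_iff₀ hc (by norm_num)]
      linarith
    nlinarith [mul_le_mul_of_nonneg_right h1 I.δ_pos.le]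

theorem mol_zero (N : ℕ) {g : SPF} (hg : ∀ q, q.1 ≤ I.a ∨ I.b ≤ q.1 → g q = 0) (q : SpaceTime)
    (hq : q.1 ≤ I.a - I.κ / 4 ∨ I.b ≤ q.1) : mol (I.len N) N g q = 0 := by
  refine mol_eq_zero (I.len_pos N) N hg q (hq.imp_left fun h => h.trans ?_)
  have hc : (0 : ℝ) < 2000 * (N + 1) := by positivity
  have h1 : (N : ℝ) * (2000 * ((N : ℝ) + 1))⁻¹ ≤ 1 / 2000 := by
    rw [← div_eq_mul_inv, div_le_div_iff₀ hc (by norm_num)]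
    linarith
  have h2 : (N : ℝ) * I.len N none ≤ N * ((2000 * ((N : ℝ) + 1))⁻¹ * I.δ) := by
    refine mul_le_mul_of_nonneg_left ?_ N.cast_nonneg
    exact div_le_self (mul_nonneg (inv_pos.2 hc).le I.δ_pos.le) (I.sc_ge none)
  nlinarith [mul_le_mul_of_nonneg_right h1 I.δ_pos.le, I.δ_le_κ, I.κ_pos]

/-- Frequencies of the averaged fields. -/
def w (Γ : ℝ) (d : Dir) : ℝ := scale (Γ * I.Λ) (Γ * I.Z) d / I.δ

theorem scale_mul (Γ : ℝ) (d : Dir) : scale (Γ * I.Λ) (Γ * I.Z) d = Γ * I.sc d := by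
  unfold sc scale; split_ifs <;> rfl

theorem bd1_mol {N : ℕ} {Γ : ℝ} (hΓ : 4000 * (N + 1) ≤ Γ) {g : SPF} {A : ℝ}
    (hg : ∀ q, |g q| ≤ A) : Bd1 (I.w Γ) N A (mol (I.len N) N g) := by
  refine (SPF.bd1_mol (I.len_pos N) N hg).mono (fun d => (div_pos two_pos (I.len_pos N d)).le)
    (fun d => ?_) le_rfl le_rfl
  have hs := I.sc_pos d
  have hδ := I.δ_pos
  have e : 2 / I.len N d = 4000 * (N + 1) * I.sc d / I.δ := by
    rw [len]; field_simp; norm_num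
  rw [e, w, scale_mul]
  gcongr

/-- The data of the iteration associated to amplitudes `B`. -/
def data {N : ℕ} {Γ : ℝ} (hΓ : 2 ≤ Γ) {B : ℕ → Dir → SPF} (hB : ∀ l i q, |B l i q| ≤ 2)
    (ho : ∀ l, ∑ j, (waveDir l j : ℝ) • B l (some j) = 0)
    (hm : ∀ l i, B l i ∈ vanish {t | t < I.a - I.κ / 2 ∨ I.b + I.κ / 2 < t}) :
    Data V 2 (1 / 12) waveDir where
  δ := I.δ
  κ := I.κ
  Λ := Γ * I.Λ
  Z := Γ * I.Z
  O := {t | t < I.a - I.κ / 2 ∨ I.b + I.κ / 2 < t}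
  u := fun i => mol (I.len N) N (I.U i)
  e := fun i => I.U i - mol (I.len N) N (I.U i)
  A := fun l i => √I.κ • B l i
  δ_pos := I.δ_pos
  κ_pos := I.κ_pos
  κ_le := I.κ_le
  δ_le := I.δ_le
  Z_ge := one_le_mul_of_one_le_of_one_le (by linarith) I.Z_ge
  Z_le := mul_le_mul_of_nonneg_left I.Z_le (by linarith)
  isOpen := (isOpen_Iio (a := I.a - I.κ / 2)).union (isOpen_Ioi (a := I.b + I.κ / 2))
  u_le := fun j q => mol_abs_le (I.len_pos N) N (I.U_le j) q
  e_le := fun i q => (I.sub_mol_le N (fun d => I.pd_U d i) q).trans (by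
    have := I.δ_pos
    norm_num
    linarith)
  pd_e := fun d i q => by
    rw [map_sub, pd_mol, sub_apply, scale_mul]
    have h1 := I.pd_U d i
    have h2 := mol_abs_le (I.len_pos N) N h1 q
    have h3 := (abs_sub _ _).trans (add_le_add (h1 q) h2)
    have : 2 * I.sc d ≤ Γ * I.sc d := mul_le_mul_of_nonneg_right hΓ (I.sc_pos d).le
    change _ ≤ I.sc d + I.sc d at h3
    linarith
  A_le := fun l i q => by
    rw [smul_apply, abs_mul, abs_of_pos I.sqrt_pos, mul_comm]
    exact mul_le_mul_of_nonneg_right (hB l i q) I.sqrt_pos.le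
  orth := fun l => by
    simp only [smul_comm _ (√I.κ), ← Finset.smul_sum]
    rw [ho l, smul_zero]
  A_mem := fun l i => smul_mem_vanish _ (hm l i)

theorem smooth_data {N : ℕ} {Γ C : ℝ} (hΓ : 2 ≤ Γ) {B : ℕ → Dir → SPF}
    (hB : ∀ l i q, |B l i q| ≤ 2)
    (ho : ∀ l, ∑ j, (waveDir l j : ℝ) • B l (some j) = 0)
    (hm : ∀ l i, B l i ∈ vanish {t | t < I.a - I.κ / 2 ∨ I.b + I.κ / 2 < t})
    (hΓN : 4000 * (N + 1) ≤ Γ) (hC : 0 ≤ C) (hΓC : C ≤ Γ)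
    (hd : ∀ l i d, Bd1 (I.w Γ) N (C * (I.sc d / I.κ)) (pd d (B l i))) :
    (I.data (N := N) hΓ hB ho hm).Smooth N := by
  have hw : ∀ d, 0 ≤ I.w Γ d := (I.data (N := N) hΓ hB ho hm).w_nonneg
  refine ⟨fun d i => ?_, fun l d i => ?_⟩
  · change Bd1 (I.w Γ) N (scale (Γ * I.Λ) (Γ * I.Z) d) (pd d (mol (I.len N) N (I.U i)))
    rw [pd_mol]
    refine (I.bd1_mol hΓN (I.pd_U d i)).mono_right hw ?_
    rw [scale_mul]
    exact le_mul_of_one_le_left (I.sc_pos d).le (by linarith)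
  · change Bd1 (I.w Γ) N (I.κ / I.δ * scale (Γ * I.Λ) (Γ * I.Z) d) (pd d (√I.κ • B l i))
    rw [Derivation.map_smul, scale_mul]
    refine (Bd.smul (hd l i d) (r := fun _ => √I.κ) I.sqrt_pos.le
      fun _ => (abs_of_pos I.sqrt_pos).le).mono_right hw ?_
    have hκ := I.κ_pos
    have hδ := I.δ_pos
    have hs := I.sc_pos d
    have h1 : √I.κ / I.κ ≤ I.κ / I.δ := by
      rw [div_le_div_iff₀ hκ hδ]
      have h2 := mul_le_mul_of_nonneg_left I.δ_le I.sqrt_pos.le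
      have h3 := Real.mul_self_sqrt hκ.le
      calc √I.κ * I.δ ≤ √I.κ * (I.κ * √I.κ) := h2
        _ = I.κ * (√I.κ * √I.κ) := by ring
        _ = _ := by rw [h3]
    calc √I.κ * (C * (I.sc d / I.κ)) = √I.κ / I.κ * (C * I.sc d) := by ring
      _ ≤ I.κ / I.δ * (Γ * I.sc d) := by gcongr

/-- The result of the whole iteration, before the choice of frequencies. -/
structure Output (Γ : ℝ) (lam : ℕ → ℕ) (W : Dir → SPF) (S' : Dir → Fin 3 → SPF) : Prop where
  div : ∑ j, pd (some j) (W (some j)) = 0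
  mem : ∀ i, W i ∈ vanish {t | t < I.a - I.κ / 2 ∨ I.b + I.κ / 2 < t}
  mem' : ∀ i j, S' i j ∈ vanish {t | t < I.a - I.κ / 2 ∨ I.b + I.κ / 2 < t}
  symm : ∀ i j, S' (some i) j = S' (some j) i
  abs_le : ∀ i q, |W i q| ≤ 42 * √I.κ
  abs_le' : ∀ i j q, |S' i j q| ≤ I.δ
  pd_le : ∀ d i q, |pd d (I.U i + W i) q| ≤
    2 * scale (lamSeq Γ I.κ (Γ * I.Λ) lam 6) (zSeq Γ I.κ I.δ (Γ * I.Z) 6) d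
  pd_le' : ∀ d i j q, |pd d (S' i j) q| ≤
    8 * scale (lamSeq Γ I.κ (Γ * I.Λ) lam 6) (zSeq Γ I.κ I.δ (Γ * I.Z) 6) d
  temp : ∀ d q, |pd d (I.U none + W none) q| ≤
    scale (lamSeq Γ I.κ (Γ * I.Λ) lam 3) (zSeq Γ I.κ I.δ (Γ * I.Z) 3) d + Γ * I.sc d
  eq : ∀ i, NL (fun i => I.U i + W i) i = NL I.U i - ∑ j, pd (some j) (I.S i j) +
    ∑ j, pd (some j) (S' i j)

end Input

theorem exists_output (V : ℝ) (J : ℕ) : ∃ Γ : ℝ, 2 ≤ Γ ∧ ∀ (I : Input V) (lam : ℕ → ℕ),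
    (∀ l < 6, Γ * xSeq Γ I.κ I.δ (Γ * I.Λ) (Γ * I.Z) lam l ≤ lam l ∧
      Γ * xSeq Γ I.κ I.δ (Γ * I.Λ) (Γ * I.Z) lam l ^ J * lam l ^ 2 ≤ (lam l : ℝ) ^ J) →
    ∃ W S', I.Output Γ lam W S' := by
  obtain ⟨N, Γ₀, hΓ₀, H⟩ := Data.exists_chain (M₀ := 2) (c := 1 / 12) horizontal_waveDir V
    (by norm_num) (by norm_num) (by norm_num) J 6 0
  obtain ⟨C, hC, HA⟩ := exists_amplitude N
  have hNp : (0 : ℝ) ≤ N := N.cast_nonneg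
  refine ⟨Γ₀ + C + 4000 * (N + 1), by linarith, fun I lam hlam => ?_⟩
  set Γ := Γ₀ + C + 4000 * ((N : ℝ) + 1) with hΓdef
  have hΓ : 2 ≤ Γ := by linarith
  have hΓN : 4000 * ((N : ℝ) + 1) ≤ Γ := by linarith
  have hκ := I.κ_pos
  have hδ := I.δ_pos
  have hs := I.sc_pos
  set Sm : Dir → Fin 3 → SPF := fun i j => mol (I.len N) N (I.S i j) with hSm
  obtain ⟨B, hB, hd, ho, ht, hm, hsum⟩ := HA I.κ I.a I.b hκ (I.w Γ) (fun d => I.sc d / I.κ)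
    (fun d => by
      rw [inv_eq_one_div]
      exact div_le_div_of_nonneg_right (I.sc_ge d) hκ.le)
    (fun d => by
      rw [Input.w, I.scale_mul, mul_div_assoc]
      have := hs d
      have := I.δ_le_κ
      have : C ≤ Γ := by linarith
      gcongr)
    (fun i j => I.κ⁻¹ • Sm i j)
    (fun i j => ⟨fun q => by
      rw [smul_apply, abs_mul, abs_of_pos (inv_pos.2 hκ)]
      have := mol_abs_le (I.len_pos N) N (I.S_le i j) q
      calc I.κ⁻¹ * |Sm i j q| ≤ I.κ⁻¹ * I.κ := by gcongr
        _ = 1 := inv_mul_cancel₀ hκ.ne', fun d => by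
      rw [Derivation.map_smul, pd_mol]
      refine (Bd.smul (I.bd1_mol hΓN (I.pd_S d i j)) (r := fun _ => I.κ⁻¹) (inv_pos.2 hκ).le
        fun _ => (abs_of_pos (inv_pos.2 hκ)).le).mono_right
        (fun d => by
          rw [Input.w, I.scale_mul]
          have := hs d
          positivity)
        (le_of_eq ?_)
      rw [one_mul, div_eq_inv_mul]
      rfl⟩)
    (fun i j => by simp only [hSm, I.symm i j])
    (fun i j q hq => by rw [smul_apply, I.mol_zero N (I.zero i j) q hq, mul_zero])
  have hsm := I.smooth_data hΓ hB ho hm hΓN (by linarith) (by linarith) fun l i d => hd l i d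
  set D := I.data (N := N) hΓ hB ho hm with hD
  have eΛ : D.Λs Γ lam = lamSeq Γ I.κ (Γ * I.Λ) lam := D.Λs_eq Γ lam
  have eZ : D.Zs Γ = zSeq Γ I.κ I.δ (Γ * I.Z) := D.Zs_eq Γ
  obtain ⟨W, T, h⟩ := H Γ (by linarith) D hsm lam (by
    intro l hl
    have := hlam l hl
    rw [xSeq, ← eΛ, ← eZ] at this
    exact this)
  have hsc : ∀ n d, D.sc Γ lam n d =
      scale (lamSeq Γ I.κ (Γ * I.Λ) lam n) (zSeq Γ I.κ I.δ (Γ * I.Z) n) d := fun n d => by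
    rw [Data.sc, eΛ, eZ]
  have hsc0 : ∀ d, D.sc Γ lam 0 d = Γ * I.sc d := fun d => I.scale_mul Γ d
  have hle : ∀ d, Γ * I.sc d ≤ D.sc Γ lam 6 d := fun d => by
    rw [← hsc0]
    exact h.sc_le d
  have hscΓ : ∀ d, I.sc d ≤ Γ * I.sc d := fun d =>
    le_mul_of_one_le_left (hs d).le (by linarith)
  have hUe : ∀ i, D.u i + D.e i = I.U i := fun i => by
    change mol (I.len N) N (I.U i) + (I.U i - mol (I.len N) N (I.U i)) = _
    ring
  have hUW : ∀ i, I.U i + W i = D.u i + W i + D.e i := fun i => by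
    rw [← hUe]
    ring
  have hpe : ∀ d i q, |pd d (D.e i) q| ≤ Γ * I.sc d := fun d i q => by
    rw [← I.scale_mul]
    exact D.pd_e d i q
  refine ⟨W, fun i j => I.S i j - Sm i j + T i j, h.div, h.mem, fun i j => ?_, fun i j => ?_,
    fun i q => ?_, fun i j q => ?_, fun d i q => ?_, fun d i j q => ?_, fun d q => ?_, fun i => ?_⟩
  · refine add_mem (sub_mem ?_ ?_) (h.mem' i j)
    · rintro q (hq | hq)
      · exact I.zero i j q (Or.inl (by linarith))
      · exact I.zero i j q (Or.inr (by linarith))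
    · rintro q (hq | hq)
      · exact I.mol_zero N (I.zero i j) q (Or.inl (by linarith))
      · exact I.mol_zero N (I.zero i j) q (Or.inr (by linarith))
  · simp only [hSm, I.symm i j, h.symm i j]
  · refine (h.abs_le i q).trans (le_of_eq ?_)
    change ((6 : ℕ) : ℝ) * ((3 * 2 + 1) * √I.κ) = _
    push_cast
    ring
  · have h1 := I.sub_mol_le N (fun d => I.pd_S d i j) q
    have h2 := h.abs_le' i j q
    change _ ≤ ((6 : ℕ) : ℝ) * (1 / 12 * I.δ) at h2
    push_cast at h2
    refine (abs_add_le _ _).trans ?_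
    rw [sub_apply]
    linarith
  · rw [hUW, map_add, ← hsc]
    refine (abs_add_le _ _).trans ?_
    have h1 := (h.pd_le d i).abs_le () q
    have h2 := hpe d i q
    have h3 := hle d
    linarith
  · rw [map_add, map_sub, ← hsc, pd_mol]
    refine (abs_add_le _ _).trans ?_
    rw [sub_apply]
    have h0 := abs_sub (pd d (I.S i j) q) (mol (I.len N) N (pd d (I.S i j)) q)
    have h1 := I.pd_S d i j q
    have h2 := mol_abs_le (I.len_pos N) N (I.pd_S d i j) q
    have h3 := h.pd_le' d i j q
    have h4 := hle d
    have h5 := hscΓ d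
    push_cast at h3
    change _ ≤ I.sc d at h1
    change _ ≤ I.sc d at h2
    linarith
  · rw [hUW, map_add, ← hsc]
    refine (abs_add_le _ _).trans (add_le_add ?_ (hpe d none q))
    exact h.temp 3 (by norm_num) (fun l hl => by
      change √I.κ • B l none = 0
      rw [ht l hl, smul_zero]) d q
  · have h1 := h.eq i
    simp only [hUe] at h1
    rw [h1]
    have h2 : ∑ j, pd (some j) (∑ l ∈ Finset.range 6, D.A l i * D.A l (some j)) =
        -∑ j, pd (some j) (Sm i j) := by
      have e : ∀ j, ∑ l ∈ Finset.range 6, D.A l i * D.A l (some j) =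
          I.κ • ∑ l ∈ Finset.range 6, B l i * B l (some j) := fun j => by
        rw [Finset.smul_sum]
        refine Finset.sum_congr rfl fun l _ => ?_
        change (√I.κ • B l i) * (√I.κ • B l (some j)) = _
        rw [smul_mul_smul_comm, Real.mul_self_sqrt hκ.le]
      have := hsum i
      simp only [e, Derivation.map_smul, ← Finset.smul_sum] at this ⊢
      rw [this, smul_neg, smul_smul, mul_inv_cancel₀ hκ.ne', one_smul]
    simp only [map_add, map_sub, Finset.sum_add_distrib, Finset.sum_sub_distrib] at h2 ⊢
    rw [h2]
    ring

/-- The amplitudes produced when each frequency is a slightly superlinear function of the ratio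
`xSeq` available at that stage. -/
def ampSeq (Γ κ δ Λ Z e : ℝ) : ℕ → ℝ
  | 0 => Λ
  | l + 1 => Γ * (√κ * (⌈Γ * (κ * ampSeq Γ κ δ Λ Z e l / δ ^ 2 +
      κ * zSeq Γ κ δ Z l ^ 2 / δ ^ 3) ^ (1 + e)⌉₊ : ℝ))

/-- The frequencies belonging to `ampSeq`. -/
def freqSeq (Γ κ δ Λ Z e : ℝ) (l : ℕ) : ℕ :=
  ⌈Γ * (κ * ampSeq Γ κ δ Λ Z e l / δ ^ 2 + κ * zSeq Γ κ δ Z l ^ 2 / δ ^ 3) ^ (1 + e)⌉₊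

theorem lamSeq_freqSeq (Γ κ δ Λ Z e : ℝ) (l : ℕ) :
    lamSeq Γ κ Λ (freqSeq Γ κ δ Λ Z e) l = ampSeq Γ κ δ Λ Z e l := by
  induction l with
  | zero => rfl
  | succ l ih => rw [lamSeq, ampSeq, freqSeq]

theorem freqSeq_eq (Γ κ δ Λ Z e : ℝ) (l : ℕ) :
    freqSeq Γ κ δ Λ Z e l =
      ⌈Γ * xSeq Γ κ δ Λ Z (freqSeq Γ κ δ Λ Z e) l ^ (1 + e)⌉₊ := by
  rw [xSeq, lamSeq_freqSeq, freqSeq]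

theorem zSeq_eq (Γ κ δ Z : ℝ) (l : ℕ) : zSeq Γ κ δ Z l = (Γ * (κ / δ)) ^ l * Z := by
  induction l with
  | zero => simp [zSeq]
  | succ l ih => rw [zSeq, ih]; ring

/-- The ceiling of `Γ * X ^ (1 + e)` beats `X` by any fixed factor and by a power. -/
theorem ceil_rpow_bounds {Γ X e : ℝ} {J : ℕ} (hΓ : 1 ≤ Γ) (hX : 1 ≤ X) (he : 0 < e)
    (hJ : 3 ≤ J) (hJe : 2 * (1 + e) ≤ J * e) :
    Γ * X ≤ (⌈Γ * X ^ (1 + e)⌉₊ : ℝ) ∧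
      Γ * X ^ J * (⌈Γ * X ^ (1 + e)⌉₊ : ℝ) ^ 2 ≤ (⌈Γ * X ^ (1 + e)⌉₊ : ℝ) ^ J := by
  set n : ℝ := (⌈Γ * X ^ (1 + e)⌉₊ : ℝ)
  have hn : Γ * X ^ (1 + e) ≤ n := Nat.le_ceil _
  have hX0 : 0 < X := by linarith
  have h1 : X ≤ X ^ (1 + e) := Real.self_le_rpow_of_one_le hX (by linarith)
  refine ⟨le_trans (by gcongr) hn, ?_⟩
  obtain ⟨m, rfl⟩ : ∃ m, J = m + 2 := ⟨J - 2, by omega⟩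
  rw [pow_add n m 2]
  gcongr
  calc Γ * X ^ (m + 2) ≤ Γ ^ m * (X ^ (1 + e)) ^ m := by
        gcongr
        · exact le_self_pow₀ hΓ (by omega)
        · rw [← Real.rpow_natCast, ← Real.rpow_natCast, ← Real.rpow_mul hX0.le]
          apply Real.rpow_le_rpow_of_exponent_le hX
          push_cast at hJe ⊢
          nlinarith
    _ = (Γ * X ^ (1 + e)) ^ m := by rw [mul_pow]
    _ ≤ n ^ m := by gcongr

theorem ceil_rpow_le {Γ X e : ℝ} (hΓ : 1 ≤ Γ) (hX : 1 ≤ X) (he : 0 < e) :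
    (⌈Γ * X ^ (1 + e)⌉₊ : ℝ) ≤ 2 * Γ * X ^ (1 + e) := by
  have h1 : 1 ≤ X ^ (1 + e) := Real.one_le_rpow hX (by linarith)
  have := Nat.ceil_lt_add_one (show 0 ≤ Γ * X ^ (1 + e) by positivity)
  nlinarith

theorem rpow_add_le {g h e : ℝ} (hg : 0 ≤ g) (hh : 0 ≤ h) (he : 0 ≤ e) (he1 : e ≤ 1) :
    (g + h) ^ (1 + e) ≤ 4 * (g ^ (1 + e) + h ^ (1 + e)) := by
  have key : ∀ x y : ℝ, 0 ≤ x → 0 ≤ y → x ≤ y → (x + y) ^ (1 + e) ≤ 4 * y ^ (1 + e) := by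
    intro x y hx hy hxy
    calc (x + y) ^ (1 + e) ≤ (2 * y) ^ (1 + e) :=
          Real.rpow_le_rpow (by positivity) (by linarith) (by linarith)
      _ = 2 ^ (1 + e) * y ^ (1 + e) := Real.mul_rpow (by norm_num) hy
      _ ≤ 4 * y ^ (1 + e) := by
          gcongr
          calc (2 : ℝ) ^ (1 + e) ≤ 2 ^ (2 : ℝ) :=
                Real.rpow_le_rpow_of_exponent_le (by norm_num) (by linarith)
            _ = 4 := by norm_num
  have h1 := Real.rpow_nonneg hg (1 + e)
  have h2 := Real.rpow_nonneg hh (1 + e)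
  rcases le_total g h with hgh | hgh
  · linarith [key g h hg hh hgh]
  · have := key h g hh hg hgh
    rw [add_comm h g] at this
    linarith

theorem rpow_one_add_le {g u e : ℝ} (hg : 0 < g) (hu : 1 ≤ u) (he : 0 ≤ e)
    (h : g ≤ u ^ 20) : g ^ (1 + e) ≤ g * u ^ (20 * e) := by
  rw [Real.rpow_add hg, Real.rpow_one]
  gcongr
  calc g ^ e ≤ (u ^ 20) ^ e := Real.rpow_le_rpow hg.le h he
    _ = u ^ (20 * e) := by
      rw [← Real.rpow_natCast u 20, ← Real.rpow_mul (by linarith)]; norm_num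

/-- The model growth of the amplitudes over `n` stages. -/
def growth (κ δ Λ Z e : ℝ) (n : ℕ) : ℝ :=
  Λ * (κ * √κ / δ ^ 2 * (Λ / δ) ^ (20 * e)) ^ n +
    Z ^ 2 / δ * (κ * √κ / δ ^ 2 * (Z / δ) ^ (20 * e)) ^ n

/-- The standing relations among the parameters of a stage. -/
structure Params (κ δ Λ Z e : ℝ) : Prop where
  δ_pos : 0 < δ
  κ_pos : 0 < κ
  κ_le : κ ≤ 1
  δ_le : δ ≤ κ * √κ
  one_le_Z : 1 ≤ Z
  Z_le : Z ≤ Λ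
  e_pos : 0 < e
  e_le : 20 * e ≤ 1

namespace Params

variable {κ δ Λ Z e : ℝ}

theorem sqrt_pos (h : Params κ δ Λ Z e) : 0 < √κ := Real.sqrt_pos.2 h.κ_pos
theorem sqrt_le (h : Params κ δ Λ Z e) : √κ ≤ 1 := Real.sqrt_le_one.2 h.κ_le
theorem δ_le_κ (h : Params κ δ Λ Z e) : δ ≤ κ :=
  h.δ_le.trans (mul_le_of_le_one_right h.κ_pos.le h.sqrt_le)
theorem δ_le_one (h : Params κ δ Λ Z e) : δ ≤ 1 := h.δ_le_κ.trans h.κ_le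
theorem one_le_Λ (h : Params κ δ Λ Z e) : 1 ≤ Λ := h.one_le_Z.trans h.Z_le

theorem κ_div_le (h : Params κ δ Λ Z e) : κ / δ ≤ κ * √κ / δ ^ 2 := by
  have h1 : δ ≤ √κ := h.δ_le.trans (mul_le_of_le_one_left h.sqrt_pos.le h.κ_le)
  have := h.δ_pos
  have := h.κ_pos
  rw [div_le_div_iff₀ (by positivity) (by positivity)]
  calc κ * δ ^ 2 = κ * δ * δ := by ring
    _ ≤ κ * √κ * δ := by gcongr

theorem κ_div_sq_le (h : Params κ δ Λ Z e) : (κ / δ) ^ 2 ≤ κ * √κ / δ ^ 2 := by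
  have h1 : κ ≤ √κ := Real.le_sqrt_of_sq_le (by nlinarith [h.κ_pos, h.κ_le])
  have := h.δ_pos
  have := h.κ_pos
  rw [div_pow, sq κ]
  gcongr

theorem one_le_κ_div (h : Params κ δ Λ Z e) : 1 ≤ κ / δ := (one_le_div h.δ_pos).2 h.δ_le_κ

theorem one_le_ratio (h : Params κ δ Λ Z e) : 1 ≤ κ * √κ / δ ^ 2 :=
  h.one_le_κ_div.trans h.κ_div_le

theorem ratio_le (h : Params κ δ Λ Z e) {x : ℝ} (hx : 1 ≤ x) : κ * √κ / δ ^ 2 ≤ (x / δ) ^ 2 := by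
  have := h.δ_pos
  rw [div_pow]
  gcongr
  nlinarith [h.κ_pos, h.κ_le, h.sqrt_pos, h.sqrt_le]

theorem one_le_div_δ (h : Params κ δ Λ Z e) {x : ℝ} (hx : 1 ≤ x) : 1 ≤ x / δ :=
  (one_le_div h.δ_pos).2 (h.δ_le_one.trans hx)

theorem one_le_rpow (h : Params κ δ Λ Z e) {x : ℝ} (hx : 1 ≤ x) : 1 ≤ (x / δ) ^ (20 * e) :=
  Real.one_le_rpow (h.one_le_div_δ hx) (by linarith [h.e_pos])

theorem rpow_le (h : Params κ δ Λ Z e) {x : ℝ} (hx : 1 ≤ x) : (x / δ) ^ (20 * e) ≤ x / δ :=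
  Real.rpow_le_self_of_one_le (h.one_le_div_δ hx) h.e_le

theorem one_le_rate (h : Params κ δ Λ Z e) {x : ℝ} (hx : 1 ≤ x) :
    1 ≤ κ * √κ / δ ^ 2 * (x / δ) ^ (20 * e) :=
  one_le_mul_of_one_le_of_one_le h.one_le_ratio (h.one_le_rpow hx)

theorem rate_le (h : Params κ δ Λ Z e) {x : ℝ} (hx : 1 ≤ x) :
    κ * √κ / δ ^ 2 * (x / δ) ^ (20 * e) ≤ (x / δ) ^ 3 := by
  have h1 := h.one_le_div_δ hx
  calc _ ≤ (x / δ) ^ 2 * (x / δ) := by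
        gcongr
        · exact h.ratio_le hx
        · exact h.rpow_le hx
    _ = _ := by ring

/-- A model term, times a small power of itself, is controlled by the next model term. -/
theorem rpow_step (h : Params κ δ Λ Z e) {x y : ℝ} (hx : 1 ≤ x) (hy : 0 < y)
    (hyx : κ / δ ^ 2 * y ≤ (x / δ) ^ 3) {n : ℕ} (hn : n ≤ 5) :
    √κ * (κ / δ ^ 2 * (y * (κ * √κ / δ ^ 2 * (x / δ) ^ (20 * e)) ^ n)) ^ (1 + e) ≤
      y * (κ * √κ / δ ^ 2 * (x / δ) ^ (20 * e)) ^ (n + 1) := by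
  have := h.δ_pos
  have := h.κ_pos
  have h0 := h.one_le_div_δ hx
  have h1 := h.one_le_rate hx
  have h2 := h.rate_le hx
  have h3 := h.sqrt_pos
  set ρ := κ * √κ / δ ^ 2 * (x / δ) ^ (20 * e) with hρ
  have hg : κ / δ ^ 2 * (y * ρ ^ n) ≤ (x / δ) ^ 20 :=
    calc κ / δ ^ 2 * (y * ρ ^ n) = κ / δ ^ 2 * y * ρ ^ n := by ring
      _ ≤ (x / δ) ^ 3 * ((x / δ) ^ 3) ^ n := by gcongr
      _ = (x / δ) ^ (3 + 3 * n) := by rw [← pow_mul, ← pow_add]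
      _ ≤ (x / δ) ^ 20 := pow_le_pow_right₀ h0 (by omega)
  calc _ ≤ √κ * (κ / δ ^ 2 * (y * ρ ^ n) * (x / δ) ^ (20 * e)) := by
        gcongr
        exact rpow_one_add_le (by positivity) h0 h.e_pos.le hg
    _ = y * ρ ^ n * (κ * √κ / δ ^ 2 * (x / δ) ^ (20 * e)) := by ring
    _ = _ := by rw [← hρ]; ring

theorem growth_nonneg (h : Params κ δ Λ Z e) (n : ℕ) : 0 ≤ growth κ δ Λ Z e n := by
  have := h.δ_pos
  have := h.one_le_Λ
  have h1 := h.one_le_rate h.one_le_Λ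
  have h2 := h.one_le_rate h.one_le_Z
  rw [growth]
  positivity

theorem le_growth (h : Params κ δ Λ Z e) (n : ℕ) : Λ ≤ growth κ δ Λ Z e n := by
  have := h.δ_pos
  have h0 := h.one_le_Λ
  have h1 := one_le_pow₀ (n := n) (h.one_le_rate h.one_le_Λ)
  have h2 := h.one_le_rate h.one_le_Z
  have : 0 ≤ Z ^ 2 / δ * (κ * √κ / δ ^ 2 * (Z / δ) ^ (20 * e)) ^ n := by positivity
  rw [growth]
  nlinarith

theorem mul_pow_le (h : Params κ δ Λ Z e) (n : ℕ) :
    (κ / δ) ^ n * Z ≤ growth κ δ Λ Z e n := by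
  have := h.δ_pos
  have := h.κ_pos
  have h0 := h.one_le_Λ
  have hr := h.one_le_ratio
  have h1 := h.one_le_rpow h.one_le_Λ
  have h2 := h.one_le_rate h.one_le_Z
  have h3 : 0 ≤ Z ^ 2 / δ * (κ * √κ / δ ^ 2 * (Z / δ) ^ (20 * e)) ^ n := by positivity
  have h4 : (κ / δ) ^ n * Z ≤ (κ * √κ / δ ^ 2 * (Λ / δ) ^ (20 * e)) ^ n * Λ := by
    have h5 : κ / δ ≤ κ * √κ / δ ^ 2 * (Λ / δ) ^ (20 * e) :=
      h.κ_div_le.trans (le_mul_of_one_le_right (by linarith) h1)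
    have := h.Z_le
    have := h.one_le_Z
    have h6 := h.one_le_rate h.one_le_Λ
    generalize κ * √κ / δ ^ 2 * (Λ / δ) ^ (20 * e) = y at *
    have : 0 ≤ y ^ n := by positivity
    gcongr
  rw [growth]
  linarith

theorem one_le_x (h : Params κ δ Λ Z e) {Γ L : ℝ} (hΓ : 1 ≤ Γ) (hL : 0 ≤ L) (n : ℕ) :
    1 ≤ κ * L / δ ^ 2 + κ * zSeq Γ κ δ (Γ * Z) n ^ 2 / δ ^ 3 := by
  have hδ := h.δ_pos
  have hκ := h.κ_pos
  have h1 : 1 ≤ zSeq Γ κ δ (Γ * Z) n := by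
    rw [zSeq_eq]
    exact one_le_mul_of_one_le_of_one_le
      (one_le_pow₀ (one_le_mul_of_one_le_of_one_le hΓ h.one_le_κ_div))
      (one_le_mul_of_one_le_of_one_le hΓ h.one_le_Z)
  have h2 : 1 ≤ κ * zSeq Γ κ δ (Γ * Z) n ^ 2 / δ ^ 3 := by
    rw [one_le_div (by positivity)]
    calc δ ^ 3 ≤ δ := pow_le_of_le_one hδ.le h.δ_le_one (by norm_num)
      _ ≤ κ := h.δ_le_κ
      _ ≤ _ := le_mul_of_one_le_right hκ.le (one_le_pow₀ h1)
  have : 0 ≤ κ * L / δ ^ 2 := by positivity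
  linarith

theorem x_le (h : Params κ δ Λ Z e) {Γ L C : ℝ} (hΓ : 1 ≤ Γ) (n : ℕ)
    (hL : L ≤ C * growth κ δ Λ Z e n) :
    κ * L / δ ^ 2 + κ * zSeq Γ κ δ (Γ * Z) n ^ 2 / δ ^ 3 ≤
      (C + Γ ^ (2 * n + 2)) * (κ / δ ^ 2 * growth κ δ Λ Z e n) := by
  have hδ := h.δ_pos
  have hκ := h.κ_pos
  have h0 := h.one_le_Λ
  have hr := h.one_le_ratio
  have h1 := h.one_le_rate h.one_le_Λ
  have h2 := h.one_le_rpow h.one_le_Z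
  have hz : κ * zSeq Γ κ δ (Γ * Z) n ^ 2 / δ ^ 3 ≤
      Γ ^ (2 * n + 2) * (κ / δ ^ 2 * growth κ δ Λ Z e n) := by
    rw [zSeq_eq]
    calc κ * ((Γ * (κ / δ)) ^ n * (Γ * Z)) ^ 2 / δ ^ 3
        = Γ ^ (2 * n + 2) * (κ / δ ^ 2 * (Z ^ 2 / δ * ((κ / δ) ^ 2) ^ n)) := by
          rw [mul_pow Γ]
          generalize κ / δ = y
          field_simp
          ring
      _ ≤ Γ ^ (2 * n + 2) * (κ / δ ^ 2 *
          (Z ^ 2 / δ * (κ * √κ / δ ^ 2 * (Z / δ) ^ (20 * e)) ^ n)) := by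
          gcongr
          exact h.κ_div_sq_le.trans (le_mul_of_one_le_right (by linarith) h2)
      _ ≤ _ := by
          gcongr
          rw [growth]
          have : 0 ≤ Λ * (κ * √κ / δ ^ 2 * (Λ / δ) ^ (20 * e)) ^ n := by positivity
          linarith
  have : κ * L / δ ^ 2 ≤ C * (κ / δ ^ 2 * growth κ δ Λ Z e n) :=
    calc κ * L / δ ^ 2 = κ / δ ^ 2 * L := by ring
      _ ≤ κ / δ ^ 2 * (C * growth κ δ Λ Z e n) := by gcongr
      _ = _ := by ring
  linarith

theorem growth_step (h : Params κ δ Λ Z e) {n : ℕ} (hn : n ≤ 5) :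
    √κ * (κ / δ ^ 2 * growth κ δ Λ Z e n) ^ (1 + e) ≤ 4 * growth κ δ Λ Z e (n + 1) := by
  have hδ := h.δ_pos
  have hκ := h.κ_pos
  have hZ := h.one_le_Z
  have h0 := h.one_le_Λ
  have h1 := h.one_le_rate h.one_le_Λ
  have h2 := h.one_le_rate h.one_le_Z
  have hs := h.sqrt_pos
  have h3 := h.rpow_step h0 (y := Λ) (by linarith) (by
    calc κ / δ ^ 2 * Λ ≤ 1 / δ ^ 2 * Λ := by gcongr; exact h.κ_le
      _ = (1 / δ) ^ 2 * Λ := by ring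
      _ ≤ (Λ / δ) ^ 2 * (Λ / δ) := by
        gcongr
        exact le_div_self (by linarith) hδ h.δ_le_one
      _ = _ := by ring) hn
  have h4 := h.rpow_step hZ (y := Z ^ 2 / δ) (by positivity) (by
    calc κ / δ ^ 2 * (Z ^ 2 / δ) ≤ Z / δ ^ 2 * (Z ^ 2 / δ) := by
          gcongr; linarith [h.κ_le]
      _ = _ := by ring) hn
  have h5 := rpow_add_le (g := κ / δ ^ 2 * (Λ * (κ * √κ / δ ^ 2 * (Λ / δ) ^ (20 * e)) ^ n))
    (h := κ / δ ^ 2 * (Z ^ 2 / δ * (κ * √κ / δ ^ 2 * (Z / δ) ^ (20 * e)) ^ n))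
    (by positivity) (by positivity) h.e_pos.le (by linarith [h.e_le, h.e_pos])
  rw [growth, growth, mul_add]
  have h6 := mul_le_mul_of_nonneg_left h5 hs.le
  linarith

theorem ampSeq_nonneg (h : Params κ δ Λ Z e) {Γ : ℝ} (hΓ : 1 ≤ Γ) (n : ℕ) :
    0 ≤ ampSeq Γ κ δ (Γ * Λ) (Γ * Z) e n := by
  have := h.one_le_Λ
  cases n <;> rw [ampSeq] <;> positivity

end Params

theorem exists_ampSeq_le {Γ : ℝ} (hΓ : 1 ≤ Γ) (n : ℕ) (hn : n ≤ 6) :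
    ∃ C : ℝ, 1 ≤ C ∧ ∀ {κ δ Λ Z e : ℝ}, Params κ δ Λ Z e →
      ampSeq Γ κ δ (Γ * Λ) (Γ * Z) e n ≤ C * growth κ δ Λ Z e n := by
  induction n with
  | zero => exact ⟨Γ, hΓ, fun h => by rw [ampSeq]; gcongr; exact h.le_growth 0⟩
  | succ n ih =>
    obtain ⟨C, hC, ih⟩ := ih (by omega)
    have hK : 1 ≤ C + Γ ^ (2 * n + 2) := by linarith [one_le_pow₀ (n := 2 * n + 2) hΓ]
    refine ⟨8 * Γ ^ 2 * (C + Γ ^ (2 * n + 2)) ^ 2, ?_, fun {κ δ Λ Z e} h => ?_⟩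
    · have := one_le_pow₀ (n := 2) hΓ
      have := one_le_pow₀ (n := 2) hK
      nlinarith
    have hL := h.ampSeq_nonneg hΓ n
    have h1 := h.one_le_x hΓ hL n
    have h2 := h.x_le hΓ n (ih h)
    have he := h.e_pos
    have he' := h.e_le
    have hg := h.growth_nonneg n
    have hδ := h.δ_pos
    have hκ := h.κ_pos
    have h3 := h.growth_step (n := n) (by omega)
    have h4 := ceil_rpow_le hΓ h1 he
    rw [ampSeq]
    generalize κ * ampSeq Γ κ δ (Γ * Λ) (Γ * Z) e n / δ ^ 2 +
      κ * zSeq Γ κ δ (Γ * Z) n ^ 2 / δ ^ 3 = X at *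
    generalize C + Γ ^ (2 * n + 2) = K at *
    have h5 : X ^ (1 + e) ≤ K ^ 2 * (κ / δ ^ 2 * growth κ δ Λ Z e n) ^ (1 + e) :=
      calc X ^ (1 + e) ≤ (K * (κ / δ ^ 2 * growth κ δ Λ Z e n)) ^ (1 + e) :=
            Real.rpow_le_rpow (by linarith) h2 (by linarith)
        _ = K ^ (1 + e) * (κ / δ ^ 2 * growth κ δ Λ Z e n) ^ (1 + e) :=
            Real.mul_rpow (by linarith) (by positivity)
        _ ≤ _ := by
            gcongr
            rw [← Real.rpow_natCast K 2]
            exact Real.rpow_le_rpow_of_exponent_le hK (by push_cast; linarith)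
    calc Γ * (√κ * (⌈Γ * X ^ (1 + e)⌉₊ : ℝ))
        ≤ Γ * (√κ * (2 * Γ * (K ^ 2 * (κ / δ ^ 2 * growth κ δ Λ Z e n) ^ (1 + e)))) := by
          gcongr
          exact h4.trans (by gcongr)
      _ = 2 * Γ ^ 2 * K ^ 2 * (√κ * (κ / δ ^ 2 * growth κ δ Λ Z e n) ^ (1 + e)) := by ring
      _ ≤ 2 * Γ ^ 2 * K ^ 2 * (4 * growth κ δ Λ Z e (n + 1)) := by gcongr
      _ = _ := by ring

theorem exists_frequencies {Γ e : ℝ} {J : ℕ} (hΓ : 1 ≤ Γ) (hJ : 3 ≤ J)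
    (hJe : 2 * (1 + e) ≤ J * e) :
    ∃ C : ℝ, 1 ≤ C ∧ ∀ {κ δ Λ Z : ℝ}, Params κ δ Λ Z e →
      ∃ lam : ℕ → ℕ,
        (∀ l, Γ * xSeq Γ κ δ (Γ * Λ) (Γ * Z) lam l ≤ lam l ∧
          Γ * xSeq Γ κ δ (Γ * Λ) (Γ * Z) lam l ^ J * (lam l : ℝ) ^ 2 ≤ (lam l : ℝ) ^ J) ∧
        ∀ n ≤ 6, lamSeq Γ κ (Γ * Λ) lam n ≤ C * growth κ δ Λ Z e n ∧
          zSeq Γ κ δ (Γ * Z) n ≤ C * ((κ / δ) ^ n * Z) := by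
  have hex : ∀ n : ℕ, ∃ C : ℝ, 1 ≤ C ∧ ∀ {κ δ Λ Z e : ℝ}, Params κ δ Λ Z e → n ≤ 6 →
      ampSeq Γ κ δ (Γ * Λ) (Γ * Z) e n ≤ C * growth κ δ Λ Z e n ∧
      zSeq Γ κ δ (Γ * Z) n ≤ C * ((κ / δ) ^ n * Z) := by
    intro n
    by_cases hn : n ≤ 6
    · obtain ⟨C, hC, hh⟩ := exists_ampSeq_le hΓ n hn
      refine ⟨C + Γ ^ (n + 1), by linarith [one_le_pow₀ (n := n + 1) hΓ], fun {κ δ Λ Z e} h _ => ?_⟩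
      have h1 := hh h
      have h2 := h.growth_nonneg n
      have h3 := h.δ_pos
      have h4 := h.κ_pos
      have h5 := h.one_le_Z
      refine ⟨h1.trans (by gcongr; linarith [one_le_pow₀ (n := n + 1) hΓ]), ?_⟩
      rw [zSeq_eq]
      have h6 : 0 ≤ C * ((κ / δ) ^ n * Z) := mul_nonneg (by linarith)
        (mul_nonneg (pow_nonneg (div_nonneg h4.le h3.le) n) (by linarith))
      calc _ = Γ ^ (n + 1) * ((κ / δ) ^ n * Z) := by rw [mul_pow]; ring
        _ ≤ _ := by rw [add_mul]; linarith [h6]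
    · exact ⟨1, le_rfl, fun _ h => absurd h hn⟩
  choose C hC hh using hex
  refine ⟨∑ n ∈ Finset.range 7, C n, ?_, fun {κ δ Λ Z} h => ?_⟩
  · exact (hC 0).trans (Finset.single_le_sum (f := C) (fun i _ => by linarith [hC i]) (by simp))
  refine ⟨freqSeq Γ κ δ (Γ * Λ) (Γ * Z) e, fun l => ?_, fun n hn => ?_⟩
  · have h1 : 1 ≤ xSeq Γ κ δ (Γ * Λ) (Γ * Z) (freqSeq Γ κ δ (Γ * Λ) (Γ * Z) e) l := by
      rw [xSeq, lamSeq_freqSeq]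
      exact h.one_le_x hΓ (h.ampSeq_nonneg hΓ l) l
    have := ceil_rpow_bounds hΓ h1 h.e_pos hJ hJe
    rwa [← freqSeq_eq] at this
  · rw [lamSeq_freqSeq]
    have h1 : C n ≤ ∑ n ∈ Finset.range 7, C n :=
      Finset.single_le_sum (f := C) (fun i _ => by linarith [hC i]) (by simp; omega)
    have h2 := h.growth_nonneg n
    have h3 := h.δ_pos
    have h4 := h.κ_pos
    have h5 := h.one_le_Z
    obtain ⟨h6, h7⟩ := hh n h hn
    exact ⟨h6.trans (by gcongr), h7.trans (by gcongr)⟩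

/-- The bound for the derivatives of the velocity and the stresses. -/
def target (ε κ δ Λ Z : ℝ) : ℝ :=
  κ ^ ((6 + 11 * ε)/2) * (κ / δ ^ 2) ^ (6 + 16 * ε) * Λ ^ ((1 + ε) ^ 6)
    + κ ^ (5.5 + 11 * ε) * Z ^ (2 * (1 + ε) ^ 5) * δ ^ (-(6 + 16 * ε)) * (√κ / δ) ^ (7 + 21 * ε)

/-- The bound for the derivatives of the temperature. -/
def target' (ε κ δ Λ Z : ℝ) : ℝ :=
  κ ^ ((3 + ε)/2) * (κ / δ ^ 2) ^ (3 + 4 * ε) * Λ ^ ((1 + ε) ^ 3)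
    + κ ^ ((5 : ℝ)/2 + ε) * Z ^ (2 * (1 + ε) ^ 2) * δ ^ (-(3 + 4 * ε)) * (√κ / δ) ^ (4 + 6 * ε)

theorem log_growth_left {κ δ Λ e : ℝ} (hκ : 0 < κ) (hδ : 0 < δ) (hΛ : 0 < Λ) (n : ℕ) :
    Real.log (Λ * (κ * √κ / δ ^ 2 * (Λ / δ) ^ (20 * e)) ^ n) =
      Real.log Λ + n * (3 / 2 * Real.log κ - 2 * Real.log δ +
        20 * e * (Real.log Λ - Real.log δ)) := by
  have : 0 < √κ := Real.sqrt_pos.2 hκ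
  rw [Real.log_mul (by positivity) (by positivity), Real.log_pow,
    Real.log_mul (by positivity) (by positivity), Real.log_rpow (by positivity),
    Real.log_div (by positivity) (by positivity), Real.log_div (by positivity) (by positivity),
    Real.log_mul (by positivity) (by positivity), Real.log_pow, Real.log_sqrt hκ.le]
  push_cast
  ring

theorem log_growth_right {κ δ Z e : ℝ} (hκ : 0 < κ) (hδ : 0 < δ) (hZ : 0 < Z) (n : ℕ) :
    Real.log (Z ^ 2 / δ * (κ * √κ / δ ^ 2 * (Z / δ) ^ (20 * e)) ^ n) =
      2 * Real.log Z - Real.log δ + n * (3 / 2 * Real.log κ - 2 * Real.log δ +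
        20 * e * (Real.log Z - Real.log δ)) := by
  have : 0 < √κ := Real.sqrt_pos.2 hκ
  rw [Real.log_mul (by positivity) (by positivity), Real.log_pow,
    Real.log_mul (by positivity) (by positivity), Real.log_rpow (by positivity),
    Real.log_div (by positivity) (by positivity), Real.log_div (by positivity) (by positivity),
    Real.log_div (by positivity) (by positivity),
    Real.log_mul (by positivity) (by positivity), Real.log_pow, Real.log_pow, Real.log_sqrt hκ.le]
  push_cast
  ring

theorem log_target_left {κ δ Λ : ℝ} (hκ : 0 < κ) (hδ : 0 < δ) (hΛ : 0 < Λ) (x y z : ℝ) :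
    Real.log (κ ^ x * (κ / δ ^ 2) ^ y * Λ ^ z) =
      x * Real.log κ + y * (Real.log κ - 2 * Real.log δ) + z * Real.log Λ := by
  rw [Real.log_mul (by positivity) (by positivity), Real.log_mul (by positivity) (by positivity),
    Real.log_rpow (by positivity), Real.log_rpow (by positivity), Real.log_rpow (by positivity),
    Real.log_div (by positivity) (by positivity), Real.log_pow]
  push_cast
  ring

theorem log_target_right {κ δ Z : ℝ} (hκ : 0 < κ) (hδ : 0 < δ) (hZ : 0 < Z) (x y z w : ℝ) :
    Real.log (κ ^ x * Z ^ y * δ ^ z * (√κ / δ) ^ w) =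
      x * Real.log κ + y * Real.log Z + z * Real.log δ +
        w * (Real.log κ / 2 - Real.log δ) := by
  have : 0 < √κ := Real.sqrt_pos.2 hκ
  rw [Real.log_mul (by positivity) (by positivity), Real.log_mul (by positivity) (by positivity),
    Real.log_mul (by positivity) (by positivity),
    Real.log_rpow (by positivity), Real.log_rpow (by positivity), Real.log_rpow (by positivity),
    Real.log_rpow (by positivity),
    Real.log_div (by positivity) (by positivity), Real.log_sqrt hκ.le]

namespace Params

variable {κ δ Λ Z e : ℝ}

theorem growth_le_target (h : Params κ δ Λ Z e) {ε : ℝ} (hε : 120 * e ≤ ε) :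
    growth κ δ Λ Z e 6 ≤ target ε κ δ Λ Z := by
  have hδ := h.δ_pos
  have hκ := h.κ_pos
  have hΛ : 0 < Λ := by linarith [h.one_le_Λ]
  have hZ : 0 < Z := by linarith [h.one_le_Z]
  have he := h.e_pos
  have hs := h.sqrt_pos
  have h1 : Real.log κ ≤ 0 := Real.log_nonpos hκ.le h.κ_le
  have h2 : Real.log δ ≤ Real.log κ := Real.log_le_log hδ h.δ_le_κ
  have h3 : 0 ≤ Real.log Λ := Real.log_nonneg h.one_le_Λ
  have h4 : 0 ≤ Real.log Z := Real.log_nonneg h.one_le_Z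
  have h5 : 1 + ε ≤ (1 + ε) ^ 6 := le_self_pow₀ (by linarith) (by norm_num)
  have h6 : 1 + ε ≤ (1 + ε) ^ 5 := le_self_pow₀ (by linarith) (by norm_num)
  rw [growth, target]
  refine add_le_add ?_ ?_
  · rw [← Real.log_le_log_iff (by positivity) (by positivity), log_growth_left hκ hδ hΛ,
      log_target_left hκ hδ hΛ]
    push_cast
    nlinarith
  · rw [← Real.log_le_log_iff (by positivity) (by positivity), log_growth_right hκ hδ hZ,
      log_target_right hκ hδ hZ]
    push_cast
    nlinarith

theorem growth_le_target' (h : Params κ δ Λ Z e) {ε : ℝ} (hε : 120 * e ≤ ε) :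
    growth κ δ Λ Z e 3 ≤ target' ε κ δ Λ Z := by
  have hδ := h.δ_pos
  have hκ := h.κ_pos
  have hΛ : 0 < Λ := by linarith [h.one_le_Λ]
  have hZ : 0 < Z := by linarith [h.one_le_Z]
  have he := h.e_pos
  have hs := h.sqrt_pos
  have h1 : Real.log κ ≤ 0 := Real.log_nonpos hκ.le h.κ_le
  have h2 : Real.log δ ≤ Real.log κ := Real.log_le_log hδ h.δ_le_κ
  have h3 : 0 ≤ Real.log Λ := Real.log_nonneg h.one_le_Λ
  have h4 : 0 ≤ Real.log Z := Real.log_nonneg h.one_le_Z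
  have h5 : 1 + ε ≤ (1 + ε) ^ 3 := le_self_pow₀ (by linarith) (by norm_num)
  have h6 : 1 + ε ≤ (1 + ε) ^ 2 := le_self_pow₀ (by linarith) (by norm_num)
  rw [growth, target']
  refine add_le_add ?_ ?_
  · rw [← Real.log_le_log_iff (by positivity) (by positivity), log_growth_left hκ hδ hΛ,
      log_target_left hκ hδ hΛ]
    push_cast
    nlinarith
  · rw [← Real.log_le_log_iff (by positivity) (by positivity), log_growth_right hκ hδ hZ,
      log_target_right hκ hδ hZ]
    push_cast
    nlinarith

end Params

theorem supNorm_nonneg {α E : Type*} [NormedAddCommGroup E] (f : α → E) : 0 ≤ supNorm f :=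
  Real.iSup_nonneg fun _ => norm_nonneg _

theorem supNorm_le {α E : Type*} [NormedAddCommGroup E] {f : α → E} {B : ℝ} (hB : 0 ≤ B) (h : ∀ q, ‖f q‖ ≤ B) :
    supNorm f ≤ B := Real.iSup_le h hB

section Norms

variable {E : Type*} [NormedAddCommGroup E] [NormedSpace ℝ E]

/-- The first partial derivatives of a vector-valued function. -/
def dirDeriv (d : Dir) (f : SpaceTime → E) (q : SpaceTime) : E := fderiv ℝ f q (dvec d)

theorem hasDerivAt_dirDeriv {f : SpaceTime → E} (hf : Differentiable ℝ f) (q v : SpaceTime)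
    (s : ℝ) : HasDerivAt (fun s : ℝ => f (q + s • v)) (fderiv ℝ f (q + s • v) v) s := by
  have h1 : HasDerivAt (fun s : ℝ => q + s • v) v s := by
    simpa using ((hasDerivAt_id s).smul_const v).const_add q
  exact (hf (q + s • v)).hasFDerivAt.comp_hasDerivAt s h1

theorem tderiv_eq_dirDeriv {f : SpaceTime → E} (hf : Differentiable ℝ f) :
    tderiv f = dirDeriv none f := by
  funext q
  have h := hasDerivAt_dirDeriv hf (0, q.2) (dvec none) q.1
  have e : ∀ s : ℝ, ((0, q.2) : SpaceTime) + s • dvec none = (s, q.2) := fun s => by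
    ext <;> simp [dvec]
  simp only [e] at h
  exact h.deriv

theorem sderiv_eq_dirDeriv {f : SpaceTime → E} (hf : Differentiable ℝ f) (i : Fin 3) :
    sderiv i f = dirDeriv (some i) f := by
  funext q
  have h := hasDerivAt_dirDeriv hf (q.1, Function.update q.2 i 0) (dvec (some i)) (q.2 i)
  have e : ∀ s : ℝ, ((q.1, Function.update q.2 i 0) : SpaceTime) + s • dvec (some i)
      = (q.1, Function.update q.2 i s) := fun s => by
    refine Prod.ext (by simp [dvec]) (funext fun j => ?_)
    by_cases hj : j = i
    · subst hj; simp [dvec]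
    · simp [dvec, hj]
  simp only [e, Function.update_eq_self] at h
  exact h.deriv

theorem dirDeriv_apply {ι : Type*} [Fintype ι] {f : SpaceTime → ι → E} (hf : Differentiable ℝ f)
    (d : Dir) (q : SpaceTime) (i : ι) : dirDeriv d f q i = dirDeriv d (fun r => f r i) q := by
  rw [dirDeriv, dirDeriv, fderiv_apply (hf q)]
  rfl

theorem c1Norm_le {f : SpaceTime → E} (hf : Differentiable ℝ f) {B₀ B₁ : ℝ} (h₀ : 0 ≤ B₀)
    (h₁ : 0 ≤ B₁) (h : ∀ q, ‖f q‖ ≤ B₀) (h' : ∀ d q, ‖dirDeriv d f q‖ ≤ B₁) :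
    c1Norm f ≤ B₀ + 2 * B₁ := by
  have e1 := supNorm_le h₀ h
  have e2 : (⨆ i : Fin 3, supNorm (sderiv i f)) ≤ B₁ := Real.iSup_le (fun i => by
    rw [sderiv_eq_dirDeriv hf]
    exact supNorm_le h₁ (h' _)) h₁
  have e3 : supNorm (tderiv f) ≤ B₁ := by
    rw [tderiv_eq_dirDeriv hf]
    exact supNorm_le h₁ (h' _)
  rw [c1Norm]
  linarith

theorem czNorm_le {f : SpaceTime → E} (hf : Differentiable ℝ f) {B₀ B₁ : ℝ} (h₀ : 0 ≤ B₀)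
    (h₁ : 0 ≤ B₁) (h : ∀ q, ‖f q‖ ≤ B₀) (h' : ∀ q, ‖dirDeriv (some 2) f q‖ ≤ B₁) :
    czNorm f ≤ B₀ + B₁ := by
  rw [czNorm, sderiv_eq_dirDeriv hf]
  exact add_le_add (supNorm_le h₀ h) (supNorm_le h₁ h')

theorem czNorm_le_c1Norm (f : SpaceTime → E) : czNorm f ≤ c1Norm f := by
  have h1 : supNorm (sderiv 2 f) ≤ ⨆ i : Fin 3, supNorm (sderiv i f) :=
    le_ciSup (f := fun i : Fin 3 => supNorm (sderiv i f)) (Set.finite_range _).bddAbove 2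
  have h2 := supNorm_nonneg (tderiv f)
  rw [czNorm, c1Norm]
  linarith

/-- Smooth, periodic, and zero for times outside `[a, b]`. -/
structure TimeSupported (a b : ℝ) (f : SpaceTime → E) : Prop where
  smooth : ContDiff ℝ (⊤ : ℕ∞) f
  periodic : stPeriodic f
  zero : ∀ q : SpaceTime, q.1 < a ∨ b < q.1 → f q = 0

namespace TimeSupported

variable {a b : ℝ} {f : SpaceTime → E}

theorem differentiable (hf : TimeSupported a b f) : Differentiable ℝ f :=
  hf.smooth.differentiable (by simp)

theorem dirDeriv (hf : TimeSupported a b f) (d : Dir) : TimeSupported a b (dirDeriv d f) where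
  smooth := (hf.smooth.fderiv_right (m := (⊤ : ℕ∞)) (by simp)).clm_apply contDiff_const
  periodic := by
    rw [periodic_iff]
    intro m q
    have : f = fun p => f (p + (0, fun i => 2 * Real.pi * m i)) :=
      funext fun p => (shift_periodic hf.periodic m p).symm
    unfold SPF.dirDeriv
    conv_rhs => rw [this]
    rw [fderiv_comp_add_right]
  zero q hq := by
    have ho : IsOpen {q : SpaceTime | q.1 < a ∨ b < q.1} :=
      (isOpen_lt continuous_fst continuous_const).union (isOpen_lt continuous_const continuous_fst)
    have h : f =ᶠ[nhds q] fun _ => 0 := by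
      filter_upwards [ho.mem_nhds hq] with r hr using hf.zero r hr
    rw [SPF.dirDeriv, h.fderiv_eq]
    simp

theorem bddAbove (hf : TimeSupported a b f) : BddAbove (Set.range fun q => ‖f q‖) := by
  have hK : IsCompact (Set.Icc a b ×ˢ Set.Icc (0 : Fin 3 → ℝ) fun _ => 2 * Real.pi) :=
    isCompact_Icc.prod isCompact_Icc
  obtain ⟨C, hC⟩ := hK.exists_bound_of_continuousOn hf.smooth.continuous.continuousOn
  refine ⟨max C 0, ?_⟩
  rintro _ ⟨q, rfl⟩
  by_cases hq : q.1 < a ∨ b < q.1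
  · simp [hf.zero q hq]
  push Not at hq
  have hp : 0 < 2 * Real.pi := Real.two_pi_pos
  have hper := shift_periodic hf.periodic (fun i => -⌊q.2 i / (2 * Real.pi)⌋) q
  change ‖f q‖ ≤ _
  rw [← hper]
  refine (hC _ ?_).trans (le_max_left _ _)
  refine ⟨by simpa using hq, fun i => ?_, fun i => ?_⟩
  · have h1 := Int.floor_le (q.2 i / (2 * Real.pi))
    rw [le_div_iff₀ hp] at h1
    simp
    linarith
  · have h1 := (Int.lt_floor_add_one (q.2 i / (2 * Real.pi))).le
    rw [div_le_iff₀ hp] at h1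
    simp
    linarith

theorem norm_le (hf : TimeSupported a b f) (q : SpaceTime) : ‖f q‖ ≤ supNorm f :=
  le_ciSup hf.bddAbove q

theorem norm_dirDeriv_le (hf : TimeSupported a b f) {Λ Z : ℝ} (hΛ : c1Norm f ≤ Λ)
    (hZ : czNorm f ≤ Z) (d : Dir) (q : SpaceTime) : ‖SPF.dirDeriv d f q‖ ≤ scale Λ Z d := by
  have h0 := (hf.dirDeriv d).norm_le q
  have h1 := supNorm_nonneg f
  have h3 := supNorm_nonneg (tderiv f)
  have h4 : ∀ i, supNorm (sderiv i f) ≤ ⨆ i : Fin 3, supNorm (sderiv i f) :=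
    le_ciSup (f := fun i : Fin 3 => supNorm (sderiv i f)) (Set.finite_range _).bddAbove
  rw [c1Norm] at hΛ
  rw [czNorm] at hZ
  refine h0.trans ?_
  cases d with
  | none =>
    have h5 := (supNorm_nonneg _).trans (h4 0)
    rw [← tderiv_eq_dirDeriv hf.differentiable]
    simp only [scale, reduceCtorEq, if_false]
    linarith
  | some i =>
    rw [← sderiv_eq_dirDeriv hf.differentiable]
    unfold scale
    split_ifs with h
    · rw [Option.some.injEq] at h
      subst h
      linarith
    · linarith [h4 i]

end TimeSupported

end Norms

theorem dirDeriv_vec (g : Fin 3 → SPF) (d : Dir) (q : SpaceTime) (i : Fin 3) :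
    dirDeriv d (fun q i => g i q) q i = pd d (g i) q :=
  dirDeriv_apply (differentiable_pi.2 fun i => (g i).differentiable) d q i

theorem smooth_vec (g : Fin 3 → SPF) :
    ContDiff ℝ (⊤ : ℕ∞) (fun (q : SpaceTime) (i : Fin 3) => g i q) :=
  contDiff_pi.2 fun i => (g i).smooth

theorem smooth_mat (g : Fin 3 → Fin 3 → SPF) :
    ContDiff ℝ (⊤ : ℕ∞) (fun (q : SpaceTime) (i j : Fin 3) => g i j q) :=
  contDiff_pi.2 fun i => smooth_vec (g i)

theorem dirDeriv_mat (g : Fin 3 → Fin 3 → SPF) (d : Dir) (q : SpaceTime) (i j : Fin 3) :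
    dirDeriv d (fun q i j => g i j q) q i j = pd d (g i j) q := by
  rw [dirDeriv_apply ((smooth_mat g).differentiable (by simp))]
  exact dirDeriv_vec (g i) d q j

/-- The components of a vector field as elements of `SPF`. -/
def ofVec (v : SpaceTime → Fin 3 → ℝ) (hv : ContDiff ℝ (⊤ : ℕ∞) v) (hp : stPeriodic v)
    (i : Fin 3) : SPF :=
  ⟨fun q => v q i, contDiff_pi.1 hv i, fun t x m => congrFun (hp t x m) i⟩

theorem eq_iff {f g : SPF} : f = g ↔ ∀ q, f q = g q := ⟨fun h _ => h ▸ rfl, ext'⟩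

theorem boussStress_iff (U : Dir → SPF) (p : SPF) (S : Dir → Fin 3 → SPF) :
    BoussStress (fun q i => U (some i) q) p (U none) (fun q i j => S (some i) j q)
        (fun q j => S none j q) ↔
      (∀ i, NL U (some i) + pd (some i) p = ∑ j, pd (some j) (S (some i) j)) ∧
        (∑ j, pd (some j) (U (some j)) = 0) ∧ NL U none = ∑ j, pd (some j) (S none j) := by
  have h2 : ∀ i, sderiv 2 (sderiv 2 (U i : SpaceTime → ℝ)) = pd (some 2) (pd (some 2) (U i)) :=
    fun i => by rw [sderiv_eq, sderiv_eq]
  have hm : ∀ i j q, sderiv j (fun r => U i r * U (some j) r) q =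
      pd (some j) (U i * U (some j)) q := fun i j q => congrFun (sderiv_eq j (U i * U (some j))) q
  have hm' : ∀ i j q, sderiv j (fun r => U (some j) r * U i r) q =
      pd (some j) (U i * U (some j)) q := fun i j q => by
    rw [← hm]
    simp only [mul_comm]
  rw [BoussStress]
  refine and_congr ?_ (and_congr ?_ ?_)
  · rw [forall_comm]
    refine forall_congr' fun i => ?_
    rw [eq_iff]
    refine forall_congr' fun q => ?_
    rw [tderiv_eq, h2, sderiv_eq]
    simp only [hm, sderiv_eq]
    rw [NL]
    simp only [add_apply, sub_apply, sum_apply, Option.some.injEq]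
    split_ifs with h
    · constructor <;> intro h' <;> linarith
    · rw [zero_apply]
      constructor <;> intro h' <;> linarith
  · rw [eq_iff]
    refine forall_congr' fun q => ?_
    simp only [sderiv_eq, sum_apply, zero_apply]
  · rw [eq_iff]
    refine forall_congr' fun q => ?_
    rw [tderiv_eq, h2]
    simp only [hm', sderiv_eq]
    rw [NL]
    simp only [add_apply, sub_apply, sum_apply, reduceCtorEq, if_false, sub_zero]

/-- The velocity of the pair `U`. -/
def vel (U : Dir → SPF) : SpaceTime → Fin 3 → ℝ := fun q i => U (some i) q

/-- The Reynolds stress of `S`. -/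
def stress (S : Dir → Fin 3 → SPF) : SpaceTime → Fin 3 → Fin 3 → ℝ := fun q i j => S (some i) j q

/-- The temperature flux of `S`. -/
def flux (S : Dir → Fin 3 → SPF) : SpaceTime → Fin 3 → ℝ := fun q j => S none j q

section Upper

variable {U : Dir → SPF} {S : Dir → Fin 3 → SPF} {B B' B₀ : ℝ}

theorem norm_vel_le (hB : 0 ≤ B) (h : ∀ i q, |U i q| ≤ B) (q : SpaceTime) : ‖vel U q‖ ≤ B :=
  (pi_norm_le_iff_of_nonneg hB).2 fun i => h (some i) q

theorem norm_flux_le (hB : 0 ≤ B) (h : ∀ i j q, |S i j q| ≤ B) (q : SpaceTime) :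
    ‖flux S q‖ ≤ B := (pi_norm_le_iff_of_nonneg hB).2 fun j => h none j q

theorem norm_stress_le (hB : 0 ≤ B) (h : ∀ i j q, |S i j q| ≤ B) (q : SpaceTime) :
    ‖stress S q‖ ≤ B := (pi_norm_le_iff_of_nonneg hB).2 fun i =>
  (pi_norm_le_iff_of_nonneg hB).2 fun j => h (some i) j q

theorem norm_dirDeriv_vel_le (hB : 0 ≤ B) {d : Dir} {q : SpaceTime}
    (h : ∀ i, |pd d (U i) q| ≤ B) : ‖dirDeriv d (vel U) q‖ ≤ B :=
  (pi_norm_le_iff_of_nonneg hB).2 fun i => by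
    exact (congrArg abs (dirDeriv_vec (fun i => U (some i)) d q i)).trans_le (h (some i))

theorem norm_dirDeriv_flux_le (hB : 0 ≤ B) {d : Dir} {q : SpaceTime}
    (h : ∀ i j, |pd d (S i j) q| ≤ B) : ‖dirDeriv d (flux S) q‖ ≤ B :=
  (pi_norm_le_iff_of_nonneg hB).2 fun j => by
    exact (congrArg abs (dirDeriv_vec (fun j => S none j) d q j)).trans_le (h none j)

theorem norm_dirDeriv_stress_le (hB : 0 ≤ B) {d : Dir} {q : SpaceTime}
    (h : ∀ i j, |pd d (S i j) q| ≤ B) : ‖dirDeriv d (stress S) q‖ ≤ B :=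
  (pi_norm_le_iff_of_nonneg hB).2 fun i => (pi_norm_le_iff_of_nonneg hB).2 fun j => by
    exact (congrArg abs (dirDeriv_mat (fun i j => S (some i) j) d q i j)).trans_le (h (some i) j)

theorem smooth_vel (U : Dir → SPF) : ContDiff ℝ (⊤ : ℕ∞) (vel U) := smooth_vec _
theorem smooth_flux (S : Dir → Fin 3 → SPF) : ContDiff ℝ (⊤ : ℕ∞) (flux S) := smooth_vec _
theorem smooth_stress (S : Dir → Fin 3 → SPF) : ContDiff ℝ (⊤ : ℕ∞) (stress S) := smooth_mat _

theorem periodic_vel (U : Dir → SPF) : stPeriodic (vel U) := fun t x m =>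
  funext fun i => (U (some i)).periodic t x m
theorem periodic_flux (S : Dir → Fin 3 → SPF) : stPeriodic (flux S) := fun t x m =>
  funext fun j => (S none j).periodic t x m
theorem periodic_stress (S : Dir → Fin 3 → SPF) : stPeriodic (stress S) := fun t x m =>
  funext fun i => funext fun j => (S (some i) j).periodic t x m

theorem Lam_le (h₀ : 0 ≤ B₀) (hB : 0 ≤ B) (hU : ∀ i q, |U i q| ≤ B₀)
    (hS : ∀ i j q, |S i j q| ≤ B₀) (hU' : ∀ d i q, |pd d (U i) q| ≤ B)
    (hS' : ∀ d i j q, |pd d (S i j) q| ≤ B) :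
    Lam (vel U) (flux S) (U none) (stress S) ≤ max 1 (B₀ + 2 * B) := by
  refine max_le_max le_rfl (max_le ?_ (max_le ?_ (max_le ?_ ?_)))
  · exact c1Norm_le ((smooth_stress S).differentiable (by simp)) h₀ hB (norm_stress_le h₀ hS)
      fun d q => norm_dirDeriv_stress_le hB fun i j => hS' d i j q
  · exact c1Norm_le ((smooth_flux S).differentiable (by simp)) h₀ hB (norm_flux_le h₀ hS)
      fun d q => norm_dirDeriv_flux_le hB fun i j => hS' d i j q
  · exact c1Norm_le ((smooth_vel U).differentiable (by simp)) h₀ hB (norm_vel_le h₀ hU)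
      fun d q => norm_dirDeriv_vel_le hB fun i => hU' d i q
  · exact c1Norm_le (U none).differentiable h₀ hB (hU none) fun d q => hU' d none q

theorem LamZ_le (h₀ : 0 ≤ B₀) (hB : 0 ≤ B) (hU : ∀ i q, |U i q| ≤ B₀)
    (hS : ∀ i j q, |S i j q| ≤ B₀) (hU' : ∀ i q, |pd (some 2) (U i) q| ≤ B)
    (hS' : ∀ i j q, |pd (some 2) (S i j) q| ≤ B) :
    LamZ (vel U) (flux S) (U none) (stress S) ≤ max 1 (B₀ + B) := by
  refine max_le_max le_rfl (max_le ?_ (max_le ?_ (max_le ?_ ?_)))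
  · exact czNorm_le ((smooth_stress S).differentiable (by simp)) h₀ hB (norm_stress_le h₀ hS)
      fun q => norm_dirDeriv_stress_le hB fun i j => hS' i j q
  · exact czNorm_le ((smooth_flux S).differentiable (by simp)) h₀ hB (norm_flux_le h₀ hS)
      fun q => norm_dirDeriv_flux_le hB fun i j => hS' i j q
  · exact czNorm_le ((smooth_vel U).differentiable (by simp)) h₀ hB (norm_vel_le h₀ hU)
      fun q => norm_dirDeriv_vel_le hB fun i => hU' i q
  · exact czNorm_le (U none).differentiable h₀ hB (hU none) fun q => hU' none q

end Upper

theorem LamZ_le_Lam (v f : SpaceTime → Fin 3 → ℝ) (θ : SpaceTime → ℝ)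
    (R : SpaceTime → Fin 3 → Fin 3 → ℝ) : LamZ v f θ R ≤ Lam v f θ R :=
  max_le_max le_rfl (max_le_max (czNorm_le_c1Norm R) (max_le_max (czNorm_le_c1Norm f)
    (max_le_max (czNorm_le_c1Norm v) (czNorm_le_c1Norm θ))))

/-- A pair of fields with stresses, all supported in the time interval `(a, b)`. -/
structure Supported (a b : ℝ) (U : Dir → SPF) (S : Dir → Fin 3 → SPF) : Prop where
  U_zero : ∀ i q, q.1 ≤ a ∨ b ≤ q.1 → U i q = 0
  S_zero : ∀ i j q, q.1 ≤ a ∨ b ≤ q.1 → S i j q = 0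

namespace Supported

variable {a b : ℝ} {U : Dir → SPF} {S : Dir → Fin 3 → SPF}

theorem vel (h : Supported a b U S) : TimeSupported a b (vel U) :=
  ⟨smooth_vel U, periodic_vel U, fun q hq => funext fun i =>
    h.U_zero (some i) q (hq.imp le_of_lt le_of_lt)⟩

theorem temp (h : Supported a b U S) : TimeSupported a b (U none : SpaceTime → ℝ) :=
  ⟨(U none).smooth, (U none).periodic, fun q hq => h.U_zero none q (hq.imp le_of_lt le_of_lt)⟩

theorem flux (h : Supported a b U S) : TimeSupported a b (flux S) :=
  ⟨smooth_flux S, periodic_flux S, fun q hq => funext fun j =>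
    h.S_zero none j q (hq.imp le_of_lt le_of_lt)⟩

theorem stress (h : Supported a b U S) : TimeSupported a b (stress S) :=
  ⟨smooth_stress S, periodic_stress S, fun q hq => funext fun i => funext fun j =>
    h.S_zero (some i) j q (hq.imp le_of_lt le_of_lt)⟩

theorem abs_le (h : Supported a b U S) (i : Dir) (q : SpaceTime) :
    |U i q| ≤ LamZ (SPF.vel U) (SPF.flux S) (U none) (SPF.stress S) := by
  cases i with
  | none =>
    refine (h.temp.norm_le q).trans ((le_add_of_nonneg_right
      (supNorm_nonneg (sderiv 2 (U none : SpaceTime → ℝ)))).trans ?_)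
    exact (le_max_right _ _).trans ((le_max_right _ _).trans ((le_max_right _ _).trans
      (le_max_right _ _)))
  | some i =>
    refine (norm_le_pi_norm (SPF.vel U q) i).trans ((h.vel.norm_le q).trans
      ((le_add_of_nonneg_right (supNorm_nonneg (sderiv 2 (SPF.vel U)))).trans ?_))
    exact (le_max_left _ _).trans ((le_max_right _ _).trans ((le_max_right _ _).trans
      (le_max_right _ _)))

theorem abs_pd_le (h : Supported a b U S) (d i : Dir) (q : SpaceTime) :
    |pd d (U i) q| ≤ scale (Lam (SPF.vel U) (SPF.flux S) (U none) (SPF.stress S))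
      (LamZ (SPF.vel U) (SPF.flux S) (U none) (SPF.stress S)) d := by
  cases i with
  | none =>
    exact h.temp.norm_dirDeriv_le
      ((le_max_right _ _).trans ((le_max_right _ _).trans ((le_max_right _ _).trans
        (le_max_right _ _))))
      ((le_max_right _ _).trans ((le_max_right _ _).trans ((le_max_right _ _).trans
        (le_max_right _ _)))) d q
  | some i =>
    rw [← dirDeriv_vec fun i => U (some i)]
    exact (norm_le_pi_norm (dirDeriv d (SPF.vel U) q) i).trans (h.vel.norm_dirDeriv_le
      ((le_max_left _ _).trans ((le_max_right _ _).trans ((le_max_right _ _).trans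
        (le_max_right _ _))))
      ((le_max_left _ _).trans ((le_max_right _ _).trans ((le_max_right _ _).trans
        (le_max_right _ _)))) d q)

theorem abs_pd_le' (h : Supported a b U S) (d i : Dir) (j : Fin 3) (q : SpaceTime) :
    |pd d (S i j) q| ≤ scale (Lam (SPF.vel U) (SPF.flux S) (U none) (SPF.stress S))
      (LamZ (SPF.vel U) (SPF.flux S) (U none) (SPF.stress S)) d := by
  cases i with
  | none =>
    rw [← dirDeriv_vec fun j => S none j]
    exact (norm_le_pi_norm (dirDeriv d (SPF.flux S) q) j).trans (h.flux.norm_dirDeriv_le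
      ((le_max_left _ _).trans ((le_max_right _ _).trans (le_max_right _ _)))
      ((le_max_left _ _).trans ((le_max_right _ _).trans (le_max_right _ _))) d q)
  | some i =>
    rw [← dirDeriv_mat fun i j => S (some i) j]
    exact (norm_le_pi_norm (dirDeriv d (SPF.stress S) q i) j).trans
      ((norm_le_pi_norm (dirDeriv d (SPF.stress S) q) i).trans (h.stress.norm_dirDeriv_le
      ((le_max_left _ _).trans (le_max_right _ _))
      ((le_max_left _ _).trans (le_max_right _ _)) d q))

/-- The data of the main estimate, with the sizes measured by `Lam` and `LamZ`. -/
def input (h : Supported a b U S) {V κ δ : ℝ} (hδ : 0 < δ) (hκ : 0 < κ) (hκ1 : κ ≤ 1)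
    (hδκ : δ ≤ κ * √κ) (hV : supNorm (SPF.vel U) ≤ V) (hR : supNorm (SPF.stress S) ≤ κ)
    (hf : supNorm (SPF.flux S) ≤ κ) (hsymm : ∀ i j, S (some i) j = S (some j) i) : Input V where
  δ := δ
  κ := κ
  Λ := Lam (SPF.vel U) (SPF.flux S) (U none) (SPF.stress S)
  Z := LamZ (SPF.vel U) (SPF.flux S) (U none) (SPF.stress S)
  a := a
  b := b
  U := U
  S := S
  δ_pos := hδ
  κ_pos := hκ
  κ_le := hκ1
  δ_le := hδκ
  Z_ge := le_max_left _ _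
  Z_le := LamZ_le_Lam _ _ _ _
  U_le j q := (norm_le_pi_norm (SPF.vel U q) j).trans ((h.vel.norm_le q).trans hV)
  pd_U := h.abs_pd_le
  S_le i j q := by
    cases i with
    | none => exact (norm_le_pi_norm (SPF.flux S q) j).trans ((h.flux.norm_le q).trans hf)
    | some i =>
      exact (norm_le_pi_norm (SPF.stress S q i) j).trans
        ((norm_le_pi_norm (SPF.stress S q) i).trans ((h.stress.norm_le q).trans hR))
  pd_S := h.abs_pd_le'
  symm := hsymm
  zero := h.S_zero

end Supported

theorem scale_le_of {Λ Z B : ℝ} (hΛ : Λ ≤ B) (hZ : Z ≤ B) (d : Dir) : scale Λ Z d ≤ B := by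
  unfold scale; split_ifs <;> assumption

theorem Supported.bounds {U : Dir → SPF} {S : Dir → Fin 3 → SPF} {Λ Z κ δ ε e : ℝ}
    (hP : Params κ δ Λ Z e) (hε : 120 * e ≤ ε) {Γ C : ℝ} (hΓ : 1 ≤ Γ) (hC : 1 ≤ C)
    (hU : ∀ i q, |U i q| ≤ Z + 42) (hS : ∀ i j q, |S i j q| ≤ δ) {x x' z z' : ℝ}
    (hx : x ≤ C * growth κ δ Λ Z e 6) (hz : z ≤ C * ((κ / δ) ^ 6 * Z))
    (hx' : x' ≤ C * growth κ δ Λ Z e 3) (hz' : z' ≤ C * ((κ / δ) ^ 3 * Z))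
    (hpU : ∀ d i q, |pd d (U i) q| ≤ 2 * scale x z d)
    (hpS : ∀ d i j q, |pd d (S i j) q| ≤ 8 * scale x z d)
    (hpθ : ∀ d q, |pd d (U none) q| ≤ scale x' z' d + Γ * scale Λ Z d) :
    Lam (SPF.vel U) (SPF.flux S) (U none) (SPF.stress S) ≤ 60 * (C + Γ) * target ε κ δ Λ Z ∧
      LamZ (SPF.vel U) (SPF.flux S) (U none) (SPF.stress S) ≤ 60 * (C + Γ) * (κ / δ) ^ 6 * Z ∧
      supNorm (sderiv 2 (U none : SpaceTime → ℝ)) ≤ 60 * (C + Γ) * (κ / δ) ^ 3 * Z ∧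
      supNorm (tderiv (U none : SpaceTime → ℝ)) + supNorm (sderiv 0 (U none : SpaceTime → ℝ)) +
        supNorm (sderiv 1 (U none : SpaceTime → ℝ)) ≤ 60 * (C + Γ) * target' ε κ δ Λ Z := by
  have hG := hP.growth_le_target hε
  have hG' := hP.growth_le_target' hε
  have hΛG := hP.le_growth 6
  have hΛG' := hP.le_growth 3
  have hzG := hP.mul_pow_le 6
  have hδ1 := hP.δ_le_one
  have hZ := hP.one_le_Z
  have hZΛ := hP.Z_le
  have hk := hP.one_le_κ_div
  have hZ6 : Z ≤ (κ / δ) ^ 6 * Z := le_mul_of_one_le_left (by linarith) (one_le_pow₀ hk)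
  have hZ3 : Z ≤ (κ / δ) ^ 3 * Z := le_mul_of_one_le_left (by linarith) (one_le_pow₀ hk)
  generalize target ε κ δ Λ Z = T at *
  generalize target' ε κ δ Λ Z = T' at *
  generalize growth κ δ Λ Z e 6 = G at *
  generalize growth κ δ Λ Z e 3 = G' at *
  rw [mul_assoc _ _ Z, mul_assoc _ _ Z]
  generalize (κ / δ) ^ 6 * Z = Y at *
  generalize (κ / δ) ^ 3 * Z = Y' at *
  have hsc : ∀ d, scale x z d ≤ C * G := scale_le_of hx (hz.trans (by gcongr))
  have h1 : ∀ t : ℝ, 1 ≤ t → t ≤ C * t := fun t ht => le_mul_of_one_le_left (by linarith) hC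
  have h2 : ∀ t : ℝ, 1 ≤ t → t ≤ Γ * t := fun t ht => le_mul_of_one_le_left (by linarith) hΓ
  have hCG := h1 G (by linarith)
  have hCY := h1 Y (by linarith)
  have hCY' := h1 Y' (by linarith)
  have hCG' := h1 G' (by linarith)
  have hΓY' := h2 Y' (by linarith)
  have hΓG' := h2 G' (by linarith)
  have hΓY := h2 Y (by linarith)
  have hΓG := h2 G (by linarith)
  have hΓZY' : Γ * Z ≤ Γ * Y' := by gcongr
  have hΓΛG' : Γ * Λ ≤ Γ * G' := by gcongr
  have hT : 60 * (C + Γ) * G ≤ 60 * (C + Γ) * T := by gcongr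
  have hT' : 60 * (C + Γ) * G' ≤ 60 * (C + Γ) * T' := by gcongr
  have hz2 : scale x z (some 2) = z := by simp [scale]
  refine ⟨?_, ?_, ?_, ?_⟩
  · refine (Lam_le (B₀ := Z + 42) (B := 8 * (C * G)) (by linarith) (by linarith) hU
      (fun i j q => (hS i j q).trans (by linarith))
      (fun d i q => (hpU d i q).trans (by linarith [hsc d]))
      (fun d i j q => (hpS d i j q).trans (by linarith [hsc d]))).trans (max_le ?_ ?_) <;>
    linarith
  · refine (LamZ_le (B₀ := Z + 42) (B := 8 * (C * Y)) (by linarith) (by linarith) hU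
      (fun i j q => (hS i j q).trans (by linarith))
      (fun i q => (hpU _ i q).trans (by linarith))
      (fun i j q => (hpS _ i j q).trans (by linarith))).trans (max_le ?_ ?_) <;>
    linarith
  · rw [sderiv_eq]
    refine (supNorm_le (B := C * Y' + Γ * Y') (by linarith) fun q => (hpθ _ q).trans ?_).trans ?_
    · simp only [scale, if_true]
      linarith
    · linarith
  · have h3 : ∀ d : Dir, d ≠ some 2 →
        supNorm (pd d (U none) : SpaceTime → ℝ) ≤ C * G' + Γ * G' := fun d hd =>
      supNorm_le (by linarith) fun q => (hpθ _ q).trans (by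
        simp only [scale, hd, if_false]
        linarith)
    rw [tderiv_eq, sderiv_eq, sderiv_eq]
    have h4 := h3 none (by simp)
    have h5 := h3 (some 0) (by simp)
    have h6 := h3 (some 1) (by simp)
    linarith

theorem exists_improvement {ε : ℝ} (hε : 0 < ε) (V : ℝ) : ∃ A : ℝ, 0 < A ∧
    ∀ {a b κ δ : ℝ} {U : Dir → SPF} {S : Dir → Fin 3 → SPF} (_ : Supported a b U S) (_ : 0 < δ)
      (_ : 0 < κ) (_ : κ ≤ 1) (_ : δ ≤ κ * √κ) (_ : supNorm (vel U) ≤ V)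
      (_ : supNorm (stress S) ≤ κ) (_ : supNorm (flux S) ≤ κ)
      (_ : ∀ i j, S (some i) j = S (some j) i),
      ∃ (W : Dir → SPF) (S' : Dir → Fin 3 → SPF),
        Supported (a - κ) (b + κ) (fun i => U i + W i) S' ∧
        (∑ j, pd (some j) (W (some j)) = 0) ∧
        (∀ i j, S' (some i) j = S' (some j) i) ∧
        (∀ i q, |W i q| ≤ 42 * √κ) ∧ (∀ i j q, |S' i j q| ≤ δ) ∧
        (∀ i, NL (fun i => U i + W i) i = NL U i - ∑ j, pd (some j) (S i j) +
          ∑ j, pd (some j) (S' i j)) ∧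
        Lam (vel fun i => U i + W i) (flux S') (U none + W none : SPF) (stress S') ≤
          A * target ε κ δ (Lam (vel U) (flux S) (U none) (stress S))
            (LamZ (vel U) (flux S) (U none) (stress S)) ∧
        LamZ (vel fun i => U i + W i) (flux S') (U none + W none : SPF) (stress S') ≤
          A * (κ / δ) ^ 6 * LamZ (vel U) (flux S) (U none) (stress S) ∧
        supNorm (sderiv 2 ((U none + W none : SPF) : SpaceTime → ℝ)) ≤
          A * (κ / δ) ^ 3 * LamZ (vel U) (flux S) (U none) (stress S) ∧
        supNorm (tderiv ((U none + W none : SPF) : SpaceTime → ℝ)) +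
          supNorm (sderiv 0 ((U none + W none : SPF) : SpaceTime → ℝ)) +
          supNorm (sderiv 1 ((U none + W none : SPF) : SpaceTime → ℝ)) ≤
          A * target' ε κ δ (Lam (vel U) (flux S) (U none) (stress S))
            (LamZ (vel U) (flux S) (U none) (stress S)) := by
  obtain ⟨e, he, he1, heε⟩ : ∃ e : ℝ, 0 < e ∧ 20 * e ≤ 1 ∧ 120 * e ≤ ε :=
    ⟨min ε 1 / 120, by positivity, by linarith [min_le_right ε 1], by linarith [min_le_left ε 1]⟩
  obtain ⟨J, hJ⟩ := exists_nat_ge (3 + 2 * (1 + e) / e)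
  have hJ3 : 3 ≤ J := by
    have : 0 ≤ 2 * (1 + e) / e := by positivity
    exact_mod_cast (by linarith : (3 : ℝ) ≤ J)
  have hJe : 2 * (1 + e) ≤ J * e := by
    rw [← div_le_iff₀ he]
    linarith
  obtain ⟨Γ, hΓ, hout⟩ := exists_output V J
  have hΓ1 : 1 ≤ Γ := by linarith
  obtain ⟨C, hC, hfreq⟩ := exists_frequencies hΓ1 hJ3 hJe
  refine ⟨60 * (C + Γ), by positivity, ?_⟩
  intro a b κ δ U S hsup hδ hκ hκ1 hδκ hV hR hf hsymm
  have hP : Params κ δ (Lam (vel U) (flux S) (U none) (stress S))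
      (LamZ (vel U) (flux S) (U none) (stress S)) e :=
    ⟨hδ, hκ, hκ1, hδκ, le_max_left _ _, LamZ_le_Lam _ _ _ _, he, he1⟩
  obtain ⟨lam, hlam, hsize⟩ := hfreq hP
  obtain ⟨W, S', h⟩ := hout (hsup.input hδ hκ hκ1 hδκ hV hR hf hsymm) lam fun l _ => hlam l
  have hW : ∀ i q, |W i q| ≤ 42 * √κ := h.abs_le
  refine ⟨W, S', ⟨fun i q hq => ?_, fun i j q hq => ?_⟩, h.div, h.symm, hW, h.abs_le', h.eq,
    Supported.bounds hP heε hΓ1 hC (U := fun i => U i + W i) (fun i q => ?_) h.abs_le'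
      (hsize 6 le_rfl).1 (hsize 6 le_rfl).2 (hsize 3 (by norm_num)).1 (hsize 3 (by norm_num)).2
      h.pd_le h.pd_le' h.temp⟩
  · have h1 : W i q = 0 := h.mem i q (hq.imp (fun hq => ?_) fun hq => ?_)
    · rw [add_apply, h1, hsup.U_zero i q (hq.imp (fun _ => by linarith) fun _ => by linarith),
        add_zero]
    · change q.1 < a - κ / 2
      linarith
    · change b + κ / 2 < q.1
      linarith
  · refine h.mem' i j q (hq.imp (fun hq => ?_) fun hq => ?_)
    · change q.1 < a - κ / 2
      linarith
    · change b + κ / 2 < q.1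
      linarith
  · have h1 := hsup.abs_le i q
    have h2 := hW i q
    have h3 := hP.sqrt_le
    rw [add_apply]
    exact (abs_add_le _ _).trans (by linarith)

end SPF

/-- the main iterative proposition (Proposition 2.1 of the paper). -/
theorem iterative_proposition :
    ∃ M : ℝ, 0 < M ∧
    ∀ ε : ℝ, 0 < ε → ∀ V : ℝ, 0 < V →
    ∃ A : ℝ, 0 < A ∧
    ∀ (a b κ : ℝ), 1 < a → a < b → b < 4 → 0 < κ → κ ≤ 1 →
    ∀ (v : SpaceTime → Fin 3 → ℝ) (p θ : SpaceTime → ℝ)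
      (R : SpaceTime → Fin 3 → Fin 3 → ℝ) (f : SpaceTime → Fin 3 → ℝ),
      ContDiff ℝ (⊤ : ℕ∞) v → ContDiff ℝ (⊤ : ℕ∞) p → ContDiff ℝ (⊤ : ℕ∞) θ →
      ContDiff ℝ (⊤ : ℕ∞) R → ContDiff ℝ (⊤ : ℕ∞) f →
      stPeriodic v → stPeriodic p → stPeriodic θ → stPeriodic R → stPeriodic f →
      (∀ t x, t ∉ Set.Ioo a b →
        v (t, x) = 0 ∧ p (t, x) = 0 ∧ θ (t, x) = 0 ∧ R (t, x) = 0 ∧ f (t, x) = 0) →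
      (∀ q i j, R q i j = R q j i) →
      BoussStress v p θ R f →
      supNorm v ≤ V →
      supNorm R ≤ κ → supNorm f ≤ κ →
      ∀ κ' : ℝ, 0 < κ' → κ' ≤ κ ^ ((3 : ℝ)/2) →
      ∃ (v' : SpaceTime → Fin 3 → ℝ) (p' θ' : SpaceTime → ℝ)
        (R' : SpaceTime → Fin 3 → Fin 3 → ℝ) (f' : SpaceTime → Fin 3 → ℝ),
        ContDiff ℝ (⊤ : ℕ∞) v' ∧ ContDiff ℝ (⊤ : ℕ∞) p' ∧ ContDiff ℝ (⊤ : ℕ∞) θ' ∧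
        ContDiff ℝ (⊤ : ℕ∞) R' ∧ ContDiff ℝ (⊤ : ℕ∞) f' ∧
        stPeriodic v' ∧ stPeriodic p' ∧ stPeriodic θ' ∧ stPeriodic R' ∧ stPeriodic f' ∧
        (∀ t x, t ∉ Set.Ioo (a - κ) (b + κ) →
          v' (t, x) = 0 ∧ p' (t, x) = 0 ∧ θ' (t, x) = 0 ∧ R' (t, x) = 0 ∧ f' (t, x) = 0) ∧
        (∀ q i j, R' q i j = R' q j i) ∧
        BoussStress v' p' θ' R' f' ∧
        supNorm R' ≤ κ' ∧
        supNorm f' ≤ κ' ∧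
        supNorm (fun q => v' q - v q) ≤ M * Real.sqrt κ ∧
        supNorm (fun q => θ' q - θ q) ≤ M * Real.sqrt κ ∧
        p' = p ∧
        Lam v' f' θ' R' ≤
          A * (κ ^ ((6 + 11 * ε)/2) * (κ / κ' ^ 2) ^ (6 + 16 * ε)
                * (Lam v f θ R) ^ ((1 + ε) ^ 6)
              + κ ^ (5.5 + 11 * ε) * (LamZ v f θ R) ^ (2 * (1 + ε) ^ 5)
                * κ' ^ (-(6 + 16 * ε)) * (Real.sqrt κ / κ') ^ (7 + 21 * ε)) ∧
        LamZ v' f' θ' R' ≤ A * (κ / κ') ^ (6 : ℕ) * LamZ v f θ R ∧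
        supNorm (sderiv 2 θ') ≤ A * (κ / κ') ^ (3 : ℕ) * LamZ v f θ R ∧
        supNorm (tderiv θ') + supNorm (sderiv 0 θ') + supNorm (sderiv 1 θ') ≤
          A * (κ ^ ((3 + ε)/2) * (κ / κ' ^ 2) ^ (3 + 4 * ε)
                * (Lam v f θ R) ^ ((1 + ε) ^ 3)
              + κ ^ ((5 : ℝ)/2 + ε) * (LamZ v f θ R) ^ (2 * (1 + ε) ^ 2)
                * κ' ^ (-(3 + 4 * ε)) * (Real.sqrt κ / κ') ^ (4 + 6 * ε)) := by
  refine ⟨42, by norm_num, fun ε hε V _ => ?_⟩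
  obtain ⟨A, hA, H⟩ := SPF.exists_improvement hε V
  refine ⟨A, hA, ?_⟩
  intro a b κ _ _ _ hκ hκ1 v p θ R f sv sp sθ sR sf pv pp pθ pR pf hz hsymm heq hV hR hf δ hδ hδκ
  let U : Dir → SPF := fun i => i.elim ⟨θ, sθ, pθ⟩ (SPF.ofVec v sv pv)
  let S : Dir → Fin 3 → SPF := fun i => i.elim (SPF.ofVec f sf pf) fun i =>
    SPF.ofVec (fun q => R q i) (contDiff_pi.1 sR i) fun t x m => congrFun (pR t x m) i
  let P : SPF := ⟨p, sp, pp⟩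
  have hz' : ∀ q : SpaceTime, q.1 ≤ a ∨ b ≤ q.1 →
      v q = 0 ∧ p q = 0 ∧ θ q = 0 ∧ R q = 0 ∧ f q = 0 := fun q hq =>
    hz q.1 q.2 fun hh => hq.elim (fun h => absurd hh.1 (by linarith))
      fun h => absurd hh.2 (by linarith)
  have hsup : SPF.Supported a b U S := by
    refine ⟨fun i q hq => ?_, fun i j q hq => ?_⟩ <;>
      obtain ⟨h1, -, h2, h3, h4⟩ := hz' q hq <;> cases i with
      | none => first | exact h2 | exact congrFun h4 j
      | some i => first | exact congrFun h1 i | exact congrFun (congrFun h3 i) j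
  have hδκ' : δ ≤ κ * √κ := by
    refine hδκ.trans (le_of_eq ?_)
    rw [show (3 : ℝ) / 2 = 1 + 1 / 2 by norm_num, Real.rpow_add hκ, Real.rpow_one,
      Real.sqrt_eq_rpow]
  have heq' := (SPF.boussStress_iff U P S).1 heq
  obtain ⟨W, S', hsup', hdiv, hsymm', hW, hS', hNL, hL, hLZ, hθz, hθ⟩ :=
    H hsup hδ hκ hκ1 hδκ' hV hR hf fun i j => SPF.ext' fun q => hsymm q i j
  have hzero' : ∀ t : ℝ, t ∉ Set.Ioo (a - κ) (b + κ) → t ≤ a - κ ∨ b + κ ≤ t := fun t ht => by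
    by_contra! hc
    exact ht hc
  refine ⟨SPF.vel fun i => U i + W i, p, (U none + W none : SPF), SPF.stress S', SPF.flux S',
    SPF.smooth_vel _, sp, (U none + W none).smooth, SPF.smooth_stress _, SPF.smooth_flux _,
    SPF.periodic_vel _, pp, (U none + W none).periodic, SPF.periodic_stress _,
    SPF.periodic_flux _, fun t x ht => ?_, fun q i j => congrArg (fun F : SPF => F q) (hsymm' i j), ?_,
    SPF.supNorm_le hδ.le (SPF.norm_stress_le hδ.le hS'),
    SPF.supNorm_le hδ.le (SPF.norm_flux_le hδ.le hS'), ?_, ?_, rfl, hL, hLZ, hθz, hθ⟩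
  · have ht' := hzero' t ht
    refine ⟨funext fun i => hsup'.U_zero (some i) (t, x) ht', (hz' (t, x) ?_).2.1,
      hsup'.U_zero none (t, x) ht', funext fun i => funext fun j =>
      hsup'.S_zero (some i) j (t, x) ht', funext fun j => hsup'.S_zero none j (t, x) ht'⟩
    exact ht'.imp (fun h => by linarith) fun h => by linarith
  · refine (SPF.boussStress_iff (fun i => U i + W i) P S').2 ⟨fun i => ?_, ?_, ?_⟩
    · rw [hNL, ← heq'.1 i]
      ring
    · simp only [map_add, Finset.sum_add_distrib, hdiv, heq'.2.1, add_zero]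
    · rw [hNL, heq'.2.2]
      ring
  · refine SPF.supNorm_le (by positivity) fun q => ?_
    refine (pi_norm_le_iff_of_nonneg (by positivity)).2 fun i => ?_
    have h1 : (SPF.vel (fun i => U i + W i) q - v q) i = W (some i) q := add_sub_cancel_left _ _
    rw [h1]
    exact hW (some i) q
  · refine SPF.supNorm_le (by positivity) fun q => ?_
    have h1 : (U none + W none : SPF) q - θ q = W none q := add_sub_cancel_left _ _
    rw [h1]
    exact hW none q
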